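/- arXiv:2203.05541 — 3 statements merged into one kernel-verified Lean document; each statement's English description precedes it below -/
import Mathlib

section
/- The only pairs (x, y) of rational numbers satisfying y^2 = (x^2 - x + 1)(x^4 + x^3 - 4x^2 - 3x + 9) are (0, 3), (0, -3), (1, 2), (1, -2), (-2, 7), (-2, -7), (3/2, 21/8), (3/2, -21/8), (-5/3, 154/27), and (-5/3, -154/27). -/
/-- The ring of integers `ℤ[α]`, `α² = α - 2`, of `ℚ(√-7)`. -/
abbrev O7 : Type := QuadraticAlgebra ℤ (-2) 1

namespace O7

open scoped QuadraticAlgebra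

/-- The generator `α = (1 + √-7) / 2`. -/
def α : O7 := ⟨0, 1⟩

theorem α_sq : α ^ 2 = α - 2 := by
  ext <;> simp [α, sq, QuadraticAlgebra.re_ofNat, QuadraticAlgebra.im_ofNat]

theorem eq_add_mul_α (z : O7) : z = z.re + z.im * α := by
  ext <;> simp [α]

/-- The norm on `ℤ[α]`. -/
abbrev N : O7 →* ℤ := QuadraticAlgebra.norm

theorem norm_eq (z : O7) : N z = z.re ^ 2 + z.re * z.im + 2 * z.im ^ 2 := by
  rw [QuadraticAlgebra.norm_def]; ring

theorem norm_nonneg (z : O7) : 0 ≤ N z := by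
  rw [norm_eq]; nlinarith [sq_nonneg (2 * z.re + z.im), sq_nonneg z.im]

theorem norm_eq_zero {z : O7} : N z = 0 ↔ z = 0 := by
  refine ⟨fun h => ?_, fun h => by simp [h]⟩
  rw [norm_eq] at h
  have h1 : z.im = 0 := by
    by_contra h0
    have := sq_pos_of_ne_zero h0
    nlinarith [sq_nonneg (2 * z.re + z.im)]
  have h2 : z.re = 0 := by simpa [h1] using h
  ext <;> simp [h1, h2]

instance : IsDomain O7 :=
  have : NoZeroDivisors O7 := ⟨fun {a b} h => by
    rw [← norm_eq_zero, ← norm_eq_zero, ← mul_eq_zero, ← map_mul, h, QuadraticAlgebra.norm_zero]⟩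
  NoZeroDivisors.to_isDomain _

theorem isUnit_iff {z : O7} : IsUnit z ↔ z = 1 ∨ z = -1 := by
  refine ⟨fun h => ?_, by rintro (rfl | rfl) <;> simp⟩
  have h1 : N z = 1 := by
    have := (QuadraticAlgebra.isUnit_iff_norm_isUnit.1 h)
    rcases Int.isUnit_iff.1 this with h | h
    · exact h
    · exact absurd (norm_nonneg z) (by rw [show N z = -1 from h]; decide)
  rw [norm_eq] at h1
  have h2 : z.im = 0 := by
    by_contra h0
    have : 1 ≤ z.im ^ 2 := Int.add_one_le_iff.2 (sq_pos_of_ne_zero h0)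
    nlinarith [sq_nonneg (2 * z.re + z.im)]
  have h3 : z.re = 1 ∨ z.re = -1 := by
    rw [h2] at h1
    exact mul_self_eq_one_iff.1 (by linarith)
  rcases h3 with h3 | h3
  · left; ext <;> simp [h2, h3]
  · right; ext <;> simp [h2, h3]

theorem exists_norm_sub_mul_lt (a : O7) {b : O7} (hb : b ≠ 0) :
    ∃ q : O7, N (a - b * q) < N b := by
  have hn : 0 < N b := lt_of_le_of_ne (norm_nonneg b) fun h => hb (norm_eq_zero.1 h.symm)
  set n := N b with hn'
  set c := a * star b with hc
  obtain ⟨y, hy⟩ : ∃ y : ℤ, |2 * (c.im - n * y)| ≤ n := by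
    refine ⟨(2 * c.im + n) / (2 * n), ?_⟩
    have h1 := Int.emod_add_mul_ediv (2 * c.im + n) (2 * n)
    have h2 := Int.emod_nonneg (2 * c.im + n) (by omega : 2 * n ≠ 0)
    have h3 := Int.emod_lt_of_pos (2 * c.im + n) (by omega : 0 < 2 * n)
    rw [abs_le]; constructor <;> nlinarith
  set v := c.im - n * y with hv
  obtain ⟨x, hx⟩ : ∃ x : ℤ, |2 * (c.re - n * x) + v| ≤ n := by
    refine ⟨(2 * c.re + v + n) / (2 * n), ?_⟩
    have h1 := Int.emod_add_mul_ediv (2 * c.re + v + n) (2 * n)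
    have h2 := Int.emod_nonneg (2 * c.re + v + n) (by omega : 2 * n ≠ 0)
    have h3 := Int.emod_lt_of_pos (2 * c.re + v + n) (by omega : 0 < 2 * n)
    rw [abs_le]; constructor <;> nlinarith
  set u := c.re - n * x with hu
  refine ⟨⟨x, y⟩, ?_⟩
  have key : N (a - b * ⟨x, y⟩) * n = u ^ 2 + u * v + 2 * v ^ 2 := by
    have h1 : (a - b * ⟨x, y⟩) * star b = ⟨u, v⟩ := by
      have : b * star b = (n : O7) := by
        rw [hn', ← QuadraticAlgebra.algebraMap_norm_eq_mul_star]; rfl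
      have : (a - b * ⟨x, y⟩) * star b = c - (n : O7) * ⟨x, y⟩ := by
        rw [← this]; ring
      rw [this]
      ext <;> simp [hu, hv]
    have h2 := congrArg N h1
    rw [map_mul, QuadraticAlgebra.norm_star] at h2
    rw [h2, norm_eq]
  have h4 : (2 * u + v) ^ 2 ≤ n ^ 2 := sq_le_sq' (abs_le.1 hx).1 (abs_le.1 hx).2
  have h5 : (2 * v) ^ 2 ≤ n ^ 2 := sq_le_sq' (abs_le.1 hy).1 (abs_le.1 hy).2
  nlinarith

noncomputable instance : EuclideanDomain O7 :=
  { (inferInstance : CommRing O7), (inferInstance : Nontrivial O7) with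
    quotient := fun a b => if hb : b = 0 then 0 else (exists_norm_sub_mul_lt a hb).choose
    remainder := fun a b => a - b * (if hb : b = 0 then 0 else (exists_norm_sub_mul_lt a hb).choose)
    quotient_zero := fun a => by simp
    quotient_mul_add_remainder_eq := fun a b => by ring
    r := fun a b => (N a).natAbs < (N b).natAbs
    r_wellFounded := (measure (Int.natAbs ∘ N)).wf
    remainder_lt := fun a b hb => by
      simp only [hb, dif_neg, not_false_eq_true]
      have := (exists_norm_sub_mul_lt a hb).choose_spec
      have h0 := norm_nonneg (a - b * (exists_norm_sub_mul_lt a hb).choose)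
      omega
    mul_left_not_lt := fun a b hb => by
      rw [not_lt, map_mul, Int.natAbs_mul]
      exact Nat.le_mul_of_pos_right _ (Int.natAbs_pos.2 fun h => hb (norm_eq_zero.1 h)) }

/-- If `a b` is a square and `P` is stable under multiplication by squares of primes and by the
common prime divisors of `a` and `b`, then `P a` holds. -/
theorem of_mul_eq_sq {P S : O7 → Prop} (h1 : ∀ u, IsUnit u → P u)
    (hsq : ∀ p x, P x → P (p ^ 2 * x)) (hS : ∀ p x, S p → P x → P (p * x))
    {c a b : O7} (hc : c ≠ 0) (h : a * b = c ^ 2)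
    (hab : ∀ p, Prime p → p ∣ a → p ∣ b → S p) : P a := by
  induction c using UniqueFactorizationMonoid.induction_on_prime generalizing a b with
  | h₁ => exact absurd rfl hc
  | h₂ u hu => exact h1 _ (isUnit_of_mul_isUnit_left (h ▸ hu.pow 2))
  | h₃ c p hc0 hp ih =>
    have hp0 := hp.ne_zero
    by_cases ha : p ∣ a
    · obtain ⟨a, rfl⟩ := ha
      by_cases hb : p ∣ b
      · obtain ⟨b, rfl⟩ := hb
        have hSp := hab p hp (Dvd.intro _ rfl) (Dvd.intro _ rfl)
        refine hS _ _ hSp (ih hc0 (b := b) ?_ fun q hq h2 h3 => hab q hq (h2.mul_left _) (h3.mul_left _))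
        exact mul_left_cancel₀ (pow_ne_zero 2 hp0) (by linear_combination h)
      · have : p ∣ a * b := by
          refine (mul_dvd_mul_iff_left hp0).1 ⟨c ^ 2, by linear_combination h⟩
        obtain ⟨a, rfl⟩ := (hp.dvd_or_dvd this).resolve_right hb
        rw [← mul_assoc, ← sq]
        refine hsq _ _ (ih hc0 (b := b) ?_ fun q hq h2 h3 =>
          hab q hq ((h2.mul_left _).mul_left _) h3)
        exact mul_left_cancel₀ (pow_ne_zero 2 hp0) (by linear_combination h)
    · have : p ∣ a * b := h ▸ ⟨p * c ^ 2, by ring⟩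
      obtain ⟨b, rfl⟩ := (hp.dvd_or_dvd this).resolve_left ha
      have : p ∣ a * b := by
        refine (mul_dvd_mul_iff_left hp0).1 ⟨c ^ 2, by linear_combination h⟩
      obtain ⟨b, rfl⟩ := (hp.dvd_or_dvd this).resolve_left ha
      refine (ih hc0 (b := b) ?_ fun q hq h2 h3 => hab q hq h2 ((h3.mul_left _).mul_left _))
      exact mul_left_cancel₀ (pow_ne_zero 2 hp0) (by linear_combination h)

end O7

namespace O7
open scoped QuadraticAlgebra

/-- If every common prime divisor of `a` and `b` divides `s` and `a b` is a nonzero square, then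
`a` is a square up to a divisor of `s`. -/
theorem exists_eq_mul_sq {a b c s : O7} (hc : c ≠ 0) (h : a * b = c ^ 2)
    (hab : ∀ p, Prime p → p ∣ a → p ∣ b → p ∣ s) : ∃ δ z, δ ∣ s ∧ a = δ * z ^ 2 := by
  refine of_mul_eq_sq (P := fun a => ∃ δ z, δ ∣ s ∧ a = δ * z ^ 2) (S := fun p => Prime p ∧ p ∣ s)
    (fun u hu => ⟨u, 1, hu.dvd, by ring⟩) ?_ ?_ hc h fun p hp h1 h2 => ⟨hp, hab p hp h1 h2⟩
  · rintro p x ⟨δ, z, h1, rfl⟩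
    exact ⟨δ, p * z, h1, by ring⟩
  · rintro p x ⟨hp, hps⟩ ⟨δ, z, ⟨δ', rfl⟩, rfl⟩
    rcases hp.dvd_or_dvd hps with ⟨δ, rfl⟩ | ⟨δ', rfl⟩
    · exact ⟨δ, p * z, ⟨p * δ', by ring⟩, by ring⟩
    · exact ⟨p * δ, z, ⟨δ', by ring⟩, by ring⟩

theorem prime_of_norm {z : O7} {p : ℤ} (hp : Prime p) (h : N z = p) : Prime z := by
  rw [← irreducible_iff_prime]
  refine ⟨fun hz => ?_, fun a b hab => ?_⟩
  · have := hz.map N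
    rw [h] at this
    exact hp.not_isUnit this
  · rw [hab, map_mul] at h
    have h2 : Irreducible (N a * N b) := h ▸ hp.irreducible
    exact (h2.isUnit_or_isUnit rfl).imp QuadraticAlgebra.isUnit_iff_norm_isUnit.2
      QuadraticAlgebra.isUnit_iff_norm_isUnit.2

/-- The conjugate `1 - α` of `α`. -/
def β : O7 := 1 - α

/-- The square root `2 α - 1` of `-7`. -/
def ρ : O7 := 2 * α - 1

theorem prime_β : Prime β :=
  prime_of_norm (p := 2) Int.prime_two (by rw [norm_eq]; simp [β, α])

theorem prime_ρ : Prime ρ :=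
  prime_of_norm (p := 7) (by norm_num) (by
    rw [norm_eq]; simp [ρ, α, QuadraticAlgebra.re_ofNat, QuadraticAlgebra.im_ofNat])

theorem three_dvd_iff {z : O7} : 3 ∣ z ↔ 3 ∣ N z := by
  constructor
  · rintro ⟨w, rfl⟩
    rw [map_mul, show N 3 = 9 by
      rw [norm_eq]; simp [QuadraticAlgebra.re_ofNat, QuadraticAlgebra.im_ofNat]]
    exact ⟨3 * N w, by ring⟩
  · intro h
    have key : ∀ x y : ZMod 3, x ^ 2 + x * y + 2 * y ^ 2 = 0 → x = 0 ∧ y = 0 := by decide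
    rw [norm_eq] at h
    obtain ⟨h1, h2⟩ := key z.re z.im (by exact_mod_cast (ZMod.intCast_zmod_eq_zero_iff_dvd _ 3).2 h)
    obtain ⟨x, hx⟩ := (ZMod.intCast_zmod_eq_zero_iff_dvd _ 3).1 h1
    obtain ⟨y, hy⟩ := (ZMod.intCast_zmod_eq_zero_iff_dvd _ 3).1 h2
    refine ⟨⟨x, y⟩, ?_⟩
    ext <;> simp [hx, hy, QuadraticAlgebra.re_ofNat, QuadraticAlgebra.im_ofNat]

theorem prime_three : Prime (3 : O7) := by
  refine ⟨by decide, fun h => ?_, fun a b h => ?_⟩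
  · rw [isUnit_iff] at h
    revert h; decide
  · rw [three_dvd_iff, map_mul] at h
    rw [three_dvd_iff, three_dvd_iff]
    exact Int.prime_three.dvd_or_dvd h

theorem dvd_prime_mul {p s δ : O7} (hp : Prime p) (h : δ ∣ p * s) :
    δ ∣ s ∨ ∃ δ', δ' ∣ s ∧ δ = p * δ' := by
  obtain ⟨e, he⟩ := h
  rcases hp.dvd_or_dvd (Dvd.intro s he) with ⟨δ', rfl⟩ | ⟨e', rfl⟩
  · exact Or.inr ⟨δ', ⟨e, mul_left_cancel₀ hp.ne_zero (by linear_combination he)⟩, rfl⟩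
  · exact Or.inl ⟨e', mul_left_cancel₀ hp.ne_zero (by linear_combination he)⟩

theorem dvd_prime {p δ : O7} (hp : Prime p) (h : δ ∣ p) : δ = 1 ∨ δ = -1 ∨ δ = p ∨ δ = -p := by
  rcases dvd_prime_mul hp (s := 1) (by simpa using h) with h1 | ⟨δ, h1, rfl⟩
  · rcases isUnit_iff.1 (isUnit_of_dvd_one h1) with rfl | rfl <;> simp
  · rcases isUnit_iff.1 (isUnit_of_dvd_one h1) with rfl | rfl <;> simp

variable {K : Type*} [Field K] [Algebra O7 K] [IsFractionRing O7 K]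

theorem exists_of_sq_eq {y : K} {c : O7} (h : y ^ 2 = algebraMap O7 K c) :
    ∃ z, algebraMap O7 K z = y :=
  IsIntegrallyClosed.exists_algebraMap_eq_of_isIntegral_pow (n := 2) two_pos
    (h ▸ isIntegral_algebraMap)

theorem exists_coprime (x : K) : ∃ n d : O7, IsCoprime n d ∧ d ≠ 0 ∧
    x = algebraMap O7 K n / algebraMap O7 K d := by
  obtain ⟨n, d, h, h1⟩ := IsFractionRing.exists_reduced_fraction (A := O7) x
  refine ⟨n, d, h.isCoprime, nonZeroDivisors.ne_zero d.2, ?_⟩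
  rw [← h1, IsFractionRing.mk'_eq_div]

/-- The image of `x`-coordinates under the descent map: on `y² = x (x² + A x + B)` the coordinate
`x` is a square up to divisors of `B`. -/
theorem exists_x_eq_mul_sq {A B s : O7} (hs : ∀ p, Prime p → p ∣ B → p ∣ s) {x y : K} (hy : y ≠ 0)
    (h : y ^ 2 = x * (x ^ 2 + algebraMap O7 K A * x + algebraMap O7 K B)) :
    ∃ δ : O7, ∃ z : K, δ ∣ s ∧ x = algebraMap O7 K δ * z ^ 2 := by
  obtain ⟨n, d, hnd, hd, rfl⟩ := exists_coprime x
  have inj := IsFractionRing.injective O7 K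
  have hd' : algebraMap O7 K d ≠ 0 := (map_ne_zero_iff _ inj).2 hd
  have h1 : (y * algebraMap O7 K d ^ 2) ^ 2 =
      algebraMap O7 K (n * (d * (n ^ 2 + A * n * d + B * d ^ 2))) := by
    rw [mul_pow, h]; simp only [map_mul, map_add, map_pow]; field_simp
  obtain ⟨c, hc⟩ := exists_of_sq_eq h1
  rw [← hc, ← map_pow] at h1
  have h2 := inj h1
  have hc0 : c ≠ 0 := by
    rintro rfl
    rw [map_zero] at hc
    exact mul_ne_zero hy (pow_ne_zero 2 hd') hc.symm
  have cop : ∀ p, Prime p → p ∣ n → p ∣ d → False := fun p hp h3 h4 =>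
    hp.not_isUnit (hnd.isUnit_of_dvd' h3 h4)
  obtain ⟨δ, z, hδ, hz⟩ := exists_eq_mul_sq (s := s) hc0 h2.symm fun p hp h3 h4 => by
    rcases hp.dvd_or_dvd h4 with h4 | h4
    · exact (cop p hp h3 h4).elim
    · have h5 : p ∣ B * d ^ 2 := (dvd_add_right
        (h3.trans ⟨n + A * d, by ring⟩ : p ∣ n ^ 2 + A * n * d)).1 h4
      rcases hp.dvd_or_dvd h5 with h5 | h5
      · exact hs p hp h5
      · exact (cop p hp h3 (hp.dvd_of_dvd_pow h5)).elim
  obtain ⟨ε, w, hε, hw⟩ := exists_eq_mul_sq (s := 1) (a := d)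
    (b := n * (n ^ 2 + A * n * d + B * d ^ 2)) hc0 (by linear_combination -h2) fun p hp h3 h4 => by
      rcases hp.dvd_or_dvd h4 with h4 | h4
      · exact (cop p hp h4 h3).elim
      · have h5 : p ∣ n ^ 2 := (dvd_add_left
          (h3.trans ⟨A * n + B * d, by ring⟩ : p ∣ A * n * d + B * d ^ 2)).1 (by
            rwa [← add_assoc])
        exact (cop p hp (hp.dvd_of_dvd_pow h5) h3).elim
  have hε2 : ε ^ 2 = 1 := by
    rcases isUnit_iff.1 (isUnit_of_dvd_one hε) with rfl | rfl <;> ring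
  refine ⟨ε * δ, algebraMap O7 K z / algebraMap O7 K w, ?_, ?_⟩
  · exact (isUnit_of_dvd_one hε).mul_left_dvd.2 hδ
  · have hw' : algebraMap O7 K w ≠ 0 := by
      rintro h0
      rw [hw, map_mul, map_pow, h0] at hd'
      simp at hd'
    have hε' : algebraMap O7 K ε ^ 2 = 1 := by rw [← map_pow, hε2, map_one]
    have hε0 : algebraMap O7 K ε ≠ 0 := by
      rintro h0
      simp [h0] at hε'
    rw [hz, hw]
    simp only [map_mul, map_pow]
    field_simp
    rw [hε']; ring

end O7

/-- Reduction modulo `8` on the `2`-adic integers. -/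
noncomputable def res8 : ℤ_[2] →+* ZMod 8 := PadicInt.toZModPow 3

/-- `R8 x n c` means `x = 2 ^ n * u` for a `2`-adic integer `u` with `u ≡ c` modulo `8`. -/
def R8 (x : ℚ_[2]) (n : ℤ) (c : ZMod 8) : Prop := ∃ u : ℤ_[2], x = 2 ^ n * u ∧ res8 u = c

namespace R8

variable {x y : ℚ_[2]} {n m : ℤ} {c d : ZMod 8}

theorem of_eq (h : R8 x n c) (hx : x = y) (hn : n = m) (hc : c = d) : R8 y m d := by
  rwa [← hx, ← hn, ← hc]

theorem isUnit_of_sq {u : ℤ_[2]} (h : res8 u ^ 2 = 1) : IsUnit u := by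
  by_contra hu
  rw [PadicInt.not_isUnit_iff, PadicInt.norm_lt_one_iff_dvd] at hu
  obtain ⟨v, rfl⟩ := hu
  rw [map_mul] at h
  have : res8 ((2 : ℕ) : ℤ_[2]) = 2 := map_natCast res8 2
  rw [this] at h
  revert h
  generalize res8 v = e
  revert e; decide

theorem sq_of_isUnit {u : ℤ_[2]} (h : IsUnit u) : res8 u ^ 2 = 1 := by
  obtain ⟨v, hv⟩ := (h.map res8).exists_right_inv
  revert hv
  generalize res8 u = e
  revert e v; decide

theorem exists_of_ne_zero (hx : x ≠ 0) : ∃ n c, c ^ 2 = 1 ∧ R8 x n c := by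
  have h2 : (2 : ℚ_[2]) ≠ 0 := two_ne_zero
  have hu : ‖x * 2 ^ (-x.valuation)‖ = 1 := by
    have := Padic.norm_eq_zpow_neg_valuation hx
    have h3 := Padic.norm_p_zpow (p := 2) (-x.valuation)
    push_cast at h3 this
    rw [norm_mul, this, h3, neg_neg, ← zpow_add₀ (by norm_num), neg_add_cancel, zpow_zero]
  refine ⟨x.valuation, res8 ⟨_, hu.le⟩, sq_of_isUnit (PadicInt.isUnit_iff.2 hu), ⟨_, hu.le⟩, ?_, rfl⟩
  show x = 2 ^ x.valuation * (x * 2 ^ (-x.valuation))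
  rw [mul_comm x, ← mul_assoc, ← zpow_add₀ h2]; simp

theorem ne_zero (hx : R8 x n c) (hc : c ^ 2 = 1) : x ≠ 0 := by
  obtain ⟨u, rfl, rfl⟩ := hx
  have := (isUnit_of_sq hc).ne_zero
  exact mul_ne_zero (zpow_ne_zero _ two_ne_zero) (PadicInt.coe_ne_zero.2 this)

theorem unique (hx : R8 x n c) (hy : R8 x m d) (hc : c ^ 2 = 1) (hd : d ^ 2 = 1) :
    n = m ∧ c = d := by
  obtain ⟨u, hu, rfl⟩ := hx
  obtain ⟨v, hv, rfl⟩ := hy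
  have h1 := PadicInt.isUnit_iff.1 (isUnit_of_sq hc)
  have h2 := PadicInt.isUnit_iff.1 (isUnit_of_sq hd)
  have h : (2 : ℚ_[2]) ^ n * u = 2 ^ m * v := hu ▸ hv
  have h3 := congrArg norm h
  have h4 := Padic.norm_p_zpow (p := 2) n
  have h5 := Padic.norm_p_zpow (p := 2) m
  push_cast at h4 h5
  rw [norm_mul, norm_mul, ← PadicInt.norm_def, ← PadicInt.norm_def, h1, h2, h4, h5, mul_one,
    mul_one] at h3
  have h6 : n = m := by
    have := zpow_right_injective₀ (a := (2 : ℝ)) (by norm_num) (by norm_num) h3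
    omega
  subst h6
  refine ⟨rfl, congrArg res8 ?_⟩
  exact PadicInt.ext (mul_left_cancel₀ (zpow_ne_zero n two_ne_zero) h)

theorem class_unique (hx : R8 x n c) (hy : R8 x n d) : c = d := by
  obtain ⟨u, hu, rfl⟩ := hx
  obtain ⟨v, hv, rfl⟩ := hy
  have h : (2 : ℚ_[2]) ^ n * u = 2 ^ n * v := hu ▸ hv
  exact congrArg res8 (PadicInt.ext (mul_left_cancel₀ (zpow_ne_zero n two_ne_zero) h))

theorem mul (hx : R8 x n c) (hy : R8 y m d) : R8 (x * y) (n + m) (c * d) := by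
  obtain ⟨u, rfl, rfl⟩ := hx
  obtain ⟨v, rfl, rfl⟩ := hy
  refine ⟨u * v, ?_, map_mul _ _ _⟩
  rw [zpow_add₀ two_ne_zero]; push_cast; ring

theorem sq (hx : R8 x n c) : R8 (x ^ 2) (2 * n) (c ^ 2) := by
  rw [pow_two, pow_two, two_mul]; exact hx.mul hx

theorem inv (hx : R8 x n c) (hc : c ^ 2 = 1) : R8 x⁻¹ (-n) c := by
  obtain ⟨u, rfl, rfl⟩ := hx
  obtain ⟨v, hv⟩ := (isUnit_of_sq hc).exists_right_inv
  refine ⟨v, ?_, ?_⟩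
  · have : (u : ℚ_[2]) * v = 1 := by rw [← PadicInt.coe_mul, hv, PadicInt.coe_one]
    rw [mul_inv, zpow_neg, eq_inv_of_mul_eq_one_right this]
  · have := congrArg res8 hv
    rw [map_mul, map_one] at this
    calc res8 v = res8 u ^ 2 * res8 v := by rw [hc, one_mul]
      _ = res8 u * (res8 u * res8 v) := by ring
      _ = res8 u := by rw [this, mul_one]

theorem div (hx : R8 x n c) (hy : R8 y m d) (hd : d ^ 2 = 1) : R8 (x / y) (n - m) (c * d) := by
  rw [div_eq_mul_inv, sub_eq_add_neg]; exact hx.mul (hy.inv hd)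

theorem shift (hx : R8 x n c) (k : ℕ) : R8 x (n - k) (2 ^ k * c) := by
  obtain ⟨u, rfl, rfl⟩ := hx
  refine ⟨2 ^ k * u, ?_, by rw [map_mul, map_pow, map_ofNat]⟩
  have : ((2 : ℤ_[2]) : ℚ_[2]) = 2 := rfl
  rw [zpow_sub₀ two_ne_zero, zpow_natCast, PadicInt.coe_mul, PadicInt.coe_pow, this]
  field_simp

theorem add (hx : R8 x n c) (hy : R8 y n d) : R8 (x + y) n (c + d) := by
  obtain ⟨u, rfl, rfl⟩ := hx
  obtain ⟨v, rfl, rfl⟩ := hy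
  exact ⟨u + v, by push_cast; ring, map_add _ _ _⟩

theorem neg (hx : R8 x n c) : R8 (-x) n (-c) := by
  obtain ⟨u, rfl, rfl⟩ := hx
  exact ⟨-u, by push_cast; ring, map_neg _ _⟩

theorem sub (hx : R8 x n c) (hy : R8 y n d) : R8 (x - y) n (c - d) := by
  rw [sub_eq_add_neg, sub_eq_add_neg]; exact hx.add hy.neg

/-- Lower the exponent by at least three. -/
theorem shift3 (hx : R8 x n c) (h : m + 3 ≤ n) : R8 x m 0 := by
  obtain ⟨k, hk⟩ := Int.eq_ofNat_of_zero_le (sub_nonneg.2 h)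
  have := hx.shift (k + 3)
  rw [show n - ((k + 3 : ℕ) : ℤ) = m by push_cast; omega, pow_add,
    show (2 : ZMod 8) ^ 3 = 0 by decide, mul_zero, zero_mul] at this
  exact this

/-- Lower the exponent. -/
theorem lower (hx : R8 x n c) (h : m ≤ n) : ∃ d, R8 x m d := by
  obtain ⟨k, hk⟩ := Int.eq_ofNat_of_zero_le (sub_nonneg.2 h)
  have := hx.shift k
  rw [show n - (k : ℤ) = m by omega] at this
  exact ⟨_, this⟩

/-- Lower the exponent by at least one. -/
theorem lower_even (hx : R8 x n c) (h : m < n) : ∃ d, R8 x m (2 * d) := by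
  obtain ⟨d, hd⟩ := hx.lower (Int.add_one_le_of_lt h)
  have := hd.shift 1
  rw [show m + 1 - ((1 : ℕ) : ℤ) = m by push_cast; omega, pow_one] at this
  exact ⟨d, this⟩

theorem le_of_unit (hx : R8 x n c) (hc : c ^ 2 = 1) (hy : R8 x m d) : m ≤ n := by
  by_contra! h
  obtain ⟨e, he⟩ := hy.lower_even h
  obtain rfl := hx.class_unique he
  clear * - hc; revert e; decide

/-- Raise the exponent by one. -/
theorem raise (hx : R8 x n (2 * c)) : ∃ d, 2 * d = 2 * c ∧ R8 x (n + 1) d := by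
  obtain ⟨u, rfl, hu⟩ := hx
  have h : ¬ IsUnit u := fun h => by
    have := sq_of_isUnit h
    rw [hu] at this
    clear hu; revert c; decide
  rw [PadicInt.not_isUnit_iff, PadicInt.norm_lt_one_iff_dvd] at h
  obtain ⟨v, rfl⟩ := h
  refine ⟨res8 v, ?_, v, ?_, rfl⟩
  · rw [← hu, map_mul, show res8 ((2 : ℕ) : ℤ_[2]) = 2 from map_natCast res8 2]
  · have : (((2 : ℕ) : ℤ_[2]) : ℚ_[2]) = 2 := rfl
    rw [zpow_add₀ two_ne_zero, zpow_one, PadicInt.coe_mul, this, mul_assoc]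

/-- Raise the exponent by three. -/
theorem raise3 (hx : R8 x n 0) : ∃ d, R8 x (n + 3) d := by
  obtain ⟨c, hc, h⟩ := raise (c := 0) hx
  have h1 : ∃ e, c = 2 * (2 * e) := by clear * - hc; revert c; decide
  obtain ⟨e, rfl⟩ := h1
  clear hc
  obtain ⟨c, hc, h⟩ := h.raise
  have h1 : ∃ e, c = 2 * e := by clear * - hc; revert c e; decide
  obtain ⟨e, rfl⟩ := h1
  obtain ⟨c, -, h⟩ := h.raise
  exact ⟨c, h.of_eq rfl (by ring) rfl⟩

theorem add_of_lt (hx : R8 x n c) (hy : R8 y m d) (h : n + 3 ≤ m) : R8 (x + y) n c := by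
  simpa using hx.add (hy.shift3 h)

theorem sub_of_lt (hx : R8 x n c) (hy : R8 y m d) (h : n + 3 ≤ m) : R8 (x - y) n c := by
  simpa using hx.sub (hy.shift3 h)

theorem one : R8 1 0 1 := ⟨1, by simp, map_one _⟩

theorem intCast (k : ℤ) : R8 k 0 k := ⟨k, by simp, map_intCast _ _⟩

theorem ofNat (k : ℕ) [k.AtLeastTwo] : R8 ofNat(k) 0 ofNat(k) :=
  ⟨OfNat.ofNat k, by rw [zpow_zero, one_mul]; rfl, map_ofNat _ _⟩

theorem two : R8 2 1 1 := ⟨1, by simp, map_one _⟩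

theorem four : R8 4 2 1 := ⟨1, by norm_num, map_one _⟩

/-- A nonzero square has even valuation and unit part congruent to `1`. -/
theorem of_sq (hx : R8 (x ^ 2) n c) (hc : c ^ 2 = 1) :
    c = 1 ∧ ∃ m d, n = 2 * m ∧ d ^ 2 = 1 ∧ R8 x m d := by
  have hx0 : x ≠ 0 := by
    rintro rfl
    exact hx.ne_zero hc (by simp)
  obtain ⟨m, d, hd, h⟩ := exists_of_ne_zero hx0
  have := hx.unique h.sq hc (by rw [hd]; decide)
  exact ⟨this.2.trans hd, m, d, this.1, hd, h⟩

/-- The valuations of two numbers with given sum and product. -/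
theorem val_of_add_of_mul {e : ZMod 8} {k : ℤ} (hP : R8 (x * y) 0 c) (hc : c ^ 2 = 1)
    (hS : R8 (x + y) (-2 * k) e) (he : e ^ 2 = 1) (hk : 1 ≤ k) :
    R8 x (-2 * k) e ∨ R8 x (2 * k) (c * e) := by
  have h0 := hP.ne_zero hc
  have main : ∀ {x y : ℚ_[2]} {n m : ℤ} {a b : ZMod 8}, a ^ 2 = 1 → R8 x n a → R8 y m b →
      n + m = 0 → R8 (x + y) (-2 * k) e → n < m → R8 x (-2 * k) e := by
    intro x y n m a b ha hx hy hnm hS hlt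
    have hn : n = -2 * k := by
      obtain ⟨d, hd⟩ := hy.lower_even hlt
      exact ((hx.add hd).unique hS (by clear * - ha; revert a d; decide) he).1
    obtain rfl : e = a := hS.class_unique ((hn ▸ hx).add_of_lt hy (by omega))
    exact hn ▸ hx
  obtain ⟨n, a, ha, hx⟩ := exists_of_ne_zero (left_ne_zero_of_mul h0)
  obtain ⟨m, b, hb, hy⟩ := exists_of_ne_zero (right_ne_zero_of_mul h0)
  have hnm : n + m = 0 := ((hx.mul hy).unique hP (by rw [mul_pow, ha, hb, one_mul]) hc).1
  rcases lt_trichotomy n m with h | rfl | h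
  · exact Or.inl (main ha hx hy hnm hS h)
  · have := hS.le_of_unit he (hx.add hy)
    omega
  · have h1 := main hb hy hx (by omega) (by rwa [add_comm]) h
    have h2 := hP.div h1 he
    rw [mul_div_cancel_right₀ _ (right_ne_zero_of_mul h0)] at h2
    exact Or.inr (h2.of_eq rfl (by ring) rfl)

/-- One of two numbers has the valuation of the sum if the product has large valuation. -/
theorem exists_val_eq {e : ZMod 8} {S T : ℤ} (hS : R8 (x + y) S e) (he : e ^ 2 = 1)
    (hP : R8 (x * y) T d) (hT : 2 * S < T) :
    (∃ c, c ^ 2 = 1 ∧ R8 x S c) ∨ ∃ c, c ^ 2 = 1 ∧ R8 y S c := by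
  by_cases hx0 : x = 0
  · rw [hx0, zero_add] at hS
    exact Or.inr ⟨e, he, hS⟩
  by_cases hy0 : y = 0
  · rw [hy0, add_zero] at hS
    exact Or.inl ⟨e, he, hS⟩
  obtain ⟨n, a, ha, hx⟩ := exists_of_ne_zero hx0
  obtain ⟨m, b, hb, hy⟩ := exists_of_ne_zero hy0
  have hnm : T ≤ n + m := (hx.mul hy).le_of_unit (by rw [mul_pow, ha, hb, one_mul]) hP
  have key : ∀ {a d : ZMod 8}, a ^ 2 = 1 → (a + 2 * d) ^ 2 = 1 := by decide
  rcases lt_trichotomy n m with h | rfl | h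
  · obtain ⟨d, hd⟩ := hy.lower_even h
    obtain rfl := ((hx.add hd).unique hS (key ha) he).1
    exact Or.inl ⟨a, ha, hx⟩
  · have := hS.le_of_unit he (hx.add hy)
    omega
  · obtain ⟨d, hd⟩ := hx.lower_even h
    rw [add_comm] at hS
    obtain rfl := ((hy.add hd).unique hS (key hb) he).1
    exact Or.inr ⟨b, hb, hy⟩

end R8

namespace O7

theorem exists_padic_root : ∃ b : ℤ_[2], b ^ 2 = b - 2 ∧ res8 b = 3 := by
  obtain ⟨b, hb, -⟩ := hensels_lemma (R := ℤ) (p := 2)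
    (F := (Polynomial.X ^ 2 - Polynomial.X + 2 : Polynomial ℤ)) (a := 3) (by
      have h1 : Polynomial.aeval (3 : ℤ_[2]) (Polynomial.X ^ 2 - Polynomial.X + 2 : Polynomial ℤ)
          = ((2 : ℕ) : ℤ_[2]) ^ 3 := by
        simp only [map_add, map_sub, map_pow, Polynomial.aeval_X, map_ofNat]; norm_num
      have h2 : Polynomial.aeval (3 : ℤ_[2])
          (Polynomial.derivative (Polynomial.X ^ 2 - Polynomial.X + 2 : Polynomial ℤ))
          = ((5 : ℕ) : ℤ_[2]) := by
        simp [map_ofNat (Polynomial.aeval (3 : ℤ_[2])) 2]; norm_num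
      rw [h1, h2, PadicInt.norm_p_pow, PadicInt.norm_natCast_eq_one_iff.2 (by norm_num)]
      norm_num)
  have h : b ^ 2 = b - 2 := by
    simp only [map_add, map_sub, map_pow, Polynomial.aeval_X, map_ofNat] at hb
    linear_combination hb
  have key : ∀ z : ZMod 8, z ^ 2 = z - 2 → z = 3 ∨ 1 - z = 3 := by decide
  rcases key (res8 b) (by rw [← map_pow, h, map_sub, map_ofNat]) with h1 | h1
  · exact ⟨b, h, h1⟩
  · exact ⟨1 - b, by linear_combination h, by rw [map_sub, map_one, h1]⟩

variable {K : Type*} [Field K] [Algebra O7 K]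

/-- Embeddings of `K` into `ℚ_[2]` for which `β` is a unit. -/
def IsPlaceα (σ : K →+* ℚ_[2]) : Prop := R8 (σ (algebraMap O7 K β)) 0 3

/-- Embeddings of `K` into `ℚ_[2]` for which `α` is a unit. -/
def IsPlaceβ (σ : K →+* ℚ_[2]) : Prop := R8 (σ (algebraMap O7 K α)) 0 3

theorem exists_embedding [IsFractionRing O7 K] {b : ℤ_[2]} (h : b ^ 2 = b - 2) :
    ∃ σ : K →+* ℚ_[2], σ (algebraMap O7 K α) = b := by
  have h' : (b : ℚ_[2]) * b = (-2 : ℤ) • (1 : ℚ_[2]) + (1 : ℤ) • (b : ℚ_[2]) := by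
    have := congrArg (PadicInt.Coe.ringHom (p := 2)) h
    rw [map_pow, map_sub, map_ofNat] at this
    change (b : ℚ_[2]) ^ 2 = b - 2 at this
    simp only [zsmul_eq_mul]
    push_cast
    linear_combination this
  let τ : O7 →ₐ[ℤ] ℚ_[2] := QuadraticAlgebra.lift ⟨(b : ℚ_[2]), h'⟩
  have hτ : τ α = b := by simp [τ, α]
  have inj : Function.Injective (τ : O7 →+* ℚ_[2]) := by
    rw [injective_iff_map_eq_zero]
    intro z (hz : τ z = 0)
    have h1 : τ (z * star z) = 0 := by rw [map_mul, hz, zero_mul]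
    rw [← QuadraticAlgebra.algebraMap_norm_eq_mul_star, AlgHom.commutes] at h1
    exact norm_eq_zero.1 (by simpa using h1)
  exact ⟨IsFractionRing.lift (g := (τ : O7 →+* ℚ_[2])) inj, by
    rw [IsFractionRing.lift_algebraMap]; exact hτ⟩

theorem exists_isPlaceβ [IsFractionRing O7 K] : ∃ σ : K →+* ℚ_[2], IsPlaceβ σ := by
  obtain ⟨b, h, h3⟩ := exists_padic_root
  obtain ⟨σ, hσ⟩ := exists_embedding (K := K) h
  exact ⟨σ, b, by rw [hσ]; simp, h3⟩

theorem exists_isPlaceα [IsFractionRing O7 K] : ∃ σ : K →+* ℚ_[2], IsPlaceα σ := by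
  obtain ⟨b, h, h3⟩ := exists_padic_root
  obtain ⟨σ, hσ⟩ := exists_embedding (K := K) (b := 1 - b) (by linear_combination h)
  exact ⟨σ, b, by rw [β, map_sub, map_sub, hσ]; simp, h3⟩

theorem α_mul_β : α * β = 2 := by rw [β]; linear_combination -α_sq

variable {σ : K →+* ℚ_[2]}

theorem IsPlaceα.β (h : IsPlaceα σ) : R8 (σ (algebraMap O7 K β)) 0 3 := h

theorem IsPlaceβ.α (h : IsPlaceβ σ) : R8 (σ (algebraMap O7 K α)) 0 3 := h

theorem map_α_mul_map_β : σ (algebraMap O7 K α) * σ (algebraMap O7 K β) = 2 := by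
  rw [← map_mul, ← map_mul, α_mul_β, map_ofNat, map_ofNat]

theorem IsPlaceα.α (h : IsPlaceα σ) : R8 (σ (algebraMap O7 K α)) 1 3 := by
  have h0 := h.β.ne_zero (by decide)
  have := R8.two.div h.β (by decide)
  rwa [div_eq_of_eq_mul h0 map_α_mul_map_β.symm] at this

theorem IsPlaceβ.β (h : IsPlaceβ σ) : R8 (σ (algebraMap O7 K β)) 1 3 := by
  have h0 := h.α.ne_zero (by decide)
  have := R8.two.div h.α (by decide)
  rwa [div_eq_of_eq_mul h0 (by rw [mul_comm]; exact map_α_mul_map_β.symm)] at this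

theorem IsPlaceα.ρ (h : IsPlaceα σ) : R8 (σ (algebraMap O7 K ρ)) 0 3 := by
  rw [O7.ρ, map_sub, map_sub, map_mul, map_mul, map_ofNat, map_ofNat, map_one, map_one]
  exact (((R8.two.mul h.α).shift 2).of_eq rfl (by norm_num) rfl).sub R8.one

theorem IsPlaceβ.ρ (h : IsPlaceβ σ) : R8 (σ (algebraMap O7 K ρ)) 0 5 := by
  rw [O7.ρ, map_sub, map_sub, map_mul, map_mul, map_ofNat, map_ofNat, map_one, map_one]
  exact (((R8.two.mul h.α).shift 1).of_eq rfl (by norm_num) rfl).sub R8.one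

end O7

namespace R8

variable {x y X A B C a f : ℚ_[2]} {n m k : ℤ} {c d e : ZMod 8}

/-- On `y² = x (x² - 4 a x + C)` with `C = 2⁸ c`, `c ≡ 3` modulo `8` and `a ≡ 3` modulo `4`, the
coordinate `x` has even valuation. -/
theorem even_of_sq_eq (ha : R8 a 0 d) (hd : d = 3 ∨ d = 7) (hC : R8 C 8 3) (hx : R8 x n c)
    (hc : c ^ 2 = 1) (h : y ^ 2 = x * (x ^ 2 - 4 * a * x + C)) : Even n := by
  by_contra hn
  rw [Int.not_even_iff_odd] at hn
  have hax := (four.mul ha).mul hx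
  obtain ⟨j, rfl⟩ := hn
  have key : ∀ {m e}, R8 (x ^ 2 - 4 * a * x + C) m e → (c * e) ^ 2 = 1 →
      c * e = 1 ∧ Even (2 * j + 1 + m) := fun {m e} hz he => by
    have := hx.mul hz
    rw [← h] at this
    obtain ⟨h1, i, -, h2, -⟩ := this.of_sq he
    exact ⟨h1, i, by omega⟩
  have hj : j ≤ 0 ∨ j = 1 ∨ j = 2 ∨ 3 ≤ j := by omega
  rcases hj with hj | rfl | rfl | hj
  · obtain ⟨e, he⟩ := hax.lower_even (m := 2 * (2 * j + 1)) (by omega)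
    obtain ⟨i, hi⟩ := (key ((hx.sq.sub he).add (hC.shift3 (by omega)))
      (by clear key hax hx he; revert c e; decide)).2
    omega
  · have := key ((((hx.sq).shift 1).sub (hax.of_eq rfl (by norm_num) rfl)).add
      (hC.shift3 (by norm_num)))
    revert this; clear hx key hax ha h; revert c d; decide
  · have := key (((hx.sq.shift3 (by norm_num)).sub (hax.of_eq (m := 7) rfl (by norm_num) rfl)).add
      ((hC.shift 1).of_eq rfl (by norm_num) rfl))
    revert this; clear hx key hax ha h; revert c d; decide
  · obtain ⟨e, he⟩ := hax.lower_even (m := 8) (by omega)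
    obtain ⟨i, hi⟩ := (key (((hx.sq.shift3 (by omega)).sub he).add hC)
      (by clear key hax hx he; revert c e; decide)).2
    omega

/-- The duplication formula `4 x (x² + A x + B) X = (x² - B)²` at points with pole. -/
theorem dup_of_neg (hA : R8 A 1 d) (hB : R8 B 0 1) (hx : R8 x n 1) (hn : n ≤ -2)
    (h : 4 * x * (x ^ 2 + A * x + B) * X = (x ^ 2 - B) ^ 2) : R8 X (n - 2) 1 := by
  have h1 := (hx.sq.sub_of_lt hB (by omega)).sq
  have h2 := (four.mul hx).mul ((hx.sq.add_of_lt (hA.mul hx) (by omega)).add_of_lt hB (by omega))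
  rw [← h] at h1
  have h3 := h1.div h2 (by decide)
  rw [mul_div_cancel_left₀ _ (h2.ne_zero (by decide))] at h3
  exact h3.of_eq rfl (by ring) (by decide)

/-- The duplication formula `4 x (x² + A x + B) X = (x² - B)²` at points near `x = 0`. -/
theorem dup_of_pos (hA : R8 A 1 d) (hB : R8 B 0 1) (hx : R8 x n 1) (hn : 2 ≤ n)
    (h : 4 * x * (x ^ 2 + A * x + B) * X = (x ^ 2 - B) ^ 2) : R8 X (-n - 2) 1 := by
  have h1 := ((hx.sq.shift3 (m := 0) (by omega)).sub hB).sq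
  have h2 := (four.mul hx).mul (((hx.sq.shift3 (m := 0) (by omega)).add
    ((hA.mul hx).shift3 (by omega))).add hB)
  rw [← h] at h1
  have h3 := h1.div h2 (by decide)
  rw [mul_div_cancel_left₀ _ (h2.ne_zero (by decide))] at h3
  exact h3.of_eq rfl (by ring) (by decide)

/-- The structure of points on `f² x = x² + 2 a x + B` where `x` is a unit congruent to `-a`. -/
theorem exists_of_unit (ha : R8 a 0 d) (hC : R8 (a ^ 2 - B) 6 3) (hx : R8 x 0 (-d))
    (hd : d ^ 2 = 1) (h : x * f ^ 2 = x ^ 2 + 2 * a * x + B) :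
    ∃ e, R8 (x + a) 3 e ∧ ((d = 7 ∧ ∃ i, e = 2 * i ∧ i ^ 2 = 1) ∨ (d = 3 ∧ ∃ i, e = 4 * i)) := by
  obtain ⟨e, he⟩ := ((hx.add ha).of_eq rfl rfl (neg_add_cancel d)).raise3
  have key := (hx.mul (he.sq.sub hC)).of_eq (y := (x * f) ^ 2) (m := 6)
    (by linear_combination -x * h) (by norm_num) rfl
  refine ⟨e, he, ?_⟩
  have h1 : (∃ i, -d * (e ^ 2 - 3) = 2 * i ∧ i ^ 2 = 1) ∨
      ((-d * (e ^ 2 - 3)) ^ 2 = 1 ∧ -d * (e ^ 2 - 3) ≠ 1) ∨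
      ((d = 7 ∧ ∃ i, e = 2 * i ∧ i ^ 2 = 1) ∨ (d = 3 ∧ ∃ i, e = 4 * i)) := by
    clear key he hx ha; revert d e; decide
  rcases h1 with ⟨i, h1, hi⟩ | ⟨h1, h2⟩ | h1
  · rw [h1] at key
    obtain ⟨j, hj, key⟩ := key.raise
    obtain ⟨-, m, -, hm, -⟩ := key.of_sq (by clear * - hi hj; revert i j; decide)
    omega
  · exact absurd (key.of_sq h1).1 h2
  · exact h1

/-- Points with `x ≡ 1` and `a ≡ 7` modulo `8` double to points of valuation `2`. -/
theorem dup_of_one (ha : R8 a 0 7) (hC : R8 (a ^ 2 - B) 6 3) (hx : R8 x 0 1)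
    (h : x * f ^ 2 = x ^ 2 + 2 * a * x + B)
    (h' : 4 * x * (x ^ 2 + 2 * a * x + B) * X = (x ^ 2 - B) ^ 2) : R8 X 2 1 := by
  obtain ⟨e, he, ⟨-, i, rfl, hi⟩ | ⟨h0, -⟩⟩ := exists_of_unit ha hC hx (by decide) h
  · obtain ⟨j, hj, hj'⟩ := raise he
    obtain ⟨l, hl, hl'⟩ := raise (c := 1) ((hx.sub ha).of_eq rfl rfl (by decide))
    have h1 := ((hj'.mul hl').add ((hC.shift 1).of_eq rfl (by norm_num) rfl)).sq
    have h2 := (four.mul hx).mul (((hj'.sq.shift 2).of_eq (m := 6) rfl (by norm_num) rfl).sub hC)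
    rw [show (x + a) * (x - a) + (a ^ 2 - B) = x ^ 2 - B by ring, ← h'] at h1
    rw [show (x + a) ^ 2 - (a ^ 2 - B) = x ^ 2 + 2 * a * x + B by ring] at h2
    have h3 : (1 * 1 * (2 ^ 2 * j ^ 2 - 3) : ZMod 8) = 1 ∧ (j * l + 2 ^ 1 * 3) ^ 2 = 1 := by
      clear * - hi hj hl; revert i j l; decide
    rw [h3.1] at h2
    have h4 := h1.div h2 (by decide)
    rw [mul_div_cancel_left₀ _ (h2.ne_zero (by decide)), h3.2] at h4
    exact h4.of_eq rfl (by norm_num) (by decide)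
  · exact absurd h0 (by decide)

/-- Points with `x ≡ 5` and `a ≡ 7` modulo `8` double to units. -/
theorem dup_of_five (ha : R8 a 0 7) (hC : R8 (a ^ 2 - B) 6 3) (hx : R8 x 0 5)
    (h' : 4 * x * (x ^ 2 + 2 * a * x + B) * X = (x ^ 2 - B) ^ 2) : R8 X 0 1 := by
  obtain ⟨i, hi, hi'⟩ := raise (c := 2) ((hx.add ha).of_eq rfl rfl (by decide))
  have h1 : ∃ j, i = 2 * j := by clear * - hi; revert i; decide
  obtain ⟨j, rfl⟩ := h1
  obtain ⟨k, hk, hk'⟩ := raise hi'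
  obtain ⟨l, hl, hl'⟩ := raise (c := 3) ((hx.sub ha).of_eq rfl rfl (by decide))
  have h1 := (((hk'.of_eq rfl (by norm_num) rfl).mul hl').add
    ((hC.shift 3).of_eq (m := 2 + (0 + 1)) rfl (by norm_num) rfl)).sq
  have h2 := (four.mul hx).mul (hk'.sq.sub ((hC.shift 2).of_eq rfl (by norm_num) rfl))
  rw [show (x + a) * (x - a) + (a ^ 2 - B) = x ^ 2 - B by ring, ← h'] at h1
  rw [show (x + a) ^ 2 - (a ^ 2 - B) = x ^ 2 + 2 * a * x + B by ring] at h2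
  have h3 : (1 * 5 * (k ^ 2 - 2 ^ 2 * 3) : ZMod 8) = 1 ∧ (k * l + 2 ^ 3 * 3) ^ 2 = 1 := by
    clear * - hi hk hl; revert j k l; decide
  rw [h3.1] at h2
  have h4 := h1.div h2 (by decide)
  rw [mul_div_cancel_left₀ _ (h2.ne_zero (by decide)), h3.2] at h4
  exact h4.of_eq rfl (by norm_num) (by decide)

/-- Points with `x ≡ 5` and `a ≡ 3` modulo `8` double to points of valuation at least `4`. -/
theorem dup_of_five' (ha : R8 a 0 3) (hC : R8 (a ^ 2 - B) 6 3) (hx : R8 x 0 5)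
    (h : x * f ^ 2 = x ^ 2 + 2 * a * x + B)
    (h' : 4 * x * (x ^ 2 + 2 * a * x + B) * X = (x ^ 2 - B) ^ 2) : ∃ c, R8 X 4 c := by
  obtain ⟨e, he, ⟨h0, -⟩ | ⟨-, i, rfl⟩⟩ := exists_of_unit ha hC (hx.of_eq rfl rfl (by decide))
    (by decide) h
  · exact absurd h0 (by decide)
  · obtain ⟨j, hj, hj'⟩ := raise (c := 2 * i) (he.of_eq rfl rfl (by ring))
    have h1 : ∃ l, j = 2 * l := by clear * - hj; revert i j; decide
    obtain ⟨l, rfl⟩ := h1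
    obtain ⟨j, -, hj'⟩ := raise hj'
    obtain ⟨l, hl, hl'⟩ := raise (c := 1) ((hx.sub ha).of_eq rfl rfl (by decide))
    have h1 := (((hj'.mul hl').of_eq (m := 6) rfl (by norm_num) rfl).add hC).sq
    have h2 := (four.mul hx).mul ((hj'.sq.shift3 (by norm_num)).sub hC)
    rw [show (x + a) * (x - a) + (a ^ 2 - B) = x ^ 2 - B by ring, ← h'] at h1
    rw [show (x + a) ^ 2 - (a ^ 2 - B) = x ^ 2 + 2 * a * x + B by ring] at h2
    have h4 := h1.div h2 (by decide)
    rw [mul_div_cancel_left₀ _ (h2.ne_zero (by decide))] at h4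
    exact ⟨_, h4.of_eq rfl (by norm_num) rfl⟩

/-- On `f² x = x² + A x + B` a coordinate `x` of even valuation with unit part `5` is a unit. -/
theorem eq_zero_of_five (hA : R8 A 1 d) (hB : R8 B 0 1) (hx : R8 x n 5) (hn : Even n)
    (h : x * f ^ 2 = x ^ 2 + A * x + B) : n = 0 := by
  have hf : (x * f) ^ 2 = x * (x ^ 2 + A * x + B) := by linear_combination x * h
  obtain ⟨m, rfl⟩ := hn
  by_contra h0
  rcases lt_or_gt_of_ne h0 with h0 | h0
  · have := hx.mul ((hx.sq.add_of_lt (hA.mul hx) (by omega)).add_of_lt hB (by omega))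
    rw [← hf] at this
    exact absurd (this.of_sq (by decide)).1 (by decide)
  · have := hx.mul (((hx.sq.shift3 (m := 0) (by omega)).add
      ((hA.mul hx).shift3 (by omega))).add hB)
    rw [← hf] at this
    exact absurd (this.of_sq (by decide)).1 (by decide)

end R8

namespace O7
open scoped QuadraticAlgebra

theorem dvd_ρ_iff {z : O7} : ρ ∣ z ↔ (z.re + 4 * z.im : ZMod 7) = 0 := by
  constructor
  · rintro ⟨w, rfl⟩
    simp [ρ, α, QuadraticAlgebra.re_ofNat, QuadraticAlgebra.im_ofNat]
    linear_combination (w.re : ZMod 7) * (by decide : (7 : ZMod 7) = 0)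
  · intro h
    have h1 : ((z.re + 4 * z.im : ℤ) : ZMod 7) = 0 := by push_cast; exact h
    obtain ⟨k, hk⟩ := (ZMod.intCast_zmod_eq_zero_iff_dvd _ 7).1 h1
    refine ⟨⟨k, z.im - 2 * k⟩, ?_⟩
    ext
    · simp [ρ, α, QuadraticAlgebra.re_ofNat, QuadraticAlgebra.im_ofNat]
      push_cast at hk
      linarith
    · simp [ρ, α, QuadraticAlgebra.re_ofNat, QuadraticAlgebra.im_ofNat]
      ring

/-- The reduction `ℤ[α] → ℤ/7` modulo `ρ`. -/
noncomputable def resρ : O7 →+* ZMod 7 :=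
  (QuadraticAlgebra.lift (R := ℤ) (A := ZMod 7) (a := -2) (b := 1) ⟨4, by decide⟩ : O7 →ₐ[ℤ] ZMod 7)

theorem resρ_α : resρ α = 4 := by simp [resρ, α]

theorem resρ_eq_zero {z : O7} : resρ z = 0 ↔ ρ ∣ z := by
  rw [dvd_ρ_iff]
  conv_lhs => rw [eq_add_mul_α z]
  rw [map_add, map_mul, map_intCast, map_intCast, resρ_α, mul_comm (4 : ZMod 7)]

/-- The elements `D` for which the curves `y² = x (x² + β ρ D x - 3 ρ D²)` are studied. -/
def IsTwist (D : O7) : Prop := D = 1 ∨ D = -3 ∨ D = ρ ∨ D = -3 * ρ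

/-- The linear coefficient of the curve `y² = x (x² + A x + B)`. -/
def cA (D : O7) : O7 := β * ρ * D

/-- The constant coefficient of the curve `y² = x (x² + A x + B)`. -/
def cB (D : O7) : O7 := -3 * ρ * D ^ 2

theorem cA_sq_sub (D : O7) : cA D ^ 2 - 4 * cB D = -ρ * β ^ 8 * D ^ 2 := by
  have : β ^ 2 * ρ ^ 2 + 12 * ρ = -ρ * β ^ 8 := by decide
  rw [cA, cB]; linear_combination D ^ 2 * this

theorem IsTwist.dvd {D : O7} (hD : IsTwist D) : D ∣ ρ * 3 := by
  rcases hD with rfl | rfl | rfl | rfl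
  · exact one_dvd _
  · exact ⟨-ρ, by ring⟩
  · exact ⟨3, by ring⟩
  · exact ⟨-1, by ring⟩

theorem dvd_of_dvd_cB {D p : O7} (hD : IsTwist D) (hp : Prime p) (h : p ∣ cB D) : p ∣ ρ * 3 := by
  rw [cB] at h
  rcases hp.dvd_or_dvd h with h | h
  · exact h.trans ⟨-1, by ring⟩
  · exact (hp.dvd_of_dvd_pow h).trans hD.dvd

theorem not_ρ_dvd_three : ¬ ρ ∣ 3 := by
  rw [← resρ_eq_zero, map_ofNat]; decide

theorem ρ_dvd_of_sq_eq {c n d H D : O7} (hD : IsTwist D) (hc : c = -1 ∨ c = 3)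
    (h : H ^ 2 = c * (c ^ 2 * n ^ 4 + cA D * c * n ^ 2 * d ^ 2 + cB D * d ^ 4)) :
    ρ ∣ n ∧ ρ ∣ d := by
  have hc' : ¬ ρ ∣ c := by
    rw [← resρ_eq_zero]
    rcases hc with rfl | rfl
    · rw [map_neg, map_one]; decide
    · rw [map_ofNat]; decide
  have h0 : resρ ρ = 0 := resρ_eq_zero.2 dvd_rfl
  have h1 : resρ H ^ 2 = resρ c ^ 3 * resρ n ^ 4 := by
    have := congrArg resρ h
    simp only [cA, cB, map_mul, map_add, map_pow, h0, mul_zero, zero_mul, add_zero] at this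
    linear_combination this
  have key : ∀ c x y : ZMod 7, (c = -1 ∨ c = 3) → x ^ 2 = c ^ 3 * y ^ 4 → x = 0 ∧ y = 0 := by
    decide
  obtain ⟨h2, h3⟩ := key (resρ c) _ _ (by
    rcases hc with rfl | rfl
    · left; rw [map_neg, map_one]
    · right; rw [map_ofNat]) h1
  rw [resρ_eq_zero] at h2 h3
  refine ⟨h3, ?_⟩
  obtain ⟨H, rfl⟩ := h2
  obtain ⟨n, rfl⟩ := h3
  have hp := prime_ρ
  have hp0 := hp.ne_zero
  have fin : ∀ {e : O7}, ¬ ρ ∣ e → ρ ∣ 3 * c * e ^ 2 * d ^ 4 → ρ ∣ d := fun {e} he h => by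
    rcases hp.dvd_or_dvd h with h | h
    · rcases hp.dvd_or_dvd h with h | h
      · rcases hp.dvd_or_dvd h with h | h
        · exact absurd h not_ρ_dvd_three
        · exact absurd h hc'
      · exact absurd (hp.dvd_of_dvd_pow h) he
    · exact hp.dvd_of_dvd_pow h
  have main : (∃ e, ¬ ρ ∣ e ∧ D = e) ∨ ∃ e, ¬ ρ ∣ e ∧ D = ρ * e := by
    have h3 : ¬ ρ ∣ -3 := by rw [dvd_neg]; exact not_ρ_dvd_three
    rcases hD with rfl | rfl | rfl | rfl
    · exact Or.inl ⟨1, fun h => hp.not_isUnit (isUnit_of_dvd_one h), rfl⟩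
    · exact Or.inl ⟨-3, h3, rfl⟩
    · exact Or.inr ⟨1, fun h => hp.not_isUnit (isUnit_of_dvd_one h), by ring⟩
    · exact Or.inr ⟨-3, h3, by ring⟩
  rw [cA, cB] at h
  rcases main with ⟨e, he, rfl⟩ | ⟨e, he, rfl⟩
  · refine fin he ⟨c ^ 3 * ρ ^ 2 * n ^ 4 + β * D * c ^ 2 * ρ * n ^ 2 * d ^ 2 - H ^ 2, ?_⟩
    exact mul_left_cancel₀ hp0 (by linear_combination h)
  · have h4 : ρ ∣ H ^ 2 := ⟨c * (c ^ 2 * ρ * n ^ 4 + β * e * c * ρ * n ^ 2 * d ^ 2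
      - 3 * e ^ 2 * d ^ 4), mul_left_cancel₀ (pow_ne_zero 2 hp0) (by linear_combination h)⟩
    obtain ⟨H, rfl⟩ := hp.dvd_of_dvd_pow h4
    refine fin he ⟨c ^ 3 * n ^ 4 + β * e * c ^ 2 * n ^ 2 * d ^ 2 - H ^ 2, ?_⟩
    exact mul_left_cancel₀ (pow_ne_zero 3 hp0) (by linear_combination h)

theorem no_residue {K : Type*} [Field K] [Algebra O7 K] [IsFractionRing O7 K] {c D : O7}
    (hD : IsTwist D) (hc : c = -1 ∨ c = 3) (z f : K) :
    algebraMap O7 K c * z ^ 2 * f ^ 2 ≠ (algebraMap O7 K c * z ^ 2) ^ 2 +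
      algebraMap O7 K (cA D) * (algebraMap O7 K c * z ^ 2) + algebraMap O7 K (cB D) := by
  intro h
  obtain ⟨n, d, hnd, hd, rfl⟩ := exists_coprime z
  have inj := IsFractionRing.injective O7 K
  have hd' : algebraMap O7 K d ≠ 0 := (map_ne_zero_iff _ inj).2 hd
  have h1 : (algebraMap O7 K c * algebraMap O7 K n * f * algebraMap O7 K d) ^ 2 =
      algebraMap O7 K (c * (c ^ 2 * n ^ 4 + cA D * c * n ^ 2 * d ^ 2 + cB D * d ^ 4)) := by
    simp only [map_mul, map_add, map_pow]
    field_simp at h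
    linear_combination algebraMap O7 K c * h
  obtain ⟨H, hH⟩ := exists_of_sq_eq h1
  rw [← hH, ← map_pow] at h1
  obtain ⟨h2, h3⟩ := ρ_dvd_of_sq_eq hD hc (inj h1)
  exact prime_ρ.not_isUnit (hnd.isUnit_of_dvd' h2 h3)

/-- The analogous obstruction modulo `3`. -/
theorem three_dvd_of_sq_eq {A r n d H : O7} (hA : N A % 3 = 2)
    (h : H ^ 2 = -3 * ((n ^ 2 - A * d ^ 2) ^ 2 - 3 * r * d ^ 4)) : 3 ∣ n ∧ 3 ∣ d := by
  have hp := prime_three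
  obtain ⟨H, rfl⟩ := hp.dvd_of_dvd_pow
    (h ▸ ⟨-((n ^ 2 - A * d ^ 2) ^ 2 - 3 * r * d ^ 4), by ring⟩ : 3 ∣ H ^ 2)
  obtain ⟨w, hw⟩ : 3 ∣ n ^ 2 - A * d ^ 2 := hp.dvd_of_dvd_pow (n := 2)
    ⟨r * d ^ 4 - H ^ 2, mul_left_cancel₀ hp.ne_zero (by linear_combination h)⟩
  have h1 : (N n) ^ 2 ≡ N A * N d ^ 2 [ZMOD 3] := by
    rw [← map_pow, ← map_pow, ← map_mul, show n ^ 2 = A * d ^ 2 + 3 * w by rw [← hw]; ring]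
    generalize A * d ^ 2 = x
    rw [norm_eq, norm_eq]
    refine (Int.modEq_iff_dvd.2 ⟨-(2 * x.re * w.re + 3 * w.re ^ 2 + x.re * w.im + x.im * w.re +
      3 * w.re * w.im + 4 * x.im * w.im + 6 * w.im ^ 2), ?_⟩)
    simp [QuadraticAlgebra.re_ofNat, QuadraticAlgebra.im_ofNat]
    ring
  have key : ∀ x y : ZMod 3, x ^ 2 = 2 * y ^ 2 → x = 0 ∧ y = 0 := by decide
  have h2 : (N A : ZMod 3) = (2 : ℤ) := (ZMod.intCast_eq_intCast_iff _ _ 3).2 hA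
  have h3 := (ZMod.intCast_eq_intCast_iff _ _ 3).2 h1
  push_cast at h2 h3
  obtain ⟨h4, h5⟩ := key _ _ (h2 ▸ h3)
  rw [three_dvd_iff, three_dvd_iff]
  exact ⟨(ZMod.intCast_zmod_eq_zero_iff_dvd _ 3).1 h4, (ZMod.intCast_zmod_eq_zero_iff_dvd _ 3).1 h5⟩

end O7

namespace O7

variable {K : Type*} [Field K] [Algebra O7 K] {σ σ' : K →+* ℚ_[2]} {D : O7}

theorem place_neg_three : R8 (σ (algebraMap O7 K (-3))) 0 5 :=
  (R8.ofNat 3).neg.of_eq (by rw [map_neg, map_neg, map_ofNat, map_ofNat]) rfl (by decide)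

theorem IsPlaceα.twist (h : IsPlaceα σ) (hD : IsTwist D) :
    ∃ c, c ^ 2 = 1 ∧ R8 (σ (algebraMap O7 K D)) 0 c := by
  rcases hD with rfl | rfl | rfl | rfl
  · exact ⟨1, by decide, R8.one.of_eq (by simp) rfl rfl⟩
  · exact ⟨5, by decide, place_neg_three⟩
  · exact ⟨3, by decide, h.ρ⟩
  · exact ⟨5 * 3, by decide, (place_neg_three.mul h.ρ).of_eq (by rw [map_mul, map_mul]) rfl rfl⟩

theorem IsPlaceα.cA (h : IsPlaceα σ) (hD : IsTwist D) :
    ∃ c, c ^ 2 = 1 ∧ R8 (σ (algebraMap O7 K (cA D))) 0 c := by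
  obtain ⟨c, hc, hc'⟩ := h.twist hD
  refine ⟨3 * 3 * c, by rw [mul_pow, hc]; decide, ?_⟩
  simpa only [O7.cA, map_mul, add_zero] using (h.β.mul h.ρ).mul hc'

theorem IsPlaceα.cB (h : IsPlaceα σ) (hD : IsTwist D) :
    R8 (σ (algebraMap O7 K (cB D))) 0 7 := by
  obtain ⟨c, hc, hc'⟩ := h.twist hD
  refine (((place_neg_three (σ := σ)).mul h.ρ).mul hc'.sq).of_eq
    (by simp only [O7.cB, map_mul, map_pow]) (by norm_num) ?_
  rw [hc]; decide

theorem IsPlaceα.disc (h : IsPlaceα σ) (hD : IsTwist D) :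
    R8 (σ (algebraMap O7 K (-O7.ρ * O7.β ^ 8 * D ^ 2))) 0 5 := by
  obtain ⟨c, hc, hc'⟩ := h.twist hD
  refine ((h.ρ.neg.mul h.β.sq.sq.sq).mul hc'.sq).of_eq ?_ (by norm_num) ?_
  · simp only [map_mul, map_neg, map_pow, ← pow_mul]
  · rw [hc]; decide

/-- The unit part of `D` at `σ`. -/
theorem IsPlaceβ.twist (h : IsPlaceβ σ) (hD : IsTwist D) :
    ∃ c, (c = 1 ∧ (D = 1 ∨ D = -3 * O7.ρ) ∨ c = 5 ∧ (D = -3 ∨ D = O7.ρ)) ∧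
      R8 (σ (algebraMap O7 K D)) 0 c := by
  rcases hD with rfl | rfl | rfl | rfl
  · exact ⟨1, by simp, R8.one.of_eq (by simp) rfl rfl⟩
  · exact ⟨5, by simp, place_neg_three⟩
  · exact ⟨5, by simp, h.ρ⟩
  · exact ⟨1, by simp, (place_neg_three.mul h.ρ).of_eq (by rw [map_mul, map_mul]) rfl (by decide)⟩

theorem IsPlaceβ.cB (h : IsPlaceβ σ) (hD : IsTwist D) :
    R8 (σ (algebraMap O7 K (cB D))) 0 1 := by
  obtain ⟨c, hc, hc'⟩ := h.twist hD
  refine (((place_neg_three (σ := σ)).mul h.ρ).mul hc'.sq).of_eq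
    (by simp only [O7.cB, map_mul, map_pow]) (by norm_num) ?_
  rcases hc with ⟨rfl, -⟩ | ⟨rfl, -⟩ <;> decide

theorem IsPlaceβ.disc (h : IsPlaceβ σ) (hD : IsTwist D) :
    R8 (σ (algebraMap O7 K (-O7.ρ * O7.β ^ 8 * D ^ 2))) 8 3 := by
  obtain ⟨c, hc, hc'⟩ := h.twist hD
  refine ((h.ρ.neg.mul h.β.sq.sq.sq).mul hc'.sq).of_eq ?_ (by norm_num) ?_
  · simp only [map_mul, map_neg, map_pow, ← pow_mul]
  · rcases hc with ⟨rfl, -⟩ | ⟨rfl, -⟩ <;> decide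

theorem IsPlaceβ.cA (h : IsPlaceβ σ) (hD : IsTwist D) :
    ∃ a c, σ (algebraMap O7 K (cA D)) = 2 * a ∧ R8 a 0 c ∧
      R8 (a ^ 2 - σ (algebraMap O7 K (O7.cB D))) 6 3 ∧
      (c = 7 ∧ (D = 1 ∨ D = -3 * O7.ρ) ∨ c = 3 ∧ (D = -3 ∨ D = O7.ρ)) := by
  obtain ⟨c, hc, hc'⟩ := h.twist hD
  have h0 := h.α.ne_zero (by decide)
  have h1 : σ (algebraMap O7 K (O7.cA D)) = 2 * (σ (algebraMap O7 K O7.ρ) *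
      σ (algebraMap O7 K D) / σ (algebraMap O7 K O7.α)) := by
    rw [← map_α_mul_map_β (σ := σ), O7.cA, map_mul, map_mul, map_mul, map_mul]
    field_simp
  refine ⟨_, _, h1, (h.ρ.mul hc').div h.α (by decide), ?_, ?_⟩
  · have h2 := congrArg (fun z => σ (algebraMap O7 K z)) (cA_sq_sub D)
    have h3 := (h.disc hD).div R8.four (by decide)
    simp only [map_sub, map_pow, map_mul, map_ofNat, h1] at h2
    refine h3.of_eq ?_ (by norm_num) (by decide)
    simp only [map_mul, map_pow]
    linear_combination -h2 / 4
  · rcases hc with ⟨rfl, h⟩ | ⟨rfl, h⟩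
    · exact Or.inl ⟨by decide, h⟩
    · exact Or.inr ⟨by decide, h⟩

/-- The divisors of `3`. -/
theorem dvd_three {δ : O7} (h : δ ∣ 3) : δ = 1 ∨ δ = -1 ∨ δ = 3 ∨ δ = -3 := dvd_prime prime_three h

variable [IsFractionRing O7 K]

theorem exists_twist_disc (hD : IsTwist D) :
    ∃ t : O7, (t = 1 ∨ t = 3 ∧ ∃ r, D = -3 * r ∧ (r = 1 ∨ r = ρ)) ∧
      ∀ p, Prime p → p ∣ -ρ * β ^ 8 * D ^ 2 → p ∣ ρ * (β * t) := by
  have main : ∀ t, D ∣ ρ * t → ∀ p, Prime p → p ∣ -ρ * β ^ 8 * D ^ 2 → p ∣ ρ * (β * t) := by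
    intro t ht p hp h
    rcases hp.dvd_or_dvd h with h | h
    · rcases hp.dvd_or_dvd h with h | h
      · exact (dvd_neg.1 (by simpa using h)).trans ⟨β * t, rfl⟩
      · exact (hp.dvd_of_dvd_pow h).trans ⟨ρ * t, by ring⟩
    · exact (hp.dvd_of_dvd_pow h).trans (ht.trans ⟨β, by ring⟩)
  rcases hD with rfl | rfl | rfl | rfl
  · exact ⟨1, Or.inl rfl, main 1 (one_dvd _)⟩
  · exact ⟨3, Or.inr ⟨rfl, 1, by ring, Or.inl rfl⟩, main 3 ⟨-ρ, by ring⟩⟩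
  · exact ⟨1, Or.inl rfl, main 1 ⟨1, by ring⟩⟩
  · exact ⟨3, Or.inr ⟨rfl, ρ, by ring, Or.inr rfl⟩, main 3 ⟨-1, by ring⟩⟩

theorem ne_neg_three_mul_sq {r : O7} (hr : r = 1 ∨ r = ρ) {ξ z : K} (hz : z ≠ 0) :
    4 * (-3 * z ^ 2) * ξ ^ 2 ≠ (-3 * z ^ 2) ^ 2
      - 2 * algebraMap O7 K (cA (-3 * r)) * (-3 * z ^ 2)
      + algebraMap O7 K (-ρ * β ^ 8 * (-3 * r) ^ 2) := by
  intro h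
  obtain ⟨n, d, hnd, hd, rfl⟩ := exists_coprime z
  have inj := IsFractionRing.injective O7 K
  have hd' : algebraMap O7 K d ≠ 0 := (map_ne_zero_iff _ inj).2 hd
  have hn' : algebraMap O7 K n ≠ 0 := fun h => hz (by rw [h, zero_div])
  have h3 : (3 : K) ≠ 0 := by
    have := (map_ne_zero_iff _ inj).2 prime_three.ne_zero
    rwa [map_ofNat] at this
  have h1 : (2 * algebraMap O7 K n * ξ * algebraMap O7 K d) ^ 2 = algebraMap O7 K
      (-3 * ((n ^ 2 - β * ρ * r * d ^ 2) ^ 2 - 3 * (-4 * ρ * r ^ 2) * d ^ 4)) := by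
    rw [← cA_sq_sub, cA, cB] at h
    simp only [map_mul, map_pow, map_sub, map_neg, map_ofNat] at h ⊢
    field_simp at h
    linear_combination -h
  obtain ⟨H, hH⟩ := exists_of_sq_eq h1
  rw [← hH, ← map_pow] at h1
  obtain ⟨h2, h3⟩ := three_dvd_of_sq_eq (by rcases hr with rfl | rfl <;> decide) (inj h1)
  exact prime_three.not_isUnit (hnd.isUnit_of_dvd' h2 h3)

end O7

namespace O7

variable {K : Type*} [Field K] [CharZero K] [Algebra O7 K] [IsFractionRing O7 K]
  {σ σ' : K →+* ℚ_[2]} {D : O7}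

/-- First half of the division by two of a point with square `x`-coordinate: one of
`2 ξ² + A ± 2 η` is a square. -/
theorem exists_sq_eq (hD : IsTwist D) (hσ : IsPlaceα σ) (hσ' : IsPlaceβ σ') {ξ η : K}
    (h : η ^ 2 = ξ ^ 4 + algebraMap O7 K (cA D) * ξ ^ 2 + algebraMap O7 K (cB D))
    {k : ℤ} (hk : 1 ≤ k) {c : ZMod 8} (hc : c ^ 2 = 1) (hξ : R8 (σ ξ) (-(k + 1)) c) :
    ∃ η' f : K, (η' = η ∨ η' = -η) ∧ 2 * ξ ^ 2 + algebraMap O7 K (cA D) + 2 * η' = f ^ 2 ∧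
      ∃ e, e ^ 2 = 1 ∧ R8 (σ f) (-k) e := by
  set A := algebraMap O7 K (cA D) with hA
  set B := algebraMap O7 K (cB D) with hB
  set C := algebraMap O7 K (-ρ * β ^ 8 * D ^ 2) with hC
  have inj := IsFractionRing.injective O7 K
  have hABC : A ^ 2 - 4 * B = C := by
    rw [hC, ← cA_sq_sub, map_sub, map_pow, map_mul, map_ofNat]
  have hC0 : C ≠ 0 := fun h0 => by
    have := (hσ.disc hD).ne_zero (by decide)
    rw [← hC, h0, map_zero] at this
    exact this rfl
  have hξ0 : ξ ≠ 0 := fun h0 => by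
    have := hξ.ne_zero hc
    rw [h0, map_zero] at this
    exact this rfl
  have hprod : ∀ {η' : K}, η' = η ∨ η' = -η → (2 * ξ ^ 2 + A + 2 * η') * (2 * ξ ^ 2 + A - 2 * η') = C := by
    rintro η' (rfl | rfl) <;> linear_combination hABC - 4 * h
  have hne : ∀ {η' : K}, η' = η ∨ η' = -η → 2 * ξ ^ 2 + A + 2 * η' ≠ 0 := fun hη h0 => by
    have := hprod hη
    rw [h0, zero_mul] at this
    exact hC0 this.symm
  have hcurve : ∀ {x η' : K}, η' = η ∨ η' = -η → x = 2 * ξ ^ 2 + A + 2 * η' →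
      4 * x * ξ ^ 2 = x ^ 2 - 2 * A * x + C := by
    intro x η' hη hx
    rw [← hprod hη, hx]; ring
  obtain ⟨t, ht, hts⟩ := exists_twist_disc hD
  obtain ⟨η', x, hη, hx, δ, z, hδ, hz⟩ : ∃ η' x, (η' = η ∨ η' = -η) ∧ x = 2 * ξ ^ 2 + A + 2 * η' ∧
      ∃ δ z, δ ∣ β * t ∧ x = algebraMap O7 K δ * z ^ 2 := by
    obtain ⟨δ, z, hδ, hz⟩ := exists_x_eq_mul_sq (A := -2 * cA D) hts
      (x := 2 * ξ ^ 2 + A + 2 * η) (y := 2 * (2 * ξ ^ 2 + A + 2 * η) * ξ)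
      (mul_ne_zero (mul_ne_zero two_ne_zero (hne (Or.inl rfl))) hξ0) (by
        rw [map_mul, map_neg, map_ofNat]
        linear_combination (2 * ξ ^ 2 + A + 2 * η) * hcurve (Or.inl rfl) rfl)
    rcases dvd_prime_mul prime_ρ hδ with h1 | ⟨δ, h1, rfl⟩
    · exact ⟨η, _, Or.inl rfl, rfl, δ, z, h1, hz⟩
    · refine ⟨-η, _, Or.inr rfl, rfl, -δ,
        algebraMap O7 K (β ^ 4 * D) / (algebraMap O7 K δ * z), (neg_dvd).2 h1, ?_⟩
      have h2 := hne (Or.inl rfl)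
      have h3 := hprod (Or.inl rfl)
      rw [hz, map_mul] at h2 h3
      have h4 := left_ne_zero_of_mul (left_ne_zero_of_mul h2)
      have h5 := right_ne_zero_of_mul (left_ne_zero_of_mul h2)
      have h6 : z ≠ 0 := fun h => by simp [h] at h2
      simp only [hC, map_mul, map_neg, map_pow] at h3 ⊢
      field_simp
      refine mul_left_cancel₀ h4 ?_
      linear_combination h3
  have hx0 : x ≠ 0 := hx ▸ hne hη
  have hz0 : z ≠ 0 := fun h => hx0 (by rw [hz, h]; ring)
  have hδt : δ ∣ t := by
    rcases dvd_prime_mul prime_β hδ with h1 | ⟨δ, h1, rfl⟩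
    · exact h1
    · exfalso
      have h3 : δ ∣ 3 := h1.trans (by rcases ht with rfl | ⟨rfl, -⟩ <;> simp)
      obtain ⟨e, he, hδ'⟩ : ∃ e, e ^ 2 = 1 ∧ R8 (σ' (algebraMap O7 K δ)) 0 e := by
        rcases dvd_three h3 with rfl | rfl | rfl | rfl
        · exact ⟨1, by decide, by simpa using R8.one⟩
        · exact ⟨-1, by decide, by simpa using R8.one.neg⟩
        · exact ⟨3, by decide, by rw [map_ofNat, map_ofNat]; exact R8.ofNat 3⟩
        · exact ⟨5, by decide, place_neg_three⟩
      obtain ⟨n, b, hb, hzn⟩ := R8.exists_of_ne_zero ((map_ne_zero σ').2 hz0)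
      have hxn := (hσ'.β.mul hδ').mul hzn.sq
      rw [← map_mul, ← map_mul, ← map_pow, ← map_mul, ← hz] at hxn
      obtain ⟨a, d, ha, had, -, hd⟩ := hσ'.cA hD
      obtain ⟨m, hm⟩ := R8.even_of_sq_eq (y := σ' (2 * x * ξ)) had (by tauto) (hσ'.disc hD) hxn
        (by rw [mul_pow, mul_pow, he, hb]; decide) (by
          have := congrArg σ' (hcurve hη hx)
          simp only [map_mul, map_add, map_sub, map_pow, map_ofNat, ← hC] at this ⊢
          rw [ha] at this
          linear_combination σ' x * this)
      omega
  have hsum : R8 (σ x + σ (2 * ξ ^ 2 + A - 2 * η')) (-2 * k) 1 := by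
    obtain ⟨d, -, hd⟩ := hσ.cA hD
    refine ((R8.four.mul hξ.sq).add_of_lt (R8.two.mul hd) (by omega)).of_eq ?_ (by ring)
      (by rw [hc]; decide)
    rw [← map_add, hx, ← hA, ← map_ofNat σ 4, ← map_ofNat σ 2, ← map_pow, ← map_mul, ← map_mul,
      ← map_add]
    congr 1; ring
  have hP := hσ.disc hD
  rw [← hC, ← hprod hη, ← hx, map_mul] at hP
  have hcase := R8.val_of_add_of_mul hP (by decide) hsum (by decide) hk
  obtain ⟨n, b, hb, hzn⟩ := R8.exists_of_ne_zero ((map_ne_zero σ).2 hz0)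
  have key : ∀ {e}, e ^ 2 = 1 → R8 (σ (algebraMap O7 K δ)) 0 e → 2 * n = -2 * k ∧ e = 1 ∨ e = 5 := by
    intro e he hδ
    have hxn := hδ.mul hzn.sq
    rw [← map_pow, ← map_mul, ← hz, hb, mul_one] at hxn
    rcases hcase with h1 | h1
    · have := hxn.unique h1 he (by decide)
      exact Or.inl ⟨by omega, this.2⟩
    · exact Or.inr (hxn.unique h1 he (by decide)).2
  have hδ1 : δ = 1 := by
    rcases ht with rfl | ⟨rfl, r, rfl, hr⟩
    · rcases isUnit_iff.1 (isUnit_of_dvd_one hδt) with rfl | rfl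
      · rfl
      · exfalso
        have := key (e := -1) (by decide) (by simpa using R8.one.neg)
        rcases this with ⟨-, h⟩ | h <;> revert h <;> decide
    · rcases dvd_three hδt with rfl | rfl | rfl | rfl
      · rfl
      · exfalso
        have := key (e := -1) (by decide) (by simpa using R8.one.neg)
        rcases this with ⟨-, h⟩ | h <;> revert h <;> decide
      · exfalso
        have := key (e := 3) (by decide) (by rw [map_ofNat, map_ofNat]; exact R8.ofNat 3)
        rcases this with ⟨-, h⟩ | h <;> revert h <;> decide
      · exfalso
        rw [map_neg, map_ofNat] at hz
        refine ne_neg_three_mul_sq hr hz0 (ξ := ξ) ?_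
        rw [← hz]
        exact hcurve hη hx
  subst hδ1
  refine ⟨η', z, hη, by rw [← hx, hz, map_one, one_mul], b, hb, ?_⟩
  rcases key (e := 1) (by decide) (by simpa using R8.one) with ⟨h1, -⟩ | h1
  · exact hzn.of_eq rfl (by omega) rfl
  · exact absurd h1 (by decide)

/-- Division by two of a point `(ξ², η ξ)` with pole at the place above `α`. -/
theorem exists_half (hD : IsTwist D) (hσ : IsPlaceα σ) (hσ' : IsPlaceβ σ') {ξ η : K}
    (h : η ^ 2 = ξ ^ 4 + algebraMap O7 K (cA D) * ξ ^ 2 + algebraMap O7 K (cB D))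
    {k : ℤ} (hk : 1 ≤ k) {c : ZMod 8} (hc : c ^ 2 = 1) (hξ : R8 (σ ξ) (-(k + 1)) c) :
    ∃ x f z : K, z ≠ 0 ∧
      x * f ^ 2 = x ^ 2 + algebraMap O7 K (cA D) * x + algebraMap O7 K (cB D) ∧
      4 * x * (x ^ 2 + algebraMap O7 K (cA D) * x + algebraMap O7 K (cB D)) * ξ ^ 2 =
        (x ^ 2 - algebraMap O7 K (cB D)) ^ 2 ∧
      (k = 1 ∧ x = -3 * z ^ 2 ∨ 2 ≤ k ∧ x = z ^ 2 ∧ ∃ e, e ^ 2 = 1 ∧ R8 (σ z) (-k) e) := by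
  obtain ⟨η', f, hη, hf, e, he, hfk⟩ := exists_sq_eq hD hσ hσ' h hk hc hξ
  set A := algebraMap O7 K (cA D) with hA
  set B := algebraMap O7 K (cB D) with hB
  have hη2 : η' ^ 2 = η ^ 2 := by rcases hη with rfl | rfl <;> ring
  have hB0 : B ≠ 0 := fun h0 => by
    have := (hσ.cB hD).ne_zero (by decide)
    rw [← hB, h0, map_zero] at this
    exact this rfl
  have hf0 : f ≠ 0 := fun h0 => by
    have := hfk.ne_zero he
    rw [h0, map_zero] at this
    exact this rfl
  have hprod : ∀ {ξ' x x' : K}, ξ' ^ 2 = ξ ^ 2 → x = (f ^ 2 - A + 2 * f * ξ') / 2 →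
      x' = (f ^ 2 - A - 2 * f * ξ') / 2 → x * x' = B := by
    rintro ξ' _ _ h1 rfl rfl
    have h2 : f ^ 2 - A = 2 * ξ ^ 2 + 2 * η' := by rw [← hf]; ring
    rw [h2]
    linear_combination -f ^ 2 * h1 + ξ ^ 2 * hf + hη2 + h
  have hcurve : ∀ {ξ' x x' : K}, ξ' ^ 2 = ξ ^ 2 → x = (f ^ 2 - A + 2 * f * ξ') / 2 →
      x' = (f ^ 2 - A - 2 * f * ξ') / 2 → x * f ^ 2 = x ^ 2 + A * x + B := by
    intro ξ' x x' h1 h2 h3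
    rw [← hprod h1 h2 h3, h3, h2]; ring
  obtain ⟨ξ', x, x', hξ', hx, hx', δ, z, hδ, hz⟩ : ∃ ξ' x x' : K, ξ' ^ 2 = ξ ^ 2 ∧
      x = (f ^ 2 - A + 2 * f * ξ') / 2 ∧ x' = (f ^ 2 - A - 2 * f * ξ') / 2 ∧
      ∃ δ z, (δ = 1 ∨ δ = -1 ∨ δ = 3 ∨ δ = -3) ∧ x = algebraMap O7 K δ * z ^ 2 := by
    have h1 := hprod (ξ' := ξ) rfl rfl rfl
    have hx0 := left_ne_zero_of_mul (h1 ▸ hB0)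
    obtain ⟨δ, z, hδ, hz⟩ := exists_x_eq_mul_sq (A := cA D) (fun p hp h => dvd_of_dvd_cB hD hp h)
      (x := (f ^ 2 - A + 2 * f * ξ) / 2) (y := (f ^ 2 - A + 2 * f * ξ) / 2 * f)
      (mul_ne_zero hx0 hf0) (by
        linear_combination (f ^ 2 - A + 2 * f * ξ) / 2 * hcurve (ξ' := ξ) rfl rfl rfl)
    rcases dvd_prime_mul prime_ρ hδ with h2 | ⟨δ, h2, rfl⟩
    · exact ⟨ξ, _, _, rfl, rfl, rfl, δ, z, dvd_three h2, hz⟩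
    · have h3 : ∃ δ' w : O7, (δ' = 1 ∨ δ' = -1 ∨ δ' = 3 ∨ δ' = -3) ∧ δ' * w ^ 2 = -3 * δ := by
        rcases dvd_three h2 with rfl | rfl | rfl | rfl
        · exact ⟨-3, 1, by simp, by ring⟩
        · exact ⟨3, 1, by simp, by ring⟩
        · exact ⟨-1, 3, by simp, by ring⟩
        · exact ⟨1, 3, by simp, by ring⟩
      obtain ⟨δ', w, hδ', hw⟩ := h3
      refine ⟨-ξ, _, _, by ring, rfl, rfl, δ',
        algebraMap O7 K (w * D) / (algebraMap O7 K δ * z), hδ', ?_⟩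
      rw [hz] at h1 hx0
      have h4 := congrArg (algebraMap O7 K) hw
      simp only [hB, cB, map_mul, map_pow, map_neg] at h1 hx0 h4 ⊢
      have h5 := left_ne_zero_of_mul (left_ne_zero_of_mul hx0)
      have h6 := right_ne_zero_of_mul (left_ne_zero_of_mul hx0)
      have h7 : z ≠ 0 := fun h => by simp [h] at hx0
      rw [show f ^ 2 - A + 2 * f * -ξ = f ^ 2 - A - 2 * f * ξ by ring]
      refine mul_left_cancel₀ hx0 (h1.trans ?_)
      field_simp
      linear_combination -algebraMap O7 K D ^ 2 * h4
  have hxf := hcurve hξ' hx hx'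
  have hxx := hprod hξ' hx hx'
  have hz0 : z ≠ 0 := fun h0 => by
    rw [hz, h0] at hxx
    exact hB0 (by rw [← hxx]; ring)
  refine ⟨x, f, z, hz0, hxf, ?_, ?_⟩
  · rw [← hxf, ← hxx, ← hξ', hx', hx]; ring
  obtain ⟨d, hd, hAd⟩ := hσ.cA hD
  obtain ⟨s, hs, hsk, hsum⟩ : ∃ s, s ^ 2 = 1 ∧ (s = 5 ∧ k = 1 ∨ s = 1 ∧ 2 ≤ k) ∧
      R8 (σ x + σ x') (-2 * k) s := by
    have h1 : σ x + σ x' = σ f ^ 2 - σ A := by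
      rw [← map_add, ← map_pow, ← map_sub, hx, hx']; congr 1; ring
    rw [h1]
    rcases eq_or_lt_of_le hk with rfl | hk
    · refine ⟨5, by decide, by simp, (hfk.sq.sub ((hAd.shift 2).of_eq rfl (by norm_num) rfl)).of_eq
        rfl (by norm_num) ?_⟩
      clear * - he hd; revert e d; decide
    · refine ⟨1, by decide, Or.inr ⟨rfl, hk⟩, (hfk.sq.sub_of_lt hAd (by omega)).of_eq rfl
        (by ring) he⟩
  have hP := hσ.cB hD
  rw [← hB, ← hxx, map_mul] at hP
  have hcase := R8.val_of_add_of_mul hP (by decide) hsum hs hk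
  obtain ⟨n, b, hb, hzn⟩ := R8.exists_of_ne_zero ((map_ne_zero σ).2 hz0)
  have key : ∀ {e}, e ^ 2 = 1 → R8 (σ (algebraMap O7 K δ)) 0 e →
      2 * n = -2 * k ∧ e = s ∨ e = 7 * s := by
    intro e he hδ
    have hxn := hδ.mul hzn.sq
    rw [← map_pow, ← map_mul, ← hz, hb, mul_one] at hxn
    rcases hcase with h1 | h1
    · have := hxn.unique h1 he hs
      exact Or.inl ⟨by omega, this.2⟩
    · exact Or.inr (hxn.unique h1 he (by rw [mul_pow, hs]; decide)).2
  have hres : ∀ c, δ = c → ¬ (c = -1 ∨ c = 3) := by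
    rintro c rfl hc
    refine no_residue hD hc z f ?_
    rw [← hz]; exact hxf
  have hδ' : δ = 1 ∨ δ = -3 := by
    have := hres δ rfl
    tauto
  rcases hδ' with rfl | rfl
  · rcases key (e := 1) (by decide) (by simpa using R8.one) with ⟨h1, rfl⟩ | h1
    · rcases hsk with ⟨h2, -⟩ | ⟨-, h2⟩
      · exact absurd h2 (by decide)
      · exact Or.inr ⟨h2, by rw [hz, map_one, one_mul], b, hb, hzn.of_eq rfl (by omega) rfl⟩
    · exfalso
      rcases hsk with ⟨rfl, -⟩ | ⟨rfl, -⟩ <;> revert h1 <;> decide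
  · rw [map_neg, map_ofNat] at hz
    rcases key (e := 5) (by decide) place_neg_three with ⟨-, rfl⟩ | h1
    · rcases hsk with ⟨-, h2⟩ | ⟨h2, -⟩
      · exact Or.inl ⟨h2, hz⟩
      · exact absurd h2 (by decide)
    · exfalso
      rcases hsk with ⟨rfl, -⟩ | ⟨rfl, -⟩ <;> revert h1 <;> decide

end O7

namespace O7

variable {K : Type*} [Field K] [CharZero K] [Algebra O7 K] [IsFractionRing O7 K]
  {σ σ' : K →+* ℚ_[2]} {D : O7}

/-- The duplication step of `exists_half`, at the place above `β`. -/
theorem exists_padic_half (hD : IsTwist D) (hσ : IsPlaceα σ) (hσ' : IsPlaceβ σ') {ξ η : K}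
    (h : η ^ 2 = ξ ^ 4 + algebraMap O7 K (cA D) * ξ ^ 2 + algebraMap O7 K (cB D))
    {k : ℤ} (hk : 1 ≤ k) {c : ZMod 8} (hc : c ^ 2 = 1) (hξ : R8 (σ ξ) (-(k + 1)) c)
    {a : ℚ_[2]} (ha : σ' (algebraMap O7 K (cA D)) = 2 * a) {d : ZMod 8} (had : R8 a 0 d) :
    ∃ x f : ℚ_[2], x * f ^ 2 = x ^ 2 + 2 * a * x + σ' (algebraMap O7 K (cB D)) ∧
      4 * x * (x ^ 2 + 2 * a * x + σ' (algebraMap O7 K (cB D))) * σ' ξ ^ 2 =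
        (x ^ 2 - σ' (algebraMap O7 K (cB D))) ^ 2 ∧
      (k = 1 ∧ R8 x 0 5 ∨ 2 ≤ k ∧ ∃ ξ' η' : K, x = σ' ξ' ^ 2 ∧ ξ' ≠ 0 ∧
        η' ^ 2 = ξ' ^ 4 + algebraMap O7 K (cA D) * ξ' ^ 2 + algebraMap O7 K (cB D) ∧
        ∃ e, e ^ 2 = 1 ∧ R8 (σ ξ') (-k) e) := by
  obtain ⟨x, f, z, hz, h1, h2, h3⟩ := exists_half hD hσ hσ' h hk hc hξ
  have h1' := congrArg σ' h1
  have h2' := congrArg σ' h2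
  simp only [map_mul, map_add, map_sub, map_pow, map_ofNat, ha] at h1' h2'
  refine ⟨σ' x, σ' f, h1', h2', ?_⟩
  rcases h3 with ⟨rfl, hx⟩ | ⟨h3, rfl, h4⟩
  · obtain ⟨n, b, hb, hzn⟩ := R8.exists_of_ne_zero ((map_ne_zero σ').2 hz)
    have h5 := ((place_neg_three (σ := σ')).mul hzn.sq).of_eq (y := σ' x) (m := 2 * n) (d := 5)
      (by rw [hx, map_mul, map_neg, map_ofNat, map_pow]) (by ring) (by rw [hb]; decide)
    have h6 := R8.eq_zero_of_five (R8.two.mul had) (hσ'.cB hD) h5 (even_two_mul n) h1'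
    exact Or.inl ⟨rfl, h5.of_eq rfl h6 rfl⟩
  · exact Or.inr ⟨h3, z, z * f, map_pow _ _ _, hz, by linear_combination h1, h4⟩

/-- The valuation at the place above `β` of a point `(ξ², η ξ)` with pole of order `2 (k + 1)` at
the place above `α`, for the twists congruent to `1`. -/
theorem padic_of_pole (hD : D = 1 ∨ D = -3 * ρ) (hσ : IsPlaceα σ) (hσ' : IsPlaceβ σ') (N : ℕ) :
    ∀ {ξ η : K}, η ^ 2 = ξ ^ 4 + algebraMap O7 K (cA D) * ξ ^ 2 + algebraMap O7 K (cB D) →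
    ∀ {c : ZMod 8}, c ^ 2 = 1 → R8 (σ ξ) (-(N + 1 + 1 : ℤ)) c →
    N = 0 ∧ R8 (σ' ξ ^ 2) 0 1 ∨ N = 1 ∧ R8 (σ' ξ ^ 2) 2 1 ∨
      2 ≤ N ∧ R8 (σ' ξ ^ 2) (-2 * N) 1 := by
  have hD' : IsTwist D := by unfold IsTwist; tauto
  have hne : ¬ (D = -3 ∨ D = ρ) := by
    rcases hD with rfl | rfl <;> decide
  obtain ⟨a, d, ha, had, hC, h0⟩ := hσ'.cA hD'
  obtain rfl : d = 7 := by tauto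
  have hB := hσ'.cB hD'
  induction N with
  | zero =>
    intro ξ η h c hc hξ
    obtain ⟨x, f, h1, h2, ⟨-, h3⟩ | ⟨h3, -⟩⟩ :=
      exists_padic_half hD' hσ hσ' h (by simp) hc hξ ha had
    · exact Or.inl ⟨rfl, R8.dup_of_five had hC h3 h2⟩
    · simp at h3
  | succ N ih =>
    intro ξ η h c hc hξ
    obtain ⟨x, f, h1, h2, ⟨h3, -⟩ | ⟨-, ξ', η', rfl, -, h3, e, he, h4⟩⟩ :=
      exists_padic_half hD' hσ hσ' h (by omega) hc hξ ha had
    · omega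
    · rcases ih h3 he (h4.of_eq rfl (by push_cast; ring) rfl) with
        ⟨rfl, h5⟩ | ⟨rfl, h5⟩ | ⟨h6, h5⟩
      · exact Or.inr (Or.inl ⟨rfl, R8.dup_of_one had hC h5 h1 h2⟩)
      · exact Or.inr (Or.inr ⟨le_rfl, R8.dup_of_pos (R8.two.mul had) hB h5 le_rfl h2⟩)
      · exact Or.inr (Or.inr ⟨by omega, (R8.dup_of_neg (R8.two.mul had) hB h5 (by omega) h2).of_eq
          rfl (by push_cast; ring) rfl⟩)

/-- The valuation at the place above `β` of a point `(ξ², η ξ)` with pole of order `2 (k + 1)` at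
the place above `α`, for the twists congruent to `5`. -/
theorem padic_of_pole' (hD : D = -3 ∨ D = ρ) (hσ : IsPlaceα σ) (hσ' : IsPlaceβ σ') (N : ℕ) :
    ∀ {ξ η : K}, η ^ 2 = ξ ^ 4 + algebraMap O7 K (cA D) * ξ ^ 2 + algebraMap O7 K (cB D) →
    ∀ {c : ZMod 8}, c ^ 2 = 1 → R8 (σ ξ) (-(N + 1 + 1 : ℤ)) c →
    N = 0 ∧ (∃ c, R8 (σ' ξ ^ 2) 4 c) ∨ 1 ≤ N ∧ ∃ n : ℤ, n ≤ -2 * N - 4 ∧ R8 (σ' ξ ^ 2) n 1 := by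
  have hD' : IsTwist D := by unfold IsTwist; tauto
  have hne : ¬ (D = 1 ∨ D = -3 * ρ) := by
    rcases hD with rfl | rfl <;> decide
  obtain ⟨a, d, ha, had, hC, h0⟩ := hσ'.cA hD'
  obtain rfl : d = 3 := by tauto
  have hB := hσ'.cB hD'
  induction N with
  | zero =>
    intro ξ η h c hc hξ
    obtain ⟨x, f, h1, h2, ⟨-, h3⟩ | ⟨h3, -⟩⟩ :=
      exists_padic_half hD' hσ hσ' h (by simp) hc hξ ha had
    · exact Or.inl ⟨rfl, R8.dup_of_five' had hC h3 h1 h2⟩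
    · simp at h3
  | succ N ih =>
    intro ξ η h c hc hξ
    obtain ⟨x, f, h1, h2, ⟨h3, -⟩ | ⟨-, ξ', η', rfl, h0, h3, e, he, h4⟩⟩ :=
      exists_padic_half hD' hσ hσ' h (by omega) hc hξ ha had
    · omega
    · refine Or.inr ⟨by omega, ?_⟩
      rcases ih h3 he (h4.of_eq rfl (by push_cast; ring) rfl) with
        ⟨rfl, b, h5⟩ | ⟨h6, n, hn, h5⟩
      · obtain ⟨n, i, hi, h6⟩ := R8.exists_of_ne_zero ((map_ne_zero σ').2 h0)
        have h7 := h6.sq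
        rw [hi] at h7
        have h8 := h7.le_of_unit (by decide) h5
        exact ⟨_, by push_cast; omega, R8.dup_of_pos (R8.two.mul had) hB h7 (by omega) h2⟩
      · exact ⟨_, by push_cast; omega, R8.dup_of_neg (R8.two.mul had) hB h5 (by omega) h2⟩

end O7

namespace R8

/-- On `y² = x³ + A x² + B x` a coordinate `x` with a pole has unit part `1`. -/
theorem eq_one_of_pole {x y A B : ℚ_[2]} {n : ℤ} {c d e : ZMod 8} (hA : R8 A 0 d) (hB : R8 B 0 e)
    (h : y ^ 2 = x * (x ^ 2 + A * x + B)) (hx : R8 x n c) (hc : c ^ 2 = 1)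
    (hn : n ≤ -3 ∨ n ≤ -2 ∧ ∃ d', R8 A 1 d') : c = 1 := by
  have h1 : R8 (x ^ 2 + A * x) (2 * n) (c ^ 2) := by
    rcases hn with hn | ⟨hn, d', hA⟩
    · exact hx.sq.add_of_lt (hA.mul hx) (by omega)
    · exact hx.sq.add_of_lt (hA.mul hx) (by omega)
  have h2 := hx.mul (h1.add_of_lt hB (by omega))
  rw [← h, hc, mul_one] at h2
  exact (h2.of_sq hc).1

end R8

namespace O7

variable {K : Type*} [Field K] [CharZero K] [Algebra O7 K] [IsFractionRing O7 K]
  {σ σ' : K →+* ℚ_[2]} {D : O7}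

theorem not_pole_of_pole (hD : IsTwist D) (hσ : IsPlaceα σ) (hσ' : IsPlaceβ σ') {X X' y y' M : K}
    (h : y ^ 2 = X * (X ^ 2 + algebraMap O7 K (cA D) * X + algebraMap O7 K (cB D)))
    (h' : y' ^ 2 = X' * (X' ^ 2 + algebraMap O7 K (cA D) * X' + algebraMap O7 K (cB D)))
    (hM : X * X' = algebraMap O7 K ρ * M ^ 2) (hM0 : M ≠ 0)
    {k S : ℤ} (hk : 1 ≤ k) (hS : S = -2 * k ∨ D = 1 ∧ S = -2 * k - 2)
    (hX : ∃ c, c ^ 2 = 1 ∧ R8 (σ X) (-2 * (k + 1)) c)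
    (hX' : (∃ c, c ^ 2 = 1 ∧ R8 (σ' X) S c) ∨ ∃ c, c ^ 2 = 1 ∧ R8 (σ' X') S c) : False := by
  obtain ⟨c, hc, hX⟩ := hX
  obtain ⟨d, hd, hA⟩ := hσ.cA hD
  have hy := congrArg σ h
  simp only [map_mul, map_add, map_pow] at hy
  obtain rfl := R8.eq_one_of_pole hA (hσ.cB hD) hy hX hc (Or.inl (by omega))
  have hX0 := (map_ne_zero σ).1 (hX.ne_zero hc)
  have hy0 : y ≠ 0 := fun h0 => by
    have h1 := hX.mul ((hX.sq.add_of_lt (hA.mul hX) (by omega)).add_of_lt (hσ.cB hD) (by omega))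
    rw [← hy, h0] at h1
    exact h1.ne_zero (by decide) (by simp)
  obtain ⟨δ, z, hδ, hz⟩ := exists_x_eq_mul_sq (fun p hp h => dvd_of_dvd_cB hD hp h) hy0 h
  have hz0 : z ≠ 0 := fun h0 => hX0 (by rw [hz, h0]; ring)
  obtain ⟨n, b, hb, hzn⟩ := R8.exists_of_ne_zero ((map_ne_zero σ).2 hz0)
  have key : ∀ {e}, e ^ 2 = 1 → R8 (σ (algebraMap O7 K δ)) 0 e → 2 * n = -2 * (k + 1) ∧ e = 1 := by
    intro e he hδ
    have hxn := hδ.mul hzn.sq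
    rw [← map_pow, ← map_mul, ← hz, hb, mul_one] at hxn
    have := hxn.unique hX he (by decide)
    exact ⟨by omega, this.2⟩
  have hδ' : δ = 1 ∨ δ = ρ * 3 := by
    have h3 : R8 (σ (algebraMap O7 K 3)) 0 3 := by rw [map_ofNat, map_ofNat]; exact R8.ofNat 3
    rcases dvd_prime_mul prime_ρ hδ with h1 | ⟨δ, h1, rfl⟩
    · rcases dvd_three h1 with rfl | rfl | rfl | rfl
      · exact Or.inl rfl
      · exact absurd (key (e := -1) (by decide) (by simpa using R8.one.neg)).2 (by decide)
      · exact absurd (key (by decide) h3).2 (by decide)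
      · exact absurd (key (by decide) place_neg_three).2 (by decide)
    · rcases dvd_three h1 with rfl | rfl | rfl | rfl
      · exact absurd (key (e := 3) (by decide) (by simpa using hσ.ρ)).2 (by decide)
      · exact absurd (key (e := -3) (by decide) (by simpa using hσ.ρ.neg)).2 (by decide)
      · exact Or.inr rfl
      · exact absurd (key (e := 3 * 5) (by decide)
          ((hσ.ρ.mul place_neg_three).of_eq (by rw [map_mul, map_mul]) (add_zero 0) rfl)).2
          (by decide)
  have hn : 2 * n = -2 * (k + 1) := by
    rcases hδ' with rfl | rfl
    · exact (key (e := 1) (by decide) (by simpa using R8.one)).1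
    · refine (key (e := 3 * 3) (by decide) ?_).1
      rw [map_mul, map_mul, map_ofNat, map_ofNat]
      exact hσ.ρ.mul (R8.ofNat 3)
  obtain ⟨m, b', hb', hzm⟩ := R8.exists_of_ne_zero ((map_ne_zero σ').2 hz0)
  have hclass : ∃ e, (δ = 1 ∧ e = 1 ∨ e = 7) ∧ R8 (σ' X) (2 * m) e := by
    rcases hδ' with rfl | rfl
    · refine ⟨1, Or.inl ⟨rfl, rfl⟩, hzm.sq.of_eq ?_ rfl hb'⟩
      rw [hz, map_one, one_mul, map_pow]
    · refine ⟨7, Or.inr rfl, ((hσ'.ρ.mul (R8.ofNat 3)).mul hzm.sq).of_eq ?_ (by ring) ?_⟩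
      · simp only [hz, map_mul, map_pow, map_ofNat]
      · rw [hb']; decide
  obtain ⟨e, he, hXe⟩ := hclass
  have he1 : e ^ 2 = 1 := by rcases he with ⟨-, rfl⟩ | rfl <;> decide
  obtain ⟨a, d', ha, had, -, -⟩ := hσ'.cA hD
  have hA' := R8.two.mul had
  rw [← ha] at hA'
  have hA0 : ∃ d, R8 (σ' (algebraMap O7 K (cA D))) 0 d := hA'.lower (by decide)
  obtain ⟨d₀, hA0⟩ := hA0
  have hS2 : S ≤ -2 := by omega
  have hXS : δ = 1 ∧ R8 (σ' X) S 1 := by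
    rcases hX' with ⟨c, hc, hXS⟩ | ⟨c, hc, hXS⟩
    · have hy' := congrArg σ' h
      simp only [map_mul, map_add, map_pow] at hy'
      obtain rfl := R8.eq_one_of_pole hA0 (hσ'.cB hD) hy' hXS hc (Or.inr ⟨hS2, _, hA'⟩)
      refine ⟨?_, hXS⟩
      have := (hXe.unique hXS he1 hc).2
      rcases he with he | he
      · exact he.1
      · rw [he] at this; exact absurd this (by decide)
    · exfalso
      have hy' := congrArg σ' h'
      simp only [map_mul, map_add, map_pow] at hy'
      obtain rfl := R8.eq_one_of_pole hA0 (hσ'.cB hD) hy' hXS hc (Or.inr ⟨hS2, _, hA'⟩)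
      obtain ⟨r, b, hb, hMr⟩ := R8.exists_of_ne_zero ((map_ne_zero σ').2 hM0)
      have h1 := hσ'.ρ.mul hMr.sq
      rw [← map_pow, ← map_mul, ← hM, hb, map_mul] at h1
      have := (h1.unique (hXe.mul hXS) (by decide) (by rw [mul_pow, he1]; decide)).2
      rcases he with ⟨-, rfl⟩ | rfl <;> revert this <;> decide
  obtain ⟨rfl, hXS⟩ := hXS
  rw [map_one, one_mul] at hz
  subst hz
  rw [map_pow] at hXS
  have hη : (y / z) ^ 2 = z ^ 4 + algebraMap O7 K (cA D) * z ^ 2 + algebraMap O7 K (cB D) := by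
    rw [div_pow, h]; field_simp
  obtain ⟨N, rfl⟩ : ∃ N : ℕ, k = N + 1 := ⟨(k - 1).toNat, by omega⟩
  have hzk : R8 (σ z) (-(N + 1 + 1 : ℤ)) b := hzn.of_eq rfl (by omega) rfl
  have hcases : (D = 1 ∨ D = -3 * ρ) ∨ (D = -3 ∨ D = ρ) := by unfold IsTwist at hD; tauto
  rcases hcases with hD' | hD'
  · rcases padic_of_pole hD' hσ hσ' N hη hb hzk with ⟨rfl, h1⟩ | ⟨rfl, h1⟩ | ⟨h0, h1⟩
    all_goals
      have := (h1.unique hXS (by decide) (by decide)).1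
      push_cast at *
      omega
  · have hD1 : D ≠ 1 := by rcases hD' with rfl | rfl <;> decide
    rcases padic_of_pole' hD' hσ hσ' N hη hb hzk with ⟨rfl, c, h1⟩ | ⟨h0, n, hn, h1⟩
    · have := hXS.le_of_unit (by decide) h1
      omega
    · have := (h1.unique hXS (by decide) (by decide)).1
      have : S = -2 * (N + 1) := by tauto
      omega

theorem not_pole (hD : IsTwist D) (hσ : IsPlaceα σ) (hσ' : IsPlaceβ σ') {X X' y y' M : K}
    (h : y ^ 2 = X * (X ^ 2 + algebraMap O7 K (cA D) * X + algebraMap O7 K (cB D)))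
    (h' : y' ^ 2 = X' * (X' ^ 2 + algebraMap O7 K (cA D) * X' + algebraMap O7 K (cB D)))
    (hM : X * X' = algebraMap O7 K ρ * M ^ 2) (hM0 : M ≠ 0)
    {k S : ℤ} (hk : 1 ≤ k) (hS : S = -2 * k ∨ D = 1 ∧ S = -2 * k - 2)
    (hX : (∃ c, c ^ 2 = 1 ∧ R8 (σ X) (-2 * (k + 1)) c) ∨
      ∃ c, c ^ 2 = 1 ∧ R8 (σ X') (-2 * (k + 1)) c)
    (hX' : (∃ c, c ^ 2 = 1 ∧ R8 (σ' X) S c) ∨ ∃ c, c ^ 2 = 1 ∧ R8 (σ' X') S c) : False := by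
  rcases hX with hX | hX
  · exact not_pole_of_pole hD hσ hσ' h h' hM hM0 hk hS hX hX'
  · exact not_pole_of_pole hD hσ hσ' h' h (by rw [mul_comm, hM]) hM0 hk hS hX hX'.symm

end O7

namespace R8

variable {x y : ℚ_[2]} {n m : ℤ} {c d : ZMod 8}

/-- A summand of larger valuation does not change the valuation. -/
theorem add_of_lt_of_unit (hx : R8 x n c) (hc : c ^ 2 = 1) (hy : R8 y m d) (h : n < m) :
    ∃ e, e ^ 2 = 1 ∧ R8 (x + y) n e := by
  obtain ⟨e, he⟩ := hy.lower_even h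
  exact ⟨_, by clear * - hc; revert c e; decide, hx.add he⟩

theorem raise_four (hx : R8 x n 4) : ∃ e, e ^ 2 = 1 ∧ R8 x (n + 2) e := by
  obtain ⟨d, hd, hx⟩ := raise (c := 2) hx
  have : ∃ e, d = 2 * e ∧ e ^ 2 = 1 := by clear * - hd; revert d; decide
  obtain ⟨e, rfl, he⟩ := this
  obtain ⟨d, hd, hx⟩ := hx.raise
  exact ⟨d, by clear * - hd he; revert d e; decide, hx.of_eq rfl (by ring) rfl⟩

end R8

namespace O7

section

variable {K : Type*} [Field K] [Algebra O7 K] {σ : K →+* ℚ_[2]}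

theorem algebraMap_eq (z : O7) : algebraMap O7 K z = z.re + z.im * algebraMap O7 K α := by
  conv_lhs => rw [eq_add_mul_α z]
  simp

theorem IsPlaceα.map (h : IsPlaceα σ) (z : O7) :
    R8 (σ (algebraMap O7 K z)) 0 (z.re + 6 * z.im) := by
  have h1 := (R8.intCast z.re).add ((R8.intCast z.im).mul (h.α.shift 1))
  refine h1.of_eq (by simp [algebraMap_eq z]) rfl ?_
  rw [show (2 ^ 1 * 3 : ZMod 8) = 6 by decide]; ring

theorem IsPlaceβ.map (h : IsPlaceβ σ) (z : O7) :
    R8 (σ (algebraMap O7 K z)) 0 (z.re + 3 * z.im) := by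
  have h1 := (R8.intCast z.re).add ((R8.intCast z.im).mul h.α)
  exact h1.of_eq (by simp [algebraMap_eq z]) rfl (by ring)

end

variable {K : Type*} [Field K] [CharZero K] [Algebra O7 K] [IsFractionRing O7 K] {D : O7}

theorem not_sq_of_line (hD : IsTwist D) {q : ℚ} {l : ℤ} {e : ZMod 8} (he : e ^ 2 = 1)
    (hq : R8 (q : ℚ_[2]) (-l) e) {c₀ c₁ c₂ p r : O7}
    (hl : 2 ≤ l ∧ (c₂.re + 6 * c₂.im : ZMod 8) ^ 2 = 1 ∨
      D = 1 ∧ 3 ≤ l ∧ (c₂.re + 6 * c₂.im : ZMod 8) = 4)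
    (hc₂ : (c₂.re + 3 * c₂.im : ZMod 8) = 4) (hc₁ : ∃ d, (c₁.re + 3 * c₁.im : ZMod 8) = 2 * d)
    (hc₀ : ∃ d, (c₀.re + 3 * c₀.im : ZMod 8) = 2 * d) (hp : (p.re + 3 * p.im : ZMod 8) ^ 2 = 1)
    {H M G g a b v : K}
    (hH : H = (algebraMap O7 K c₂ * q ^ 2 + algebraMap O7 K c₁ * q + algebraMap O7 K c₀ / 4) / 9)
    (hM : M = (2 * algebraMap O7 K p * q + algebraMap O7 K r) / 3)
    (h₁ : (a * q + b) ^ 2 = H + algebraMap O7 K (cA D) + G)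
    (h₂ : 2 * (a * q + b) * g * M = algebraMap O7 K (cB D) - algebraMap O7 K ρ * M ^ 2 - H * G)
    (h₃ : g ^ 2 = G * algebraMap O7 K ρ)
    (hv : v ^ 2 = H ^ 2 - 4 * algebraMap O7 K ρ * M ^ 2) : False := by
  obtain ⟨σ, hσ⟩ := exists_isPlaceα (K := K)
  obtain ⟨σ', hσ'⟩ := exists_isPlaceβ (K := K)
  have hY : ∀ X : K, X ^ 2 = H * X - algebraMap O7 K ρ * M ^ 2 → ((a * q + b) * X + g * M) ^ 2 =
      X * (X ^ 2 + algebraMap O7 K (cA D) * X + algebraMap O7 K (cB D)) := by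
    intro X hX
    linear_combination X ^ 2 * h₁ + X * h₂ + M ^ 2 * h₃ + (G - X) * hX
  have hl2 : 2 ≤ l := by omega
  have hX : ∀ s : K, s ^ 2 = v ^ 2 → ((H + s) / 2) ^ 2 =
      H * ((H + s) / 2) - algebraMap O7 K ρ * M ^ 2 := by
    intro s hs
    linear_combination (hs + hv) / 4
  have h9 : R8 9 0 1 := (R8.ofNat 9).of_eq rfl rfl (by decide)
  have hσM : ∃ d, R8 (σ M) (1 - l) d := by
    obtain ⟨d, hd⟩ := (hσ.map r).lower (m := 1 - l) (by omega)
    refine ⟨_, (((((R8.two.mul (hσ.map p)).mul hq).of_eq rfl (by ring) rfl).add hd).div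
      (R8.ofNat 3) (by decide)).of_eq ?_ (sub_zero _) rfl⟩
    simp only [hM, map_div₀, map_add, map_mul, map_ofNat, map_ratCast]
  have hσM' : ∃ d, d ^ 2 = 1 ∧ R8 (σ' M) (1 - l) d := by
    obtain ⟨d, hd, hd'⟩ := ((((R8.two.mul (hσ'.map p)).mul hq).of_eq (m := 1 - l) rfl (by ring)
      rfl).add_of_lt_of_unit (by rw [mul_pow, mul_pow, he, hp]; decide) (hσ'.map r) (by omega))
    refine ⟨d * 3, by rw [mul_pow, hd]; decide,
      (hd'.div (R8.ofNat 3) (by decide)).of_eq ?_ (sub_zero _) rfl⟩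
    simp only [hM, map_div₀, map_add, map_mul, map_ofNat, map_ratCast]
  obtain ⟨d, hM⟩ := hσM
  obtain ⟨d', hd', hM'⟩ := hσM'
  have hσH : ∀ S, S = -2 * l ∧ (c₂.re + 6 * c₂.im : ZMod 8) ^ 2 = 1 ∨
      S = 2 - 2 * l ∧ 3 ≤ l ∧ (c₂.re + 6 * c₂.im : ZMod 8) = 4 →
      ∃ e, e ^ 2 = 1 ∧ R8 (σ H) S e := by
    intro S hS
    have h2 : ∃ e, e ^ 2 = 1 ∧ R8 (σ (algebraMap O7 K c₂)) (S + 2 * l) e := by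
      rcases hS with ⟨rfl, h⟩ | ⟨rfl, -, h⟩
      · exact ⟨_, h, (hσ.map c₂).of_eq rfl (by ring) rfl⟩
      · obtain ⟨e, he, h'⟩ := ((hσ.map c₂).of_eq rfl rfl h).raise_four
        exact ⟨e, he, h'.of_eq rfl (by ring) rfl⟩
    obtain ⟨f, hf, h2⟩ := h2
    obtain ⟨f, hf, h3⟩ := ((h2.mul hq.sq).of_eq (m := S) rfl (by ring) rfl).add_of_lt_of_unit
      (by rw [mul_pow, hf, he]; decide) ((hσ.map c₁).mul hq) (by omega)
    obtain ⟨f, hf, h3⟩ := h3.add_of_lt_of_unit hf ((hσ.map c₀).div R8.four (by decide)) (by omega)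
    refine ⟨f * 1, by rw [mul_one, hf], (h3.div h9 (by decide)).of_eq ?_ (sub_zero _) rfl⟩
    simp only [hH, map_div₀, map_add, map_mul, map_ofNat, map_ratCast, map_pow]
  have hσH' : ∃ e, e ^ 2 = 1 ∧ R8 (σ' H) (2 - 2 * l) e := by
    obtain ⟨f, hf, h2⟩ := ((hσ'.map c₂).of_eq rfl rfl hc₂).raise_four
    obtain ⟨d₁, hc₁⟩ := hc₁
    obtain ⟨d₀, hc₀⟩ := hc₀
    obtain ⟨_, -, h1⟩ := ((hσ'.map c₁).of_eq rfl rfl hc₁).raise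
    obtain ⟨_, -, h0⟩ := ((hσ'.map c₀).of_eq rfl rfl hc₀).raise
    obtain ⟨f, hf, h3⟩ := ((h2.mul hq.sq).of_eq (m := 2 - 2 * l) rfl (by ring)
      rfl).add_of_lt_of_unit (by rw [mul_pow, hf, he]; decide) (h1.mul hq) (by omega)
    obtain ⟨f, hf, h3⟩ := h3.add_of_lt_of_unit hf (h0.div R8.four (by decide)) (by omega)
    refine ⟨f * 1, by rw [mul_one, hf], (h3.div h9 (by decide)).of_eq ?_ (sub_zero _) rfl⟩
    simp only [hH, map_div₀, map_add, map_mul, map_ofNat, map_ratCast, map_pow]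
  have hS : ∃ k : ℤ, 1 ≤ k ∧ (2 - 2 * l = -2 * k ∨ D = 1 ∧ 2 - 2 * l = -2 * k - 2) ∧
      ∃ e, e ^ 2 = 1 ∧ R8 (σ H) (-2 * (k + 1)) e := by
    rcases hl with ⟨h, h'⟩ | ⟨h, h', h''⟩
    · refine ⟨l - 1, by omega, Or.inl (by ring), hσH _ (Or.inl ⟨by ring, h'⟩)⟩
    · refine ⟨l - 2, by omega, Or.inr ⟨h, by ring⟩, hσH _ (Or.inr ⟨by ring, h', h''⟩)⟩
  obtain ⟨k, hk, hkl, f, hf, hH1⟩ := hS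
  obtain ⟨f', hf', hH2⟩ := hσH'
  have hsum : (H + v) / 2 + (H + -v) / 2 = H := by ring
  have hprod : (H + v) / 2 * ((H + -v) / 2) = algebraMap O7 K ρ * M ^ 2 := by
    linear_combination -hv / 4
  refine not_pole hD hσ hσ' (hY _ (hX v rfl)) (hY _ (hX (-v) (by ring))) hprod
    ((map_ne_zero σ').1 (hM'.ne_zero hd')) hk hkl ?_ ?_
  · refine R8.exists_val_eq (T := 2 * (1 - l)) (d := 3 * d ^ 2) ?_ hf ?_ (by omega)
    · rw [← map_add, hsum]; exact hH1
    · rw [← map_mul, hprod, map_mul, map_pow]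
      exact (hσ.ρ.mul hM.sq).of_eq rfl (by ring) rfl
  · refine R8.exists_val_eq (T := 2 * (1 - l)) (d := 5 * d' ^ 2) ?_ hf' ?_ (by omega)
    · rw [← map_add, hsum]; exact hH2
    · rw [← map_mul, hprod, map_mul, map_pow]
      exact (hσ'.ρ.mul hM'.sq).of_eq rfl (by ring) rfl

end O7

namespace O7

section

variable {K : Type*} [Field K] [Algebra O7 K]

theorem algebraMap_mk (a b : ℤ) : algebraMap O7 K ⟨a, b⟩ = a + b * algebraMap O7 K α :=
  algebraMap_eq _

theorem algebraMap_α_sq : algebraMap O7 K α ^ 2 = algebraMap O7 K α - 2 := by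
  rw [← map_pow, α_sq, map_sub, map_ofNat]

end

variable {K : Type*} [Field K] [CharZero K] [Algebra O7 K] [IsFractionRing O7 K] {q : ℚ} {l : ℤ}
  {e : ZMod 8} {m n w : K}

/-- Two-adic obstruction near the points at infinity. -/
theorem not_near_infty (he : e ^ 2 = 1) (hq : R8 (q : ℚ_[2]) (-l) e) (hl : 2 ≤ l)
    (hm : m = 1 - q ^ 2) (hn : n = 1 - 2 * q)
    (hw : w ^ 2 = m ^ 2 + algebraMap O7 K α * m * n - 3 * n ^ 2) :
    False := by
  have hα := algebraMap_α_sq (K := K)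
  set t := algebraMap O7 K α with ht
  refine not_sq_of_line (K := K) (D := 1) (Or.inl rfl) he hq
    (c₀ := ⟨0, 72⟩)
    (c₁ := ⟨18, -18⟩) (c₂ := ⟨-9, -9⟩) (p := ⟨3, 0⟩) (r := ⟨-3, 0⟩)
    (Or.inl ⟨hl, by decide⟩) (by decide) (by decide) (by decide) (by decide) rfl rfl
    (G := -2 - 3 * t) (g := 4 - t) (a := 1 - t) (b := 1) (v := (1 + t) * w) ?_ ?_ ?_ ?_
  all_goals
    simp only [algebraMap_mk, cA, cB, β, ρ, map_mul, map_sub, map_pow, map_neg, map_one, map_ofNat,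
      ← ht] at hw ⊢
    push_cast
    grind

/-- Two-adic obstruction near the points with `x = 1`. -/
theorem not_near_one (he : e ^ 2 = 1) (hq : R8 (q : ℚ_[2]) (-l) e) (hl : 3 ≤ l)
    (hm : m = q ^ 2 + 2 * q) (hn : n = q ^ 2 - 1)
    (hw : w ^ 2 = m ^ 2 + algebraMap O7 K α * m * n - 3 * n ^ 2) :
    False := by
  have hα := algebraMap_α_sq (K := K)
  set t := algebraMap O7 K α with ht
  refine not_sq_of_line (K := K) (D := 1) (Or.inl rfl) he hq
    (c₀ := ⟨-144, -72⟩)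
    (c₁ := ⟨0, -36⟩) (c₂ := ⟨36, 0⟩) (p := ⟨3, 0⟩) (r := ⟨3, 0⟩)
    (Or.inr ⟨rfl, hl, by decide⟩) (by decide) (by decide) (by decide) (by decide) rfl rfl
    (G := -1 + 2 * t) (g := 1 - 2 * t) (a := 2) (b := -t) (v := (2 - 2 * t) * w) ?_ ?_ ?_ ?_
  all_goals
    simp only [algebraMap_mk, cA, cB, β, ρ, map_mul, map_sub, map_pow, map_neg, map_one, map_ofNat,
      ← ht] at hw ⊢
    push_cast
    grind

/-- Two-adic obstruction near the points with `x = -5 / 3`. -/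
theorem not_near_neg_five_thirds (he : e ^ 2 = 1) (hq : R8 (q : ℚ_[2]) (-l) e) (hl : 3 ≤ l)
    (hm : m = -5 * q ^ 2 + 14 * q - 8) (hn : n = 3 * (q ^ 2 - 1))
    (hw : w ^ 2 = m ^ 2 + algebraMap O7 K α * m * n - 3 * n ^ 2) :
    False := by
  have hα := algebraMap_α_sq (K := K)
  set t := algebraMap O7 K α with ht
  refine not_sq_of_line (K := K) (D := 1) (Or.inl rfl) he hq
    (c₀ := ⟨-304, -232⟩)
    (c₁ := ⟨112, 28⟩) (c₂ := ⟨-28, 32⟩) (p := ⟨7, 0⟩) (r := ⟨-13, 0⟩)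
    (Or.inr ⟨rfl, hl, by decide⟩) (by decide) (by decide) (by decide) (by decide) rfl rfl
    (G := (1519 - 294 * t) / 121) (g := (35 + 28 * t) / 11)
    (a := (-2 - 4 * t) / 3) (b := (-112 + 49 * t) / 33)
    (v := ((10 - 2 * t) / 9) * w) ?_ ?_ ?_ ?_
  all_goals
    simp only [algebraMap_mk, cA, cB, β, ρ, map_mul, map_sub, map_pow, map_neg, map_one, map_ofNat,
      ← ht] at hw ⊢
    push_cast
    grind

/-- Two-adic obstruction near the points with `x = 0`. -/
theorem not_near_zero (he : e ^ 2 = 1) (hq : R8 (q : ℚ_[2]) (-l) e) (hl : 2 ≤ l)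
    (hm : m = 2 * q - 1) (hn : n = q ^ 2 - 1)
    (hw : -3 * w ^ 2 = m ^ 2 + algebraMap O7 K α * m * n - 3 * n ^ 2) :
    False := by
  have hα := algebraMap_α_sq (K := K)
  set t := algebraMap O7 K α with ht
  refine not_sq_of_line (K := K) (D := -3) (Or.inr (Or.inl rfl)) he hq
    (c₀ := ⟨432, 216⟩)
    (c₁ := ⟨-54, 54⟩) (c₂ := ⟨-81, -81⟩) (p := ⟨9, 0⟩) (r := ⟨-9, 0⟩)
    (Or.inl ⟨hl, by decide⟩) (by decide) (by decide) (by decide) (by decide) rfl rfl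
    (G := -2 - 3 * t) (g := 4 - t) (a := 3 - 3 * t) (b := -1) (v := (9 + 9 * t) * w) ?_ ?_ ?_ ?_
  all_goals
    simp only [algebraMap_mk, cA, cB, β, ρ, map_mul, map_sub, map_pow, map_neg, map_one, map_ofNat,
      ← ht] at hw ⊢
    push_cast
    grind

/-- Two-adic obstruction near the points with `x = -2`. -/
theorem not_near_neg_two (he : e ^ 2 = 1) (hq : R8 (q : ℚ_[2]) (-l) e) (hl : 2 ≤ l)
    (hm : m = -14 * q ^ 2 + 14 * q - 3) (hn : n = 7 * q ^ 2 - 1)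
    (hw : -algebraMap O7 K ρ * w ^ 2 = m ^ 2 + algebraMap O7 K α * m * n - 3 * n ^ 2) :
    False := by
  have hα := algebraMap_α_sq (K := K)
  set t := algebraMap O7 K α with ht
  refine not_sq_of_line (K := K) (D := ρ) (Or.inr (Or.inr (Or.inl rfl))) he hq
    (c₀ := ⟨1512, -1008⟩)
    (c₁ := ⟨-882, 882⟩) (c₂ := ⟨-441, -441⟩) (p := ⟨-21, 42⟩) (r := ⟨15, -30⟩)
    (Or.inl ⟨hl, by decide⟩) (by decide) (by decide) (by decide) (by decide) rfl rfl
    (G := 14 + 21 * t) (g := 7 * t) (a := 7 - 7 * t) (b := -7) (v := (7 + 7 * t) * w) ?_ ?_ ?_ ?_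
  all_goals
    simp only [algebraMap_mk, cA, cB, β, ρ, map_mul, map_sub, map_pow, map_neg, map_one, map_ofNat,
      ← ht] at hw ⊢
    push_cast
    grind

/-- Two-adic obstruction near the points with `x = 3 / 2`. -/
theorem not_near_three_halves (he : e ^ 2 = 1) (hq : R8 (q : ℚ_[2]) (-l) e) (hl : 2 ≤ l)
    (hm : m = 84 * q ^ 2 + 28 * q + 1) (hn : n = 56 * q ^ 2 - 2)
    (hw : 3 * algebraMap O7 K ρ * w ^ 2 = m ^ 2 + algebraMap O7 K α * m * n - 3 * n ^ 2) :
    False := by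
  have hα := algebraMap_α_sq (K := K)
  set t := algebraMap O7 K α with ht
  refine not_sq_of_line (K := K) (D := -3 * ρ) (Or.inr (Or.inr (Or.inr rfl))) he hq
    (c₀ := ⟨-1701, 1323⟩)
    (c₁ := ⟨-3969, 1323⟩) (c₂ := ⟨-3969, -3969⟩) (p := ⟨-63, 126⟩) (r := ⟨-18, 36⟩)
    (Or.inl ⟨hl, by decide⟩) (by decide) (by decide) (by decide) (by decide) rfl rfl
    (G := 14 + 21 * t) (g := 7 * t) (a := 21 - 21 * t) (b := -(7 + 7 * t) / 2)
    (v := (63 / 4 * (1 + t)) * w) ?_ ?_ ?_ ?_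
  all_goals
    simp only [algebraMap_mk, cA, cB, β, ρ, map_mul, map_sub, map_pow, map_neg, map_one, map_ofNat,
      ← ht] at hw ⊢
    push_cast
    grind

end O7

theorem R8.exists_div {N M : ℤ} {j : ℕ} (hN : N % 4 = 2) (hM : 2 ^ (j + 1) ∣ M) (hM0 : M ≠ 0) :
    ∃ (l : ℤ) (e : ZMod 8), e ^ 2 = 1 ∧ j ≤ l ∧ R8 ((N / M : ℚ) : ℚ) (-l) e := by
  obtain ⟨k, rfl⟩ := hM
  obtain ⟨N', rfl⟩ : ∃ N', N = 2 * (2 * N' + 1) := ⟨N / 4, by omega⟩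
  have hM' : (((2 ^ (j + 1) * k : ℤ) : ℚ) : ℚ_[2]) ≠ 0 := by exact_mod_cast hM0
  obtain ⟨n, c, hc, hn⟩ := R8.exists_of_ne_zero hM'
  have h1 : R8 (((2 ^ (j + 1) * k : ℤ) : ℚ) : ℚ_[2]) (j + 1) k :=
    ⟨k, by rw [zpow_add₀ two_ne_zero]; push_cast; simp [pow_succ], map_intCast _ _⟩
  have h2 := R8.le_of_unit hn hc h1
  have h3 : R8 (((2 * (2 * N' + 1) : ℤ) : ℚ) : ℚ_[2]) 1 (2 * N' + 1 : ℤ) :=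
    ⟨(2 * N' + 1 : ℤ), by rw [zpow_one]; push_cast; rfl, map_intCast _ _⟩
  have h4 : ((2 * N' + 1 : ℤ) : ZMod 8) ^ 2 = 1 := by
    push_cast
    generalize (N' : ZMod 8) = x
    revert x; decide
  refine ⟨n - 1, _, ?_, by omega, (h3.div hn hc).of_eq (by push_cast; rfl) (by ring) rfl⟩
  rw [mul_pow, h4, hc, one_mul]

namespace O7

/-- The quadratic factor over `ℤ[α]` of the homogenization of `x⁴ + x³ - 4x² - 3x + 9`. -/
def quad (m n : ℤ) : O7 := m ^ 2 + α * m * n - 3 * n ^ 2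

theorem algebraMap_quad {K : Type*} [Field K] [Algebra O7 K] (m n : ℤ) :
    algebraMap O7 K (quad m n) = m ^ 2 + algebraMap O7 K α * m * n - 3 * n ^ 2 := by
  simp only [quad, map_sub, map_add, map_mul, map_pow, map_intCast, map_ofNat]

variable {m n A : ℤ} {w : O7}

theorem eq_zero_of_near_infty (hA : A ^ 2 = m ^ 2 - m * n + n ^ 2) (hmA : (m - A) % 4 = 2)
    (hn : 8 ∣ n) (hw : quad m n = w ^ 2) : n = 0 := by
  by_contra h0
  obtain ⟨l, e, he, hl, hq⟩ := R8.exists_div (j := 2) hmA hn h0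
  have hA' := congrArg (Int.cast : ℤ → FractionRing O7) hA
  have hw' := congrArg (algebraMap O7 (FractionRing O7)) hw
  have h0' : (n : FractionRing O7) ≠ 0 := Int.cast_ne_zero.2 h0
  rw [algebraMap_quad] at hw'
  push_cast at hA' hl
  set t : FractionRing O7 := (n - 2 * m + 2 * A) / n ^ 2 with ht
  rw [map_pow] at hw'
  refine not_near_infty (K := FractionRing O7) he hq hl (m := t * m) (n := t * n)
    (w := t * algebraMap O7 _ w) ?_ ?_ (by linear_combination (-t ^ 2) * hw')
  · rw [ht]; push_cast; field_simp; grind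
  · rw [ht]; push_cast; field_simp; grind

theorem eq_of_near_one (hA : A ^ 2 = m ^ 2 - m * n + n ^ 2) (hnA : (A + n) % 4 = 2)
    (hmn : 16 ∣ m - n) (hw : quad m n = w ^ 2) : m - n = 0 := by
  by_contra h0
  obtain ⟨l, e, he, hl, hq⟩ := R8.exists_div (j := 3) hnA hmn h0
  have hA' := congrArg (Int.cast : ℤ → FractionRing O7) hA
  have hw' := congrArg (algebraMap O7 (FractionRing O7)) hw
  have h0' : ((m - n : ℤ) : FractionRing O7) ≠ 0 := Int.cast_ne_zero.2 h0
  rw [algebraMap_quad] at hw'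
  push_cast at hA' hl h0'
  set t : FractionRing O7 := (m + n + 2 * A) / (m - n) ^ 2 with ht
  rw [map_pow] at hw'
  refine not_near_one (K := FractionRing O7) he hq hl (m := t * m) (n := t * n)
    (w := t * algebraMap O7 _ w) ?_ ?_ (by linear_combination (-t ^ 2) * hw')
  · rw [ht]; push_cast; field_simp; grind
  · rw [ht]; push_cast; field_simp; grind

theorem eq_of_near_neg_five_thirds (hA : A ^ 2 = m ^ 2 - m * n + n ^ 2)
    (hnA : (3 * A + 7 * n) % 4 = 2) (hmn : 16 ∣ 3 * m + 5 * n) (hw : quad m n = w ^ 2) :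
    3 * m + 5 * n = 0 := by
  by_contra h0
  obtain ⟨l, e, he, hl, hq⟩ := R8.exists_div (j := 3) hnA hmn h0
  have hA' := congrArg (Int.cast : ℤ → FractionRing O7) hA
  have hw' := congrArg (algebraMap O7 (FractionRing O7)) hw
  have h0' : ((3 * m + 5 * n : ℤ) : FractionRing O7) ≠ 0 := Int.cast_ne_zero.2 h0
  rw [algebraMap_quad] at hw'
  push_cast at hA' hl h0'
  set t : FractionRing O7 := 9 * (14 * A - 13 * m + 11 * n) / (3 * m + 5 * n) ^ 2 with ht
  rw [map_pow] at hw'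
  refine not_near_neg_five_thirds (K := FractionRing O7) he hq hl (m := t * m) (n := t * n)
    (w := t * algebraMap O7 _ w) ?_ ?_ (by linear_combination (-t ^ 2) * hw')
  · rw [ht]; push_cast; field_simp; grind
  · rw [ht]; push_cast; field_simp; grind

theorem eq_zero_of_near_zero (hA : A ^ 2 = m ^ 2 - m * n + n ^ 2) (hnA : (A + n) % 4 = 2)
    (hm : 8 ∣ m) (hw : quad m n = -3 * w ^ 2) : m = 0 := by
  by_contra h0
  obtain ⟨l, e, he, hl, hq⟩ := R8.exists_div (j := 2) hnA hm h0
  have hA' := congrArg (Int.cast : ℤ → FractionRing O7) hA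
  have hw' := congrArg (algebraMap O7 (FractionRing O7)) hw
  have h0' : (m : FractionRing O7) ≠ 0 := Int.cast_ne_zero.2 h0
  rw [algebraMap_quad] at hw'
  push_cast at hA' hl
  set t : FractionRing O7 := (2 * A + 2 * n - m) / m ^ 2 with ht
  rw [map_mul, map_pow, map_neg, map_ofNat] at hw'
  refine not_near_zero (K := FractionRing O7) he hq hl (m := t * m) (n := t * n)
    (w := t * algebraMap O7 _ w) ?_ ?_ (by linear_combination (-t ^ 2) * hw')
  · rw [ht]; push_cast; field_simp
  · rw [ht]; push_cast; field_simp; grind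

theorem eq_of_near_neg_two (hA : 7 * A ^ 2 = m ^ 2 - m * n + n ^ 2) (hnA : (A + n) % 4 = 2)
    (hmn : 8 ∣ m + 2 * n) (hw : quad m n = -ρ * w ^ 2) : m + 2 * n = 0 := by
  by_contra h0
  obtain ⟨l, e, he, hl, hq⟩ := R8.exists_div (j := 2) hnA hmn h0
  have hA' := congrArg (Int.cast : ℤ → FractionRing O7) hA
  have hw' := congrArg (algebraMap O7 (FractionRing O7)) hw
  have h0' : ((m + 2 * n : ℤ) : FractionRing O7) ≠ 0 := Int.cast_ne_zero.2 h0
  rw [algebraMap_quad] at hw'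
  push_cast at hA' hl h0'
  set t : FractionRing O7 := (14 * A - 5 * m + 4 * n) / (m + 2 * n) ^ 2 with ht
  rw [map_mul, map_pow, map_neg] at hw'
  refine not_near_neg_two (K := FractionRing O7) he hq hl (m := t * m) (n := t * n)
    (w := t * algebraMap O7 _ w) ?_ ?_ (by linear_combination (-t ^ 2) * hw')
  · rw [ht]; push_cast; field_simp; grind
  · rw [ht]; push_cast; field_simp; grind

theorem eq_of_near_three_halves (hA : 7 * A ^ 2 = m ^ 2 - m * (2 * n) + (2 * n) ^ 2)
    (hnA : (A + n) % 4 = 2) (hmn : 8 ∣ 2 * (m - 3 * n)) (hw : quad m (2 * n) = 3 * ρ * w ^ 2) :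
    2 * (m - 3 * n) = 0 := by
  by_contra h0
  obtain ⟨l, e, he, hl, hq⟩ := R8.exists_div (j := 2) hnA hmn h0
  have hA' := congrArg (Int.cast : ℤ → FractionRing O7) hA
  have hw' := congrArg (algebraMap O7 (FractionRing O7)) hw
  have h0' : ((m - 3 * n : ℤ) : FractionRing O7) ≠ 0 := Int.cast_ne_zero.2 (by omega)
  rw [algebraMap_quad] at hw'
  push_cast at hA' hl h0'
  set t : FractionRing O7 := 2 * (n + 2 * m + 7 * A) / (m - 3 * n) ^ 2 with ht
  rw [map_mul, map_mul, map_pow, map_ofNat, Int.cast_mul, Int.cast_ofNat] at hw'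
  refine not_near_three_halves (K := FractionRing O7) he hq hl (m := t * m) (n := t * (2 * n))
    (w := t * algebraMap O7 _ w) ?_ ?_ (by linear_combination (-t ^ 2) * hw')
  · rw [ht]; push_cast; field_simp; grind
  · rw [ht]; push_cast; field_simp; grind

end O7

namespace O7

variable {m n : ℤ}

theorem quad_eq (m n : ℤ) : quad m n = ⟨m ^ 2 - 3 * n ^ 2, m * n⟩ := by
  rw [eq_add_mul_α ⟨_, _⟩, quad]; push_cast; ring

theorem norm_quad (m n : ℤ) :
    N (quad m n) = m ^ 4 + m ^ 3 * n - 4 * m ^ 2 * n ^ 2 - 3 * m * n ^ 3 + 9 * n ^ 4 := by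
  rw [quad_eq, norm_eq]; ring

theorem quad_ne_zero (h : IsCoprime m n) : quad m n ≠ 0 := by
  intro h0
  rw [quad_eq] at h0
  have h1 : m ^ 2 - 3 * n ^ 2 = 0 := congrArg QuadraticAlgebra.re h0
  have h2 : m * n = 0 := congrArg QuadraticAlgebra.im h0
  rcases mul_eq_zero.1 h2 with rfl | rfl
  · have : n = 0 := by simpa using h1
    exact not_isCoprime_zero_zero (this ▸ h)
  · have : m = 0 := by simpa using h1
    exact not_isCoprime_zero_zero (this ▸ h)

theorem even_of_β_dvd {z : O7} (h : β ∣ z) : 2 ∣ z.re + z.im := by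
  obtain ⟨w, rfl⟩ := h
  exact ⟨w.im, by rw [show β = ⟨1, -1⟩ by decide]; simp⟩

theorem not_β_dvd_quad (h : IsCoprime m n) : ¬ β ∣ quad m n := by
  intro hd
  have h1 := even_of_β_dvd hd
  rw [quad_eq] at h1
  have h2 := (ZMod.intCast_zmod_eq_zero_iff_dvd _ 2).2 h1
  push_cast at h2
  obtain ⟨a, b, hab⟩ := h
  have h3 := congrArg (Int.cast : ℤ → ZMod 2) hab
  push_cast at h3
  revert h2 h3
  generalize (m : ZMod 2) = x
  generalize (n : ZMod 2) = y
  generalize (a : ZMod 2) = s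
  generalize (b : ZMod 2) = t
  revert x y s t
  decide

/-- The common prime divisors of the factors of the homogenized sextic. -/
theorem dvd_of_dvd_quad (h : IsCoprime m n) {p : O7} (hp : Prime p) (h1 : p ∣ quad m n)
    (h2 : p ∣ ((m : O7) ^ 2 + β * m * n - 3 * n ^ 2) * ((m : O7) ^ 2 - m * n + n ^ 2)) :
    p ∣ ρ * 3 := by
  have hmn : IsCoprime (m : O7) (n : O7) := h.intCast
  have hn : ¬ p ∣ (n : O7) := fun hn => by
    refine hp.not_isUnit (hmn.isUnit_of_dvd' (hp.dvd_of_dvd_pow (n := 2) ?_) hn)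
    have := dvd_sub h1 (hn.mul_left (α * m - 3 * n))
    rwa [quad, show (m : O7) ^ 2 + α * m * n - 3 * n ^ 2 - (α * m - 3 * n) * n = m ^ 2 by ring] at this
  have hm : p ∣ (m : O7) → p ∣ ρ * 3 := fun hm => by
    have := dvd_sub (hm.mul_left (m + α * n)) h1
    rw [quad, show (m + α * n) * (m : O7) - (m ^ 2 + α * m * n - 3 * n ^ 2) = 3 * n ^ 2 by ring] at this
    exact (hp.dvd_or_dvd this).elim (fun h => h.mul_left _)
      fun h => absurd (hp.dvd_of_dvd_pow h) hn
  have hβ : ¬ p ∣ β := fun hβ =>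
    not_β_dvd_quad h (((hp.dvd_prime_iff_associated prime_β).1 hβ).dvd'.trans h1)
  rcases hp.dvd_or_dvd h2 with h2 | h2
  · have := dvd_sub h1 h2
    rw [quad, β, show (m : O7) ^ 2 + α * m * n - 3 * n ^ 2 - (m ^ 2 + (1 - α) * m * n - 3 * n ^ 2)
      = ρ * m * n by rw [ρ]; ring] at this
    rcases hp.dvd_or_dvd this with h | h
    · exact (hp.dvd_or_dvd h).elim (fun h => h.mul_right _) hm
    · exact absurd h hn
  · have h3 := dvd_sub h1 h2
    rw [quad, show (m : O7) ^ 2 + α * m * n - 3 * n ^ 2 - (m ^ 2 - m * n + n ^ 2)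
      = n * ((α + 1) * m - 4 * n) by ring] at h3
    have h4 := (hp.dvd_or_dvd h3).resolve_left hn
    have h5 := dvd_sub (h2.mul_left ((α + 1) ^ 2))
      (h4.mul_left ((α + 1) * m - (α + 1) * n + 4 * n))
    have e : (11 : O7) - α = β ^ 4 * ρ ∨ (11 : O7) - α = -(β ^ 4 * ρ) := by decide
    have e' : (α + 1) ^ 2 * ((m : O7) ^ 2 - m * n + n ^ 2) -
      ((α + 1) * m - (α + 1) * n + 4 * n) * ((α + 1) * m - 4 * n) = n ^ 2 * (11 - α) := by
      linear_combination (n : O7) ^ 2 * α_sq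
    rw [e'] at h5
    have h6 := (hp.dvd_or_dvd h5).resolve_left fun h => hn (hp.dvd_of_dvd_pow h)
    have h7 : p ∣ β ^ 4 * ρ := by
      rcases e with e | e
      · rwa [e] at h6
      · rwa [e, dvd_neg] at h6
    exact ((hp.dvd_or_dvd h7).resolve_left fun h => hβ (hp.dvd_of_dvd_pow h)).mul_right _

theorem exists_quad_eq_mul_sq (h : IsCoprime m n) {Y : ℤ}
    (hY : Y ^ 2 = (m ^ 2 - m * n + n ^ 2) *
      (m ^ 4 + m ^ 3 * n - 4 * m ^ 2 * n ^ 2 - 3 * m * n ^ 3 + 9 * n ^ 4)) (hY0 : Y ≠ 0) :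
    ∃ δ w, δ ∣ ρ * 3 ∧ quad m n = δ * w ^ 2 := by
  refine exists_eq_mul_sq (Int.cast_ne_zero.2 hY0) ?_ fun p hp => dvd_of_dvd_quad h hp
  have hY' := congrArg (Int.cast : ℤ → O7) hY
  push_cast at hY'
  rw [hY', quad, β]
  linear_combination (((m : O7) ^ 2 - m * n + n ^ 2) * m ^ 2 * n ^ 2) * (-α_sq)

theorem not_seven_dvd (h : IsCoprime m n) (h1 : (m : ZMod 7) = 0) (h2 : (n : ZMod 7) = 0) :
    False := by
  obtain ⟨a, b, hab⟩ := h
  have := congrArg (Int.cast : ℤ → ZMod 7) hab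
  push_cast at this
  rw [h1, h2, mul_zero, mul_zero, add_zero] at this
  exact absurd this (by decide)

theorem resρ_quad (m n : ℤ) : resρ (quad m n) = (m + 2 * n) ^ 2 := by
  simp only [quad, map_sub, map_add, map_mul, map_pow, map_intCast, map_ofNat, resρ_α]
  generalize (m : ZMod 7) = x
  generalize (n : ZMod 7) = y
  revert x y; decide

/-- The units modulo squares at `ρ` for which the quartic factor has no solution. -/
theorem class_ne_of_unit (h : IsCoprime m n) {δ w : O7} (hq : quad m n = δ * w ^ 2)
    (hδ : resρ δ = -1 ∨ resρ δ = 3) : False := by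
  have h1 := congrArg resρ hq
  rw [resρ_quad, map_mul, map_pow] at h1
  have key : ∀ x d w : ZMod 7, (d = -1 ∨ d = 3) → x ^ 2 = d * w ^ 2 → x = 0 ∧ w = 0 := by decide
  obtain ⟨h2, h3⟩ := key _ _ _ hδ h1
  obtain ⟨s, rfl⟩ := resρ_eq_zero.1 h3
  have h4 : quad m n = (-7 : ℤ) * (δ * s ^ 2) := by
    have : ρ ^ 2 = -7 := by decide
    rw [hq]; push_cast; linear_combination (δ * s ^ 2) * this
  have h5 := congrArg QuadraticAlgebra.im h4
  rw [quad_eq] at h5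
  simp only [QuadraticAlgebra.im_mul, QuadraticAlgebra.re_intCast, QuadraticAlgebra.im_intCast] at h5
  have h6 := congrArg (Int.cast : ℤ → ZMod 7) h5
  push_cast at h6
  rw [show (-7 : ZMod 7) = 0 by decide] at h6
  have key2 : ∀ x y : ZMod 7, x + 2 * y = 0 → x * y = 0 → x = 0 ∧ y = 0 := by decide
  obtain ⟨h7, h8⟩ := key2 _ _ h2 (by simpa using h6)
  exact not_seven_dvd h h7 h8

theorem class_ne_of_ρ (h : IsCoprime m n) {δ w : O7} (hq : quad m n = ρ * δ * w ^ 2)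
    (hδ : resρ δ = 1 ∨ resρ δ = -3) : False := by
  have h0 : resρ ρ = 0 := resρ_eq_zero.2 dvd_rfl
  have h1 := congrArg resρ hq
  rw [resρ_quad, map_mul, map_mul, h0, zero_mul, zero_mul] at h1
  have h2 : ((m + 2 * n : ℤ) : ZMod 7) = 0 := by
    have key : ∀ x : ZMod 7, x ^ 2 = 0 → x = 0 := by decide
    push_cast; exact key _ h1
  obtain ⟨k, hk⟩ := (ZMod.intCast_zmod_eq_zero_iff_dvd _ 7).1 h2
  obtain rfl : m = 7 * k - 2 * n := by push_cast at hk; linarith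
  have h3 : -(n : O7) ^ 2 - ρ * (7 * k ^ 2 - 4 * k * n + α * k * n) = δ * w ^ 2 := by
    have : ρ ^ 2 = -7 := by decide
    have hρ : ρ = 2 * α - 1 := rfl
    refine mul_left_cancel₀ prime_ρ.ne_zero ?_
    rw [← mul_assoc, ← hq, quad]
    push_cast
    linear_combination (-(7 * k ^ 2 - 4 * k * n + α * k * n) : O7) * this +
      (-(n : O7) ^ 2) * hρ
  have h4 := congrArg resρ h3
  rw [map_sub, map_neg, map_pow, map_mul, h0, zero_mul, sub_zero, map_intCast, map_mul,
    map_pow] at h4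
  have key : ∀ x d w : ZMod 7, (d = 1 ∨ d = -3) → -x ^ 2 = d * w ^ 2 → x = 0 := by decide
  have h5 := key _ _ _ hδ h4
  exact not_seven_dvd h (by push_cast; rw [h5, show (7 : ZMod 7) = 0 by decide]; ring) h5

theorem quad_class (h : IsCoprime m n) {Y : ℤ}
    (hY : Y ^ 2 = (m ^ 2 - m * n + n ^ 2) *
      (m ^ 4 + m ^ 3 * n - 4 * m ^ 2 * n ^ 2 - 3 * m * n ^ 3 + 9 * n ^ 4)) (hY0 : Y ≠ 0) :
    ∃ w, quad m n = w ^ 2 ∨ quad m n = -3 * w ^ 2 ∨ quad m n = -ρ * w ^ 2 ∨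
      quad m n = 3 * ρ * w ^ 2 := by
  obtain ⟨δ, w, hδ, hw⟩ := exists_quad_eq_mul_sq h hY hY0
  refine ⟨w, ?_⟩
  rcases dvd_prime_mul prime_ρ hδ with h1 | ⟨δ', h1, rfl⟩
  · rcases dvd_three h1 with rfl | rfl | rfl | rfl
    · left; rw [hw, one_mul]
    · exact (class_ne_of_unit h hw (by simp only [map_neg, map_one]; decide)).elim
    · exact (class_ne_of_unit h hw (by simp only [map_ofNat]; decide)).elim
    · right; left; exact hw
  · rcases dvd_three h1 with rfl | rfl | rfl | rfl
    · exact (class_ne_of_ρ h hw (by simp only [map_one]; decide)).elim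
    · right; right; left; rw [hw]; ring
    · right; right; right; rw [hw]; ring
    · exact (class_ne_of_ρ h hw (by simp only [map_neg, map_ofNat]; decide)).elim

theorem exists_mul_eq_sq {δ w : O7} {Y k c : ℤ}
    (hY : Y ^ 2 = (m ^ 2 - m * n + n ^ 2) *
      (m ^ 4 + m ^ 3 * n - 4 * m ^ 2 * n ^ 2 - 3 * m * n ^ 3 + 9 * n ^ 4)) (hY0 : Y ≠ 0)
    (hw : quad m n = δ * w ^ 2) (hδ : N δ = k * c ^ 2) :
    ∃ B, B ^ 2 = k * (m ^ 2 - m * n + n ^ 2) := by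
  rw [← norm_quad, hw, map_mul, map_pow, hδ] at hY
  have h1 : (c * N w) ^ 2 ∣ Y ^ 2 := ⟨k * (m ^ 2 - m * n + n ^ 2), by rw [hY]; ring⟩
  obtain ⟨B, rfl⟩ := (Int.pow_dvd_pow_iff two_ne_zero).1 h1
  refine ⟨B, mul_left_cancel₀ (pow_ne_zero 2 (left_ne_zero_of_mul hY0)) ?_⟩
  linear_combination hY

theorem exists_seven_mul_sq {B k : ℤ} (h : B ^ 2 = 7 * k) : ∃ A, 7 * A ^ 2 = k := by
  obtain ⟨A, rfl⟩ := (by norm_num : Prime (7 : ℤ)).dvd_of_dvd_pow (Dvd.intro k h.symm)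
  exact ⟨A, by linarith⟩

theorem odd_of_coprime (h : IsCoprime m n) {A k : ℤ} (hA : k * A ^ 2 = m ^ 2 - m * n + n ^ 2) :
    A % 2 = 1 := by
  by_contra hA2
  obtain ⟨a, b, hab⟩ := h
  have h1 := congrArg (Int.cast : ℤ → ZMod 2) hA
  have h2 := congrArg (Int.cast : ℤ → ZMod 2) hab
  have h3 : (A : ZMod 2) = 0 := (ZMod.intCast_zmod_eq_zero_iff_dvd _ 2).2 (by omega)
  push_cast at h1 h2
  rw [h3] at h1
  revert h1 h2
  generalize (m : ZMod 2) = x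
  generalize (n : ZMod 2) = y
  generalize (a : ZMod 2) = s
  generalize (b : ZMod 2) = t
  generalize (k : ZMod 2) = u
  revert x y s t u
  decide

theorem ne_zero_of_coprime (h : IsCoprime m n) : (m * 8 : ZMod 16) ≠ 0 ∨ (n * 8 : ZMod 16) ≠ 0 := by
  obtain ⟨a, b, hab⟩ := h
  by_contra! hc
  have h2 := congrArg (Int.cast : ℤ → ZMod 16) hab
  push_cast at h2
  have h3 : (8 : ZMod 16) = 0 := by linear_combination (-8) * h2 + a * hc.1 + b * hc.2
  exact absurd h3 (by decide)

/-- The reduction `ℤ[α] → ℤ/16` modulo the fourth power of a prime above `2`. -/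
noncomputable def res16 {r : ZMod 16} (hr : r ^ 2 = r - 2) : O7 →+* ZMod 16 :=
  (QuadraticAlgebra.lift (R := ℤ) (A := ZMod 16) (a := -2) (b := 1)
    ⟨r, by simpa [sq, sub_eq_neg_add] using hr⟩ : O7 →ₐ[ℤ] ZMod 16)

theorem res16_α {r : ZMod 16} (hr : r ^ 2 = r - 2) : res16 hr α = r := by simp [res16, α]

theorem res16_quad {r : ZMod 16} (hr : r ^ 2 = r - 2) (m n : ℤ) :
    res16 hr (quad m n) = m ^ 2 + r * m * n - 3 * n ^ 2 := by
  simp only [quad, map_sub, map_add, map_mul, map_pow, map_intCast, map_ofNat, res16_α]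

theorem exists_res16 {δ w : O7} (hw : quad m n = δ * w ^ 2) {r : ZMod 16} (hr : r ^ 2 = r - 2) :
    ∃ x : ZMod 16, (m ^ 2 + r * m * n - 3 * n ^ 2 : ZMod 16) = (δ.re + δ.im * r) * x ^ 2 := by
  refine ⟨res16 hr w, ?_⟩
  have h1 := congrArg (res16 hr) hw
  rw [res16_quad, map_mul, map_pow, eq_add_mul_α δ, map_add, map_mul, map_intCast, map_intCast,
    res16_α] at h1
  exact h1

end O7

namespace O7

variable {m n A : ℤ} {w : O7}

theorem exists_sign {A n : ℤ} (hA : A % 2 = 1) (hn : n % 2 = 1) :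
    ∃ B, B ^ 2 = A ^ 2 ∧ (B + n) % 4 = 2 := by
  rcases (by omega : (A + n) % 4 = 2 ∨ (-A + n) % 4 = 2) with h | h
  · exact ⟨A, rfl, h⟩
  · exact ⟨-A, neg_sq A, h⟩

theorem odd_of_mul_eight {k : ℤ} (hk : (k * 8 : ZMod 16) ≠ 0) : k % 2 = 1 := by
  by_contra hk2
  refine hk ?_
  have := (ZMod.intCast_zmod_eq_zero_iff_dvd (k * 8) 16).2 (by omega)
  exact_mod_cast this

theorem of_class_one (h : IsCoprime m n) (hA : A ^ 2 = m ^ 2 - m * n + n ^ 2)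
    (hw : quad m n = w ^ 2) : n = 0 ∨ m = n ∨ 3 * m = -5 * n := by
  have hA2 := odd_of_coprime h (k := 1) (by rw [one_mul, hA])
  have hw1 : quad m n = 1 * w ^ 2 := by rw [one_mul, hw]
  obtain ⟨x, hx⟩ := exists_res16 hw1 (r := 6) (by decide)
  obtain ⟨y, hy⟩ := exists_res16 hw1 (r := 11) (by decide)
  simp only [QuadraticAlgebra.re_one, QuadraticAlgebra.im_one, Int.cast_one, Int.cast_zero,
    zero_mul, add_zero, one_mul] at hx hy
  have key : ∀ m n : ZMod 16, (m * 8 ≠ 0 ∨ n * 8 ≠ 0) →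
      (∃ x, m ^ 2 + 6 * m * n - 3 * n ^ 2 = x ^ 2) →
      (∃ x, m ^ 2 + 11 * m * n - 3 * n ^ 2 = x ^ 2) →
      m * 8 ≠ 0 ∧ (2 * n = 0 ∨ n * 8 ≠ 0 ∧ (m - n = 0 ∨ 3 * m + 5 * n = 0)) := by
    decide +kernel
  obtain ⟨hm, hmn⟩ := key m n (ne_zero_of_coprime h) ⟨x, hx⟩ ⟨y, hy⟩
  rcases hmn with hn | ⟨hn, hmn | hmn⟩
  · obtain ⟨B, hB, hBm⟩ := exists_sign hA2 (odd_of_mul_eight hm)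
    have hn' := (ZMod.intCast_zmod_eq_zero_iff_dvd (2 * n) 16).1 (by exact_mod_cast hn)
    exact Or.inl (eq_zero_of_near_infty (A := -B) (by rw [neg_sq, hB, hA]) (by omega)
      (by omega) hw)
  · obtain ⟨B, hB, hBn⟩ := exists_sign hA2 (odd_of_mul_eight hn)
    have hn' := (ZMod.intCast_zmod_eq_zero_iff_dvd (m - n) 16).1 (by exact_mod_cast hmn)
    have := eq_of_near_one (hB.trans hA) hBn hn' hw
    omega
  · obtain ⟨B, hB, hBn⟩ := exists_sign hA2 (odd_of_mul_eight hn)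
    have hn' := (ZMod.intCast_zmod_eq_zero_iff_dvd (3 * m + 5 * n) 16).1 (by exact_mod_cast hmn)
    have := eq_of_near_neg_five_thirds (hB.trans hA) (by omega) hn' hw
    omega

theorem of_class_neg_three (h : IsCoprime m n) (hA : A ^ 2 = m ^ 2 - m * n + n ^ 2)
    (hw : quad m n = -3 * w ^ 2) : m = 0 := by
  have hA2 := odd_of_coprime h (k := 1) (by rw [one_mul, hA])
  obtain ⟨x, hx⟩ := exists_res16 hw (r := 6) (by decide)
  obtain ⟨y, hy⟩ := exists_res16 hw (r := 11) (by decide)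
  rw [show (-3 : O7) = ⟨-3, 0⟩ by decide] at hx hy
  push_cast at hx hy
  rw [zero_mul, add_zero] at hx hy
  have hA' := congrArg (Int.cast : ℤ → ZMod 16) hA
  push_cast at hA'
  have key : ∀ m n : ZMod 16, (m * 8 ≠ 0 ∨ n * 8 ≠ 0) →
      (∃ x, m ^ 2 + 6 * m * n - 3 * n ^ 2 = -3 * x ^ 2) →
      (∃ x, m ^ 2 + 11 * m * n - 3 * n ^ 2 = -3 * x ^ 2) →
      (∃ x, x ^ 2 = m ^ 2 - m * n + n ^ 2) → n * 8 ≠ 0 ∧ 2 * m = 0 := by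
    decide +kernel
  obtain ⟨hn, hm⟩ := key m n (ne_zero_of_coprime h) ⟨x, hx⟩ ⟨y, hy⟩ ⟨A, hA'⟩
  obtain ⟨B, hB, hBn⟩ := exists_sign hA2 (odd_of_mul_eight hn)
  have hm' := (ZMod.intCast_zmod_eq_zero_iff_dvd (2 * m) 16).1 (by exact_mod_cast hm)
  exact eq_zero_of_near_zero (hB.trans hA) hBn (by omega) hw

theorem of_class_neg_ρ (h : IsCoprime m n) (hA : 7 * A ^ 2 = m ^ 2 - m * n + n ^ 2)
    (hw : quad m n = -ρ * w ^ 2) : m = -2 * n := by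
  have hA2 := odd_of_coprime h hA
  obtain ⟨x, hx⟩ := exists_res16 hw (r := 6) (by decide)
  obtain ⟨y, hy⟩ := exists_res16 hw (r := 11) (by decide)
  rw [show -ρ = ⟨1, -2⟩ by decide] at hx hy
  push_cast at hx hy
  have key : ∀ m n : ZMod 16, (m * 8 ≠ 0 ∨ n * 8 ≠ 0) →
      (∃ x, m ^ 2 + 6 * m * n - 3 * n ^ 2 = (1 + -2 * 6) * x ^ 2) →
      (∃ x, m ^ 2 + 11 * m * n - 3 * n ^ 2 = (1 + -2 * 11) * x ^ 2) →
      n * 8 ≠ 0 ∧ 2 * (m + 2 * n) = 0 := by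
    decide +kernel
  obtain ⟨hn, hmn⟩ := key m n (ne_zero_of_coprime h) ⟨x, hx⟩ ⟨y, hy⟩
  obtain ⟨B, hB, hBn⟩ := exists_sign hA2 (odd_of_mul_eight hn)
  have hm' := (ZMod.intCast_zmod_eq_zero_iff_dvd (2 * (m + 2 * n)) 16).1 (by exact_mod_cast hmn)
  have := eq_of_near_neg_two (by rw [hB, hA]) hBn (by omega) hw
  omega

theorem of_class_three_ρ (h : IsCoprime m n) (hA : 7 * A ^ 2 = m ^ 2 - m * n + n ^ 2)
    (hw : quad m n = 3 * ρ * w ^ 2) : 2 * m = 3 * n := by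
  have hA2 := odd_of_coprime h hA
  obtain ⟨x, hx⟩ := exists_res16 hw (r := 6) (by decide)
  obtain ⟨y, hy⟩ := exists_res16 hw (r := 11) (by decide)
  rw [show 3 * ρ = ⟨-3, 6⟩ by decide] at hx hy
  push_cast at hx hy
  have key : ∀ m n : ZMod 16, (m * 8 ≠ 0 ∨ n * 8 ≠ 0) →
      (∃ x, m ^ 2 + 6 * m * n - 3 * n ^ 2 = (-3 + 6 * 6) * x ^ 2) →
      (∃ x, m ^ 2 + 11 * m * n - 3 * n ^ 2 = (-3 + 6 * 11) * x ^ 2) →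
      m * 8 ≠ 0 ∧ 2 * (n - 6 * m) = 0 := by
    decide +kernel
  obtain ⟨hm, hmn⟩ := key m n (ne_zero_of_coprime h) ⟨x, hx⟩ ⟨y, hy⟩
  have hm' := (ZMod.intCast_zmod_eq_zero_iff_dvd (2 * (n - 6 * m)) 16).1 (by exact_mod_cast hmn)
  have hm2 := odd_of_mul_eight hm
  obtain ⟨n, rfl⟩ : ∃ k, n = 2 * k := ⟨n / 2, by omega⟩
  obtain ⟨B, hB, hBn⟩ := exists_sign hA2 (n := n) (by omega)
  have := eq_of_near_three_halves (by rw [hB, hA]) hBn (by omega) hw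
  omega

/-- The homogeneous form of the main result. -/
theorem cases_of_sq_eq (h : IsCoprime m n) (hn : n ≠ 0) {Y : ℤ}
    (hY : Y ^ 2 = (m ^ 2 - m * n + n ^ 2) *
      (m ^ 4 + m ^ 3 * n - 4 * m ^ 2 * n ^ 2 - 3 * m * n ^ 3 + 9 * n ^ 4)) :
    m = n ∨ 3 * m = -5 * n ∨ m = 0 ∨ m = -2 * n ∨ 2 * m = 3 * n := by
  have hY0 : Y ≠ 0 := by
    rintro rfl
    rw [← norm_quad, eq_comm, zero_pow two_ne_zero, mul_eq_zero, norm_eq_zero] at hY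
    refine hY.elim (fun h0 => ?_) (quad_ne_zero h)
    nlinarith [sq_nonneg (2 * m - n), sq_pos_of_ne_zero hn]
  obtain ⟨w, hw | hw | hw | hw⟩ := quad_class h hY hY0
  · obtain ⟨B, hB⟩ := exists_mul_eq_sq (δ := 1) (k := 1) (c := 1) hY hY0 (by rw [hw, one_mul])
      (by simp)
    have := of_class_one h (by rw [hB, one_mul]) hw
    tauto
  · obtain ⟨B, hB⟩ := exists_mul_eq_sq (k := 1) (c := 3) hY hY0 hw (by decide)
    have := of_class_neg_three h (by rw [hB, one_mul]) hw
    tauto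
  · obtain ⟨B, hB⟩ := exists_mul_eq_sq (k := 7) (c := 1) hY hY0 hw (by decide)
    obtain ⟨A, hA⟩ := exists_seven_mul_sq hB
    have := of_class_neg_ρ h hA hw
    tauto
  · obtain ⟨B, hB⟩ := exists_mul_eq_sq (k := 7) (c := 3) hY hY0 hw (by decide)
    obtain ⟨A, hA⟩ := exists_seven_mul_sq hB
    have := of_class_three_ρ h hA hw
    tauto

end O7

/-- The affine rational points of the hyperelliptic model
`y² = (x² - x + 1)(x⁴ + x³ - 4x² - 3x + 9)` of the modular curve `X₀(147)*`. -/
theorem X0_147_star_affine_rational_points (x y : ℚ) :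
    y ^ 2 = (x ^ 2 - x + 1) * (x ^ 4 + x ^ 3 - 4 * x ^ 2 - 3 * x + 9) ↔
      (x, y) = (0, 3) ∨ (x, y) = (0, -3) ∨ (x, y) = (1, 2) ∨ (x, y) = (1, -2) ∨
      (x, y) = (-2, 7) ∨ (x, y) = (-2, -7) ∨ (x, y) = (3/2, 21/8) ∨ (x, y) = (3/2, -21/8) ∨
      (x, y) = (-5/3, 154/27) ∨ (x, y) = (-5/3, -154/27) := by
  simp only [Prod.mk.injEq]
  constructor
  · intro h
    have hd : (x.den : ℚ) ≠ 0 := Nat.cast_ne_zero.2 x.den_nz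
    have hx : x = x.num / x.den := (Rat.num_div_den x).symm
    have hc : IsCoprime x.num x.den := x.isCoprime_num_den
    have h1 : (y * x.den ^ 3) ^ 2 = (((x.num ^ 2 - x.num * x.den + x.den ^ 2) *
        (x.num ^ 4 + x.num ^ 3 * x.den - 4 * x.num ^ 2 * x.den ^ 2 - 3 * x.num * x.den ^ 3 +
          9 * x.den ^ 4) : ℤ) : ℚ) := by
      have hx' : (x.num : ℚ) = x * x.den := by rw [eq_div_iff hd] at hx; exact hx.symm
      push_cast
      rw [hx', mul_pow, h]
      ring
    have hYint : IsIntegral ℤ ((y * x.den ^ 3) ^ 2) := by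
      rw [h1, ← eq_intCast (algebraMap ℤ ℚ)]
      exact isIntegral_algebraMap
    obtain ⟨Y, hY⟩ := IsIntegrallyClosed.exists_algebraMap_eq_of_isIntegral_pow two_pos hYint
    rw [← hY, eq_intCast] at h1
    have h2 := O7.cases_of_sq_eq hc (by exact_mod_cast x.den_nz) (by exact_mod_cast h1)
    have h3 : x = 1 ∨ x = -5 / 3 ∨ x = 0 ∨ x = -2 ∨ x = 3 / 2 := by
      rcases h2 with h2 | h2 | h2 | h2 | h2 <;>
      · have h3 := congrArg (Int.cast : ℤ → ℚ) h2
        push_cast at h3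
        rw [hx]
        field_simp
        grind
    have h4 : ∀ {a : ℚ}, y ^ 2 = a ^ 2 → y = a ∨ y = -a := sq_eq_sq_iff_eq_or_eq_neg.1
    rcases h3 with rfl | rfl | rfl | rfl | rfl
    · have := h4 (a := 2) (by rw [h]; norm_num)
      tauto
    · have := h4 (a := 154 / 27) (by rw [h]; norm_num)
      grind
    · have := h4 (a := 3) (by rw [h]; norm_num)
      tauto
    · have := h4 (a := 7) (by rw [h]; norm_num)
      tauto
    · have := h4 (a := 21 / 8) (by rw [h]; norm_num)
      grind
  · rintro (⟨rfl, rfl⟩ | ⟨rfl, rfl⟩ | ⟨rfl, rfl⟩ | ⟨rfl, rfl⟩ | ⟨rfl, rfl⟩ | ⟨rfl, rfl⟩ |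
      ⟨rfl, rfl⟩ | ⟨rfl, rfl⟩ | ⟨rfl, rfl⟩ | ⟨rfl, rfl⟩) <;> norm_num
end

section
/- The only pairs (x, y) of rational numbers satisfying y^2 = x^8 - 6x^7 + 11x^6 - 12x^5 + 9x^4 - 12x^3 + 11x^2 - 6x + 1 are (0, 1) and (0, -1). -/
/-- If `R * S = p * k ^ 4` with `p` prime and no prime divides all of `R`, `S`, `k`, then up to
sign `R` and `S` are a fourth power and `p` times a fourth power, in some order. -/
theorem exists_fourth_powers_of_mul_eq {p R S k : ℤ} (hp : Prime p) (hk : k ≠ 0)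
    (h : R * S = p * k ^ 4) (hc : ∀ q : ℤ, Prime q → q ∣ R → q ∣ S → q ∣ k → False) :
    ∃ r s ε : ℤ, (ε = 1 ∨ ε = -1) ∧ (r * s) ^ 2 = k ^ 2 ∧
      ((R = ε * r ^ 4 ∧ S = ε * (p * s ^ 4)) ∨ (S = ε * r ^ 4 ∧ R = ε * (p * s ^ 4))) := by
  wlog hS : p ∣ S generalizing R S
  · have hR : p ∣ R := (hp.dvd_or_dvd (h ▸ dvd_mul_right p _ : p ∣ R * S)).resolve_right hS
    obtain ⟨r, s, ε, hε, hrs, h'⟩ := this (R := S) (S := R) (by linarith)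
      (fun q hq h1 h2 h3 => hc q hq h2 h1 h3) hR
    exact ⟨r, s, ε, hε, hrs, h'.symm⟩
  obtain ⟨T, rfl⟩ := hS
  have hT : R * T = k ^ 4 := mul_left_cancel₀ hp.ne_zero (by linarith)
  have hcop : IsCoprime R T := by
    refine isCoprime_of_prime_dvd ?_ ?_
    · rintro ⟨rfl, rfl⟩
      exact pow_ne_zero 4 hk (by simpa using hT.symm)
    · intro q hq h1 h2
      exact hc q hq h1 (h2.mul_left p)
        (hq.dvd_of_dvd_pow (hT ▸ h1.mul_right T : q ∣ k ^ 4))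
  obtain ⟨r, hr⟩ := exists_associated_pow_of_mul_eq_pow' hcop hT
  obtain ⟨s, hs⟩ := exists_associated_pow_of_mul_eq_pow' hcop.symm (by rw [mul_comm]; exact hT)
  have hk4 : 0 < k ^ 4 := by positivity
  have key : ∀ z : ℤ, (z ^ 2) ^ 2 = (k ^ 2) ^ 2 → z ^ 2 = k ^ 2 := fun z hz =>
    (pow_left_inj₀ (sq_nonneg z) (sq_nonneg k) two_ne_zero).1 hz
  have hr0 : 0 ≤ r ^ 4 := by positivity
  have hs0 : 0 ≤ s ^ 4 := by positivity
  rcases Int.associated_iff.1 hr with hr | hr <;> rcases Int.associated_iff.1 hs with hs | hs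
  · refine ⟨r, s, 1, Or.inl rfl, key _ ?_, Or.inl ⟨by linarith, by rw [hs]; ring⟩⟩
    rw [← hr, ← hs] at hT
    linear_combination hT
  · obtain rfl : T = -s ^ 4 := by linarith
    rw [← hr] at hT
    nlinarith [mul_nonneg hr0 hs0]
  · obtain rfl : R = -r ^ 4 := by linarith
    rw [← hs] at hT
    nlinarith [mul_nonneg hr0 hs0]
  · obtain rfl : T = -s ^ 4 := by linarith
    obtain rfl : R = -r ^ 4 := by linarith
    refine ⟨r, s, -1, Or.inr rfl, key _ ?_, Or.inl ⟨by ring, by ring⟩⟩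
    linear_combination hT

/-- If `R * S = 3 * k ^ 4` with no prime dividing all of `R`, `S`, `k`, and
`13 * k ^ 2 + 4 * (R + S)` is a square, then `R + S` has the form `r ^ 4 + 3 * s ^ 4`. -/
theorem sum_of_fourth_powers {R S k : ℤ} (hk : k ≠ 0)
    (h : R * S = 3 * k ^ 4) (hc : ∀ q : ℤ, Prime q → q ∣ R → q ∣ S → q ∣ k → False)
    (hpos : ∃ b : ℤ, b ^ 2 = 13 * k ^ 2 + 4 * (R + S)) :
    ∃ r s : ℤ, (r * s) ^ 2 = k ^ 2 ∧ R + S = r ^ 4 + 3 * s ^ 4 := by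
  obtain ⟨r, s, ε, hε, hrs, h'⟩ := exists_fourth_powers_of_mul_eq Int.prime_three hk h hc
  have hsum : R + S = ε * (r ^ 4 + 3 * s ^ 4) := by
    rcases h' with ⟨h1, h2⟩ | ⟨h1, h2⟩ <;> rw [h1, h2] <;> ring
  refine ⟨r, s, hrs, ?_⟩
  rcases hε with rfl | rfl
  · linarith
  · obtain ⟨b, hb⟩ := hpos
    have hk2 : 0 < k ^ 2 := by positivity
    have : 16 * b ^ 2 + (8 * r ^ 2 - 13 * s ^ 2) ^ 2 + 23 * s ^ 4 = 0 := by
      rw [hb, hsum, ← hrs]; ring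
    have hs : s ≠ 0 := by
      rintro rfl
      simp at hrs
      exact hk (pow_eq_zero_iff two_ne_zero |>.1 hrs.symm)
    have : 0 < s ^ 4 := by positivity
    nlinarith [sq_nonneg b, sq_nonneg (8 * r ^ 2 - 13 * s ^ 2)]

/-- The descent through the isogeny with kernel of order two, with the class of `-1` excluded
modulo `3`. -/
theorem difference_of_fourth_powers {A B k m : ℤ} (hk : k ≠ 0) (h : A * B = 23 * k ^ 4)
    (hc : ∀ q : ℤ, Prime q → q ∣ A → q ∣ B → q ∣ k → False)
    (hm : B - A = m ^ 2 + 26 * k ^ 2) (h3 : ¬ (3 ∣ m ∧ 3 ∣ k)) :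
    ∃ a b : ℤ, (a * b) ^ 2 = k ^ 2 ∧ m ^ 2 = (b ^ 2 - 13 * a ^ 2) ^ 2 - 192 * a ^ 4 := by
  have h23 : Prime (23 : ℤ) := Int.prime_iff_natAbs_prime.2 (by norm_num)
  obtain ⟨r, s, ε, hε, hrs, h'⟩ := exists_fourth_powers_of_mul_eq h23 hk h hc
  have hdiff : m ^ 2 = r ^ 4 - 26 * r ^ 2 * s ^ 2 - 23 * s ^ 4 ∨
      m ^ 2 = 23 * s ^ 4 - 26 * r ^ 2 * s ^ 2 - r ^ 4 := by
    rcases hε with rfl | rfl <;> rcases h' with ⟨h1, h2⟩ | ⟨h1, h2⟩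
    · right; rw [h1, h2, ← hrs] at hm; linarith
    · left; rw [h1, h2, ← hrs] at hm; linarith
    · left; rw [h1, h2, ← hrs] at hm; linarith
    · right; rw [h1, h2, ← hrs] at hm; linarith
  rcases hdiff with hd | hd
  · exact ⟨s, r, by linarith, by rw [hd]; ring⟩
  · exfalso
    have hmod : ∀ x y z : ZMod 3, x ^ 2 = 23 * y ^ 4 - 26 * z ^ 2 * y ^ 2 - z ^ 4 →
        x = 0 ∧ y = 0 := by decide
    have hd' := congrArg (Int.cast : ℤ → ZMod 3) hd
    push_cast at hd'
    obtain ⟨h1, h2⟩ := hmod _ _ _ hd'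
    have h1 : (3 : ℤ) ∣ m := (ZMod.intCast_zmod_eq_zero_iff_dvd m 3).1 h1
    have h2 : (3 : ℤ) ∣ s := (ZMod.intCast_zmod_eq_zero_iff_dvd s 3).1 h2
    exact h3 ⟨h1, Int.prime_three.dvd_of_dvd_pow (n := 2)
      (hrs ▸ dvd_pow (h2.mul_left r) two_ne_zero)⟩

/-- Descent on a primitive solution of `N² = m⁴ + 13 m² e² + 48 e⁴` with `e` odd. -/
theorem descent_of_odd {m e N : ℤ} (he : e ≠ 0)
    (hc : ∀ q : ℤ, Prime q → q ∣ m → q ∣ e → False)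
    (h : N ^ 2 = m ^ 4 + 13 * m ^ 2 * e ^ 2 + 48 * e ^ 4) (hodd : Odd e) :
    ∃ b r s : ℤ, e ^ 2 = (b * r * s) ^ 2 ∧
      4 * b ^ 2 = 4 * (4 * r ^ 4 + 13 * r ^ 2 * s ^ 2 + 12 * s ^ 4) := by
  have h2 : ¬ (2 : ℤ) ∣ e := by rwa [← even_iff_two_dvd, Int.not_even_iff_odd]
  obtain ⟨a, b, hab, hm⟩ := difference_of_fourth_powers (A := 2 * N - 2 * m ^ 2 - 13 * e ^ 2)
    (B := 2 * N + 2 * m ^ 2 + 13 * e ^ 2) (m := 2 * m) he (by linear_combination 4 * h)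
    (fun q hq hA hB hqe => by
      have h4 : q ∣ 4 * m ^ 2 := by
        have := (hB.sub hA).sub (hqe.mul_right (26 * e))
        ring_nf at this ⊢
        exact this
      rcases hq.dvd_or_dvd h4 with h4 | h4
      · have hq2 : q ∣ 2 := hq.dvd_of_dvd_pow (n := 2) (by norm_num; exact h4)
        exact h2 (((Int.prime_two.dvd_prime_iff_associated hq).2
          ((hq.dvd_prime_iff_associated Int.prime_two).1 hq2).symm).trans hqe)
      · exact hc q hq (hq.dvd_of_dvd_pow h4) hqe)
    (by ring)
    (fun ⟨h3, h3'⟩ => hc 3 Int.prime_three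
      ((Int.prime_three.dvd_or_dvd h3).resolve_left (by norm_num)) h3')
  have hodd' : Odd ((a * b) ^ 2) := by rw [hab]; exact hodd.pow
  have hodd'' : Odd (a * b) := (Int.odd_pow' two_ne_zero).1 hodd'
  obtain ⟨ha, hb⟩ := Int.odd_mul.1 hodd''
  obtain ⟨i, hi⟩ := ha
  obtain ⟨j, hj⟩ := hb
  obtain ⟨c, hcc⟩ : ∃ c, b ^ 2 - 13 * a ^ 2 = 4 * c :=
    ⟨j ^ 2 + j - 13 * (i ^ 2 + i) - 3, by rw [hi, hj]; ring⟩
  rw [hcc] at hm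
  have hm' : m ^ 2 = 2 * (2 * c ^ 2 - 24 * a ^ 4) := by linarith
  obtain ⟨n, rfl⟩ : (2 : ℤ) ∣ m := Int.prime_two.dvd_of_dvd_pow (hm' ▸ dvd_mul_right _ _)
  have hn : (c - n) * (c + n) = 2 * (6 * a ^ 4) := by linarith
  obtain ⟨R, hR⟩ : (2 : ℤ) ∣ c - n := by
    rcases Int.prime_two.dvd_or_dvd (Dvd.intro _ hn.symm : (2 : ℤ) ∣ (c - n) * (c + n))
      with h | h <;> omega
  obtain rfl : c = n + 2 * R := by linarith
  have ha0 : a ≠ 0 := by omega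
  obtain ⟨r, s, hrs, hsum⟩ := sum_of_fourth_powers (R := R) (S := R + n) ha0 (by linarith)
    (fun q hq h1 h3 h4 => hc q hq (((dvd_add_right h1).1 h3).mul_left 2)
      (hq.dvd_of_dvd_pow (n := 2) (hab ▸ dvd_pow (h4.mul_right b) two_ne_zero)))
    ⟨b, by linarith⟩
  exact ⟨b, r, s, by linear_combination -hab - b ^ 2 * hrs, by
    linear_combination 4 * hcc - 52 * hrs + 16 * hsum⟩

/-- Descent on a primitive solution of `N² = m⁴ + 13 m² e² + 48 e⁴` with `e = 2 f` even. -/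
theorem descent_of_even {m f N : ℤ} (he : f ≠ 0)
    (hc : ∀ q : ℤ, Prime q → q ∣ m → q ∣ 2 * f → False)
    (h : N ^ 2 = m ^ 4 + 13 * m ^ 2 * (2 * f) ^ 2 + 48 * (2 * f) ^ 4) :
    ∃ b r s : ℤ, (2 * f) ^ 2 = (b * r * s) ^ 2 ∧
      4 * b ^ 2 = 4 * r ^ 4 + 13 * r ^ 2 * s ^ 2 + 12 * s ^ 4 := by
  have hm2 : ¬ (2 : ℤ) ∣ m := fun h => hc 2 Int.prime_two h (dvd_mul_right _ _)
  have hmodd : Odd m := by rwa [← even_iff_two_dvd, Int.not_even_iff_odd] at hm2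
  have hprod : (N - m ^ 2) * (N + m ^ 2) = 2 * (26 * m ^ 2 * f ^ 2 + 384 * f ^ 4) := by
    linarith
  obtain ⟨A, hA⟩ : (2 : ℤ) ∣ N - m ^ 2 := by
    rcases Int.prime_two.dvd_or_dvd (Dvd.intro _ hprod.symm) with h | h <;> omega
  obtain rfl : N = m ^ 2 + 2 * A := by linarith
  obtain ⟨a, b, hab, hm⟩ := difference_of_fourth_powers (A := A - 13 * f ^ 2)
    (B := A + m ^ 2 + 13 * f ^ 2) (m := m) he (by linarith)
    (fun q hq h1 h2 h3 => by
      have h4 : q ∣ m ^ 2 := by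
        have := (h2.sub h1).sub (h3.mul_right (26 * f))
        ring_nf at this ⊢
        exact this
      exact hc q hq (hq.dvd_of_dvd_pow h4) (h3.mul_left 2))
    (by ring)
    (fun ⟨h3, h3'⟩ => hc 3 Int.prime_three h3 (h3'.mul_left 2))
  obtain ⟨c, hcc⟩ : ∃ c, b ^ 2 - 13 * a ^ 2 = c := ⟨_, rfl⟩
  rw [hcc] at hm
  have hn : (c - m) * (c + m) = 2 * (96 * a ^ 4) := by linarith
  obtain ⟨R, hR⟩ : (2 : ℤ) ∣ c - m := by
    rcases Int.prime_two.dvd_or_dvd (Dvd.intro _ hn.symm : (2 : ℤ) ∣ (c - m) * (c + m))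
      with h | h <;> omega
  obtain rfl : c = m + 2 * R := by linarith
  have ha0 : a ≠ 0 := by
    rintro rfl
    simp at hab
    exact he (pow_eq_zero_iff two_ne_zero |>.1 hab.symm)
  obtain ⟨r, s, hrs, hsum⟩ := sum_of_fourth_powers (R := R) (S := R + m) (k := 2 * a)
    (by omega) (by linarith)
    (fun q hq h1 h3 h4 => hc q hq ((dvd_add_right h1).1 h3) (by
      rcases hq.dvd_or_dvd h4 with h4 | h4
      · exact h4.mul_right f
      · exact (hq.dvd_of_dvd_pow (n := 2)
          (hab ▸ dvd_pow (h4.mul_right b) two_ne_zero)).mul_left 2))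
    ⟨2 * b, by linarith⟩
  exact ⟨b, r, s, by linear_combination -4 * hab - b ^ 2 * hrs, by
    linear_combination 4 * hcc - 13 * hrs + 4 * hsum⟩

/-- The quartic `N² = m⁴ + 13 m² e² + 48 e⁴` has only the integral solutions with `m e = 0`. -/
theorem quartic_no_solution (n : ℕ) : ∀ m e N : ℤ, e.natAbs = n → m ≠ 0 → e ≠ 0 →
    N ^ 2 ≠ m ^ 4 + 13 * m ^ 2 * e ^ 2 + 48 * e ^ 4 := by
  induction n using Nat.strong_induction_on with
  | _ n ih =>
  rintro m e N rfl hm he h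
  have ih' : ∀ m' e' N' : ℤ, e' ^ 2 < e ^ 2 → m' ≠ 0 → e' ≠ 0 →
      N' ^ 2 ≠ m' ^ 4 + 13 * m' ^ 2 * e' ^ 2 + 48 * e' ^ 4 := fun m' e' N' hlt hm' he' =>
    ih _ (Int.natAbs_lt_iff_sq_lt.2 hlt) m' e' N' rfl hm' he'
  by_cases hc : ∀ q : ℤ, Prime q → q ∣ m → q ∣ e → False
  · obtain ⟨b, r, s, h1, K, hK, h2⟩ : ∃ b r s : ℤ, e ^ 2 = (b * r * s) ^ 2 ∧
        ∃ K : ℤ, (K = 1 ∨ K = 4) ∧ 4 * b ^ 2 = K * (4 * r ^ 4 + 13 * r ^ 2 * s ^ 2 + 12 * s ^ 4) := by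
      rcases Int.even_or_odd e with he2 | he2
      · obtain ⟨f, rfl⟩ := even_iff_two_dvd.1 he2
        obtain ⟨b, r, s, h1, h2⟩ := descent_of_even (by omega) hc h
        exact ⟨b, r, s, h1, 1, Or.inl rfl, by linarith⟩
      · obtain ⟨b, r, s, h1, h2⟩ := descent_of_odd he hc h he2
        exact ⟨b, r, s, h1, 4, Or.inr rfl, h2⟩
    have hne : b * r * s ≠ 0 := fun h0 => he (by simpa [h0] using h1)
    obtain ⟨⟨hb, hr⟩, hs⟩ : (b ≠ 0 ∧ r ≠ 0) ∧ s ≠ 0 := by simpa [not_or] using hne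
    have hr1 : 0 < r ^ 2 := by positivity
    have hs1 : 0 < s ^ 2 := by positivity
    have hrs : 0 < r ^ 2 * s ^ 2 := by positivity
    have hr4 : 0 < r ^ 4 := by positivity
    have hs4 : 0 < s ^ 4 := by positivity
    have hb1 : 1 < b ^ 2 := by rcases hK with rfl | rfl <;> linarith
    have hlt : s ^ 2 < e ^ 2 := by
      rw [h1]
      have : 1 < b ^ 2 * r ^ 2 := by nlinarith
      nlinarith
    rcases hK with rfl | rfl
    · exact ih' (2 * r) s (4 * b) hlt (by simpa using hr) hs (by linear_combination 4 * h2)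
    · exact ih' (2 * r) s (2 * b) hlt (by simpa using hr) hs (by linear_combination h2)
  · push Not at hc
    obtain ⟨q, hq, ⟨m', rfl⟩, ⟨e', rfl⟩, -⟩ := hc
    obtain ⟨N', rfl⟩ : q ^ 2 ∣ N := by
      rw [← Int.pow_dvd_pow_iff (two_ne_zero), h]
      exact ⟨m' ^ 4 + 13 * m' ^ 2 * e' ^ 2 + 48 * e' ^ 4, by ring⟩
    have hq0 : q ^ 4 ≠ 0 := pow_ne_zero _ hq.ne_zero
    have he' : e' ≠ 0 := right_ne_zero_of_mul he
    have hq1 : 1 < q ^ 2 := by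
      rw [one_lt_sq_iff_one_lt_abs, Int.abs_eq_natAbs]
      exact_mod_cast (Int.prime_iff_natAbs_prime.1 hq).one_lt
    refine ih' m' e' N' ?_ (right_ne_zero_of_mul hm) he'
      (mul_left_cancel₀ hq0 (by linear_combination h))
    have : 0 < e' ^ 2 := by positivity
    nlinarith

/-- The genus one quotient `v² = (t² - 3t - 1)² - 12` has no affine rational points. -/
theorem genus_one_quotient_no_affine_point (t v : ℚ) : v ^ 2 ≠ (t ^ 2 - 3 * t - 1) ^ 2 - 12 := by
  intro h
  obtain ⟨p, q, hq, hpq, ht⟩ : ∃ p q : ℤ, q ≠ 0 ∧ IsCoprime p q ∧ t = p / q :=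
    ⟨t.num, t.den, by exact_mod_cast t.den_ne_zero, Rat.isCoprime_num_den t,
      by exact_mod_cast (Rat.num_div_den t).symm⟩
  have hqQ : (q : ℚ) ≠ 0 := by exact_mod_cast hq
  have hv : (v * q ^ 2) ^ 2 =
      (((p ^ 2 - 3 * p * q - q ^ 2) ^ 2 - 12 * q ^ 4 : ℤ) : ℚ) := by
    rw [mul_pow, h, ht]
    push_cast
    field_simp
  obtain ⟨V, hV⟩ : ∃ V : ℤ, (V : ℚ) = v * q ^ 2 := by
    have hsq : IsSquare (((p ^ 2 - 3 * p * q - q ^ 2) ^ 2 - 12 * q ^ 4 : ℤ) : ℚ) :=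
      ⟨v * q ^ 2, by rw [← hv]; ring⟩
    rw [Rat.isSquare_intCast_iff] at hsq
    obtain ⟨V, hV⟩ := hsq
    rw [hV, Int.cast_mul, ← sq] at hv
    rcases sq_eq_sq_iff_eq_or_eq_neg.1 hv with h | h
    · exact ⟨V, h.symm⟩
    · exact ⟨-V, by rw [h]; push_cast; ring⟩
  rw [← hV] at hv
  have hVZ : V ^ 2 = (p ^ 2 - 3 * p * q - q ^ 2) ^ 2 - 12 * q ^ 4 := by exact_mod_cast hv
  obtain ⟨Q, hQ⟩ : ∃ Q, p ^ 2 - 3 * p * q - q ^ 2 = Q := ⟨_, rfl⟩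
  rw [hQ] at hVZ
  have hprod : (Q - V) * (Q + V) = 2 * (6 * q ^ 4) := by linarith
  obtain ⟨R, hR⟩ : (2 : ℤ) ∣ Q - V := by
    rcases Int.prime_two.dvd_or_dvd (Dvd.intro _ hprod.symm : (2 : ℤ) ∣ (Q - V) * (Q + V))
      with h | h <;> omega
  obtain rfl : Q = V + 2 * R := by linarith
  obtain ⟨r, s, hrs, hsum⟩ := sum_of_fourth_powers (R := R) (S := R + V) hq (by linarith)
    (fun l hl h1 h2 h3 => by
      have h4 : l ∣ p ^ 2 := by
        have : p ^ 2 = R + (R + V) + q * (3 * p + q) := by linarith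
        rw [this]
        exact (h1.add h2).add (h3.mul_right _)
      exact hl.not_isUnit (hpq.isUnit_of_dvd' (hl.dvd_of_dvd_pow h4) h3))
    ⟨2 * p - 3 * q, by linarith⟩
  have hne : r * s ≠ 0 := fun h0 => hq (by simpa [h0] using hrs.symm)
  refine quartic_no_solution _ (2 * r) s (2 * (2 * p - 3 * q)) rfl
    (mul_ne_zero two_ne_zero (left_ne_zero_of_mul hne)) (right_ne_zero_of_mul hne) ?_
  linear_combination 16 * hQ - 52 * hrs + 16 * hsum

/-- The affine rational points of the hyperelliptic model of the modular curve `X₀(207)*`. -/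
theorem X0_207_star_affine_rational_points (x y : ℚ) :
    y ^ 2 = x ^ 8 - 6 * x ^ 7 + 11 * x ^ 6 - 12 * x ^ 5 + 9 * x ^ 4
        - 12 * x ^ 3 + 11 * x ^ 2 - 6 * x + 1 ↔
      (x, y) = (0, 1) ∨ (x, y) = (0, -1) := by
  constructor
  · intro h
    by_cases hx : x = 0
    · subst hx
      have hy : y ^ 2 = 1 := by linarith
      simpa using hy
    · refine absurd ?_ (genus_one_quotient_no_affine_point (x + 1 / x) (y / x ^ 2))
      rw [div_pow, h]
      field_simp
      ring
  · rintro (h | h) <;> obtain ⟨rfl, rfl⟩ := Prod.mk.inj h <;> norm_num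
end

section
/- The only pairs (x, y) of rational numbers satisfying y^2 = x^8 - 6x^7 + 17x^6 - 38x^5 + 64x^4 - 74x^3 + 73x^2 - 42x + 21 are (1, 4) and (1, -4). -/
/-- If `c * d = a * b` with `c ≠ 0`, the four numbers have a common refinement. -/
lemma exists_refinement_of_mul_eq_mul {a b c d : ℤ} (hc : c ≠ 0) (h : a * b = c * d) :
    ∃ p q r s : ℤ, a = p * q ∧ b = r * s ∧ c = p * r ∧ d = q * s := by
  obtain ⟨p, r, ⟨q, rfl⟩, ⟨s, rfl⟩, rfl⟩ := exists_dvd_and_dvd_of_dvd_mul (Dvd.intro d h.symm)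
  refine ⟨p, q, r, s, rfl, rfl, rfl, ?_⟩
  exact mul_left_cancel₀ hc (by linear_combination -h)

lemma exists_common_factor_of_sq_mul_eq_sq_mul {x y A B : ℤ} (hxy : IsCoprime x y) (hy : y ≠ 0)
    (h : x ^ 2 * A = y ^ 2 * B) : ∃ t : ℤ, A = t * y ^ 2 ∧ B = t * x ^ 2 := by
  obtain ⟨t, rfl⟩ : y ^ 2 ∣ A := (hxy.symm.pow).dvd_of_dvd_mul_left (Dvd.intro B h.symm)
  refine ⟨t, by ring, ?_⟩
  exact mul_left_cancel₀ (pow_ne_zero 2 hy) (by linear_combination -h)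

lemma Int.eq_of_dvd_seven {t : ℤ} (h : t ∣ 7) : t = 1 ∨ t = -1 ∨ t = 7 ∨ t = -7 := by
  have h1 := Int.le_of_dvd (by norm_num) h
  have h2 := Int.le_of_dvd (by norm_num) ((neg_dvd).2 h)
  obtain ⟨u, hu⟩ := h
  have : -7 ≤ t := by linarith
  interval_cases t <;> omega

lemma dvd_of_dvd_mul_sq_of_isCoprime {t a u v : ℤ} (huv : IsCoprime u v) (hu : t ∣ a * u ^ 2)
    (hv : t ∣ a * v ^ 2) : t ∣ a := by
  obtain ⟨i, j, hij⟩ := (huv.pow : IsCoprime (u ^ 2) (v ^ 2))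
  have : a = i * (a * u ^ 2) + j * (a * v ^ 2) := by linear_combination -a * hij
  rw [this]
  exact dvd_add (hu.mul_left _) (hv.mul_left _)

lemma Int.sq_emod_eight_of_odd {a : ℤ} (h : Odd a) : a ^ 2 % 8 = 1 := by
  have := Int.eight_dvd_sq_sub_one_of_odd h
  omega

lemma Int.three_dvd_of_three_dvd_sq_add_sq {a b : ℤ} (h : 3 ∣ a ^ 2 + b ^ 2) :
    3 ∣ a ∧ 3 ∣ b := by
  have key : ∀ u v : ZMod 3, u ^ 2 + v ^ 2 = 0 → u = 0 ∧ v = 0 := by decide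
  have := key a b (by exact_mod_cast (ZMod.intCast_zmod_eq_zero_iff_dvd _ 3).2 (by exact_mod_cast h))
  exact ⟨by exact_mod_cast (ZMod.intCast_zmod_eq_zero_iff_dvd a 3).1 this.1,
    by exact_mod_cast (ZMod.intCast_zmod_eq_zero_iff_dvd b 3).1 this.2⟩

lemma not_three_dvd_and_three_dvd {a b : ℤ} (h : IsCoprime a b) : ¬ (3 ∣ a ∧ 3 ∣ b) := by
  rintro ⟨ha, hb⟩
  have := Int.isUnit_iff.1 (h.isUnit_of_dvd' ha hb)
  omega

/-- Coprime odd solutions of `c ^ 2 - d ^ 2 = 16 * e ^ 2`. -/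
lemma exists_of_sq_sub_sq_eq_sixteen_mul_sq {c d e : ℤ} (hc : Odd c) (hd : Odd d)
    (hcd : IsCoprime c d) (he : e ≠ 0) (h : c ^ 2 - d ^ 2 = 16 * e ^ 2) :
    ∃ U V : ℤ, Odd V ∧ IsCoprime V U ∧ (U * V) ^ 2 = e ^ 2 ∧ c ^ 2 = (4 * U ^ 2 + V ^ 2) ^ 2 := by
  obtain ⟨M, hM⟩ := (hc.sub_odd hd).two_dvd
  obtain ⟨N, hN⟩ := (hc.add_odd hd).two_dvd
  obtain rfl : c = M + N := by omega
  obtain rfl : d = N - M := by omega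
  have hMN : M * N = (2 * e) ^ 2 := by linarith
  have hcop : IsCoprime M N := by
    obtain ⟨i, j, hij⟩ := hcd
    exact ⟨i - j, i + j, by linear_combination hij⟩
  have hpos : 0 < (2 * e) ^ 2 := by positivity
  obtain ⟨s, hs⟩ := Int.sq_of_isCoprime hcop hMN
  obtain ⟨t, ht⟩ := Int.sq_of_isCoprime hcop.symm (by rw [mul_comm]; exact hMN)
  have hc2 : (M + N) ^ 2 = (s ^ 2 + t ^ 2) ^ 2 := by
    rcases hs with rfl | rfl <;> rcases ht with rfl | rfl
    · ring
    · nlinarith [mul_nonneg (sq_nonneg s) (sq_nonneg t)]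
    · nlinarith [mul_nonneg (sq_nonneg s) (sq_nonneg t)]
    · ring
  have hst : (s * t) ^ 2 = (2 * e) ^ 2 := by
    rcases hs with rfl | rfl <;> rcases ht with rfl | rfl
    · linear_combination hMN
    · nlinarith [mul_nonneg (sq_nonneg s) (sq_nonneg t)]
    · nlinarith [mul_nonneg (sq_nonneg s) (sq_nonneg t)]
    · linear_combination hMN
  have hcst : IsCoprime s t := by
    have : IsCoprime (s ^ 2) (t ^ 2) := by
      rcases hs with rfl | rfl <;> rcases ht with rfl | rfl <;>
        simpa only [IsCoprime.neg_left_iff, IsCoprime.neg_right_iff] using hcop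
    exact (IsCoprime.pow_iff (by norm_num) (by norm_num)).1 this
  have hodd : Odd (s ^ 2 + t ^ 2) := by
    have := hc.pow (n := 2)
    rw [hc2] at this
    exact Int.odd_pow' (by norm_num) |>.1 this
  rcases Int.even_or_odd' s with ⟨U, rfl | hU⟩
  · refine ⟨U, t, ?_, ?_, by linarith, by rw [hc2]; ring⟩
    · have : Even ((2 * U) ^ 2) := ⟨2 * U ^ 2, by ring⟩
      exact (Int.odd_pow' (n := 2) (by norm_num)).1 ((Int.odd_add'.1 hodd).2 this)
    · exact (hcst.of_mul_left_right).symm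
  · have hs' : Odd s := ⟨U, hU⟩
    have : Even t := by
      have := (Int.odd_add.1 hodd).1 hs'.pow
      exact (Int.even_pow' (n := 2) (by norm_num)).1 this
    obtain ⟨W, rfl⟩ := this.two_dvd
    exact ⟨W, s, hs', hcst.of_mul_right_right, by linarith, by rw [hc2]; ring⟩

/-- The curve `r ^ 2 = k ^ 4 + k ^ 2 * n ^ 2 + 16 * n ^ 4` has no nontrivial primitive points with
`k` odd, by infinite descent. -/
lemma eq_zero_of_quartic_eq_sq {k n r : ℤ} (hk : Odd k) (hkn : IsCoprime k n)
    (h : k ^ 4 + k ^ 2 * n ^ 2 + 16 * n ^ 4 = r ^ 2) : n = 0 := by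
  induction hN : n.natAbs using Nat.strong_induction_on generalizing k n r with
  | _ N ih =>
  by_contra hn
  have hk0 : k ≠ 0 := by rintro rfl; simp at hk
  have hr : r ≠ 0 := by
    rintro rfl
    have : 0 < k ^ 4 := by positivity
    nlinarith [sq_nonneg (k * n), sq_nonneg (n ^ 2)]
  have step : ∀ n₁ n₂ U V R : ℤ, n = 2 * (n₁ * n₂) → Odd V → IsCoprime V U →
      (U * V) ^ 2 = n₂ ^ 2 → V ^ 4 + V ^ 2 * U ^ 2 + 16 * U ^ 4 = R ^ 2 → False := by
    intro n₁ n₂ U V R hn12 hV hVU hUV hR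
    have h0 : n₂ ≠ 0 := by rintro rfl; simp at hn12; exact hn hn12
    have h1 : n₁ ≠ 0 := by rintro rfl; simp at hn12; exact hn hn12
    have hV0 : V ≠ 0 := by rintro rfl; simp at hV
    have hU0 : U ≠ 0 := by rintro rfl; exact h0 (by simpa using hUV.symm)
    have habs := Int.natAbs_eq_iff_sq_eq.2 hUV
    rw [Int.natAbs_mul] at habs
    have hlt : U.natAbs < N := by
      rw [← hN, hn12, Int.natAbs_mul, Int.natAbs_mul, ← habs]
      have hU1 := Int.natAbs_pos.2 hU0
      have e1 : U.natAbs ≤ U.natAbs * V.natAbs :=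
        Nat.le_mul_of_pos_right _ (Int.natAbs_pos.2 hV0)
      have e2 : U.natAbs * V.natAbs ≤ n₁.natAbs * (U.natAbs * V.natAbs) :=
        Nat.le_mul_of_pos_left _ (Int.natAbs_pos.2 h1)
      rw [show (2 : ℤ).natAbs = 2 from rfl]
      omega
    exact hU0 (ih _ hlt hV hVU hR rfl)
  have hwodd : Odd (k ^ 2 - 4 * n ^ 2) := hk.pow.sub_even ⟨2 * n ^ 2, by ring⟩
  have hk8 := Int.sq_emod_eight_of_odd hk
  have hcop : IsCoprime (k ^ 2 - 4 * n ^ 2) (k * n) := by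
    have h2 : IsCoprime k 2 := by
      obtain ⟨j, rfl⟩ := hk
      exact ⟨1, -j, by ring⟩
    have h4 : IsCoprime k (4 * n ^ 2) := by
      have : IsCoprime k ((2 : ℤ) ^ 2 * n ^ 2) := (h2.pow_right).mul_right hkn.pow_right
      norm_num at this
      exact this
    refine IsCoprime.mul_right ?_ ?_
    · obtain ⟨i, j, hij⟩ := h4
      exact ⟨-j, i + j * k, by linear_combination hij⟩
    · obtain ⟨i, j, hij⟩ := (hkn.pow_left : IsCoprime (k ^ 2) n)
      exact ⟨i, j + i * 4 * n, by linear_combination hij⟩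
  have hn8 : Even n → (k ^ 2 - 4 * n ^ 2) % 8 = 1 := by
    rintro ⟨m, rfl⟩
    have : k ^ 2 - 4 * (m + m) ^ 2 = k ^ 2 - 8 * (2 * m ^ 2) := by ring
    omega
  by_cases h3 : (3 : ℤ) ∣ k ^ 2 - 4 * n ^ 2
  · obtain ⟨w, hw⟩ := h3
    have h3r : (3 : ℤ) ∣ r := by
      refine Int.prime_three.dvd_of_dvd_pow (n := 2) ⟨3 * w ^ 2 + 3 * (k * n) ^ 2, ?_⟩
      rw [← h]
      linear_combination (k ^ 2 - 4 * n ^ 2 + 3 * w) * hw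
    obtain ⟨ρ, rfl⟩ := h3r
    have hpyth : PythagoreanTriple w (k * n) |ρ| := by
      unfold PythagoreanTriple
      rw [abs_mul_abs_self]
      have : 9 * (w * w + k * n * (k * n)) = 9 * (ρ * ρ) := by
        linear_combination h - (k ^ 2 - 4 * n ^ 2 + 3 * w) * hw
      linarith
    have hwo : Odd w := by
      rw [hw] at hwodd
      exact (Int.odd_mul.1 hwodd).2
    have hwc : IsCoprime w (k * n) := by
      rw [hw] at hcop
      exact hcop.of_mul_left_right
    obtain ⟨P, Q, hP, hQ, -, hPQ, hpar, -⟩ := hpyth.coprime_classification'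
      (Int.isCoprime_iff_gcd_eq_one.1 hwc) (Int.odd_iff.1 hwo)
      (abs_pos.2 (by rintro rfl; exact hr rfl))
    have hne : Even n := by
      have : Even (k * n) := ⟨P * Q, by rw [hQ]; ring⟩
      exact (Int.even_mul.1 this).resolve_left (Int.not_even_iff_odd.2 hk)
    have hw8 := hn8 hne
    obtain ⟨n', rfl⟩ := hne.two_dvd
    have hkn' : k * n' = P * Q := by linarith
    have hP0 : P ≠ 0 := by
      rintro rfl
      rw [zero_mul] at hkn'
      rcases mul_eq_zero.1 hkn' with h | h
      · exact hk0 h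
      · exact hn (by rw [h]; rfl)
    obtain ⟨k₁, k₂, n₁, n₂, rfl, rfl, rfl, rfl⟩ := exists_refinement_of_mul_eq_mul hP0 hkn'
    have hn2 : n₂ ≠ 0 := by rintro rfl; simp at hn
    have hko := Int.odd_mul.1 hk
    have hkn'' : IsCoprime (k₁ * k₂) (n₁ * n₂) := hkn.of_mul_right_right
    obtain ⟨t, ht1, ht2⟩ := exists_common_factor_of_sq_mul_eq_sq_mul
      (x := k₁) (y := n₂) (A := k₂ ^ 2 - 3 * n₁ ^ 2) (B := 16 * n₁ ^ 2 - 3 * k₂ ^ 2)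
      hkn''.of_mul_left_left.of_mul_right_right hn2
      (by linear_combination hw + 3 * hP)
    have ht7 : t ∣ 7 := by
      refine dvd_of_dvd_mul_sq_of_isCoprime hkn''.of_mul_left_right.of_mul_right_left
        ⟨16 * n₂ ^ 2 + 3 * k₁ ^ 2, ?_⟩ ⟨3 * n₂ ^ 2 + k₁ ^ 2, ?_⟩
      · linear_combination 16 * ht1 + 3 * ht2
      · linear_combination 3 * ht1 + ht2
    have e1 := Int.sq_emod_eight_of_odd hko.1
    have e2 := Int.sq_emod_eight_of_odd hko.2
    rcases Int.eq_of_dvd_seven ht7 with rfl | rfl | rfl | rfl <;> omega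
  · have hpyth : PythagoreanTriple (k ^ 2 - 4 * n ^ 2) (3 * (k * n)) |r| := by
      unfold PythagoreanTriple
      rw [abs_mul_abs_self]
      linear_combination h
    have hc3 : IsCoprime (k ^ 2 - 4 * n ^ 2) (3 * (k * n)) :=
      IsCoprime.mul_right ((Int.prime_three.coprime_iff_not_dvd.2 h3).symm) hcop
    obtain ⟨P, Q, hP, hQ, -, hPQ, hpar, -⟩ := hpyth.coprime_classification'
      (Int.isCoprime_iff_gcd_eq_one.1 hc3) (Int.odd_iff.1 hwodd) (abs_pos.2 hr)
    have hne : Even n := by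
      have : Even (3 * (k * n)) := ⟨P * Q, by rw [hQ]; ring⟩
      have h' := (Int.even_mul.1 this).resolve_left (by decide)
      exact (Int.even_mul.1 h').resolve_left (Int.not_even_iff_odd.2 hk)
    have hw8 := hn8 hne
    have hPQ' := Int.isCoprime_iff_gcd_eq_one.2 hPQ
    have hPo : Odd P := by
      rcases hpar with ⟨h1, h2⟩ | ⟨h1, -⟩
      · obtain ⟨P', rfl⟩ := (Int.even_iff.2 h1).two_dvd
        have := Int.sq_emod_eight_of_odd (Int.odd_iff.2 h2)
        have e : (2 * P') ^ 2 = 4 * P' ^ 2 := by ring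
        omega
      · exact Int.odd_iff.2 h1
    obtain ⟨n', rfl⟩ := hne.two_dvd
    have hkn' : 3 * (k * n') = P * Q := by linarith
    have hP0 : P ≠ 0 := by rintro rfl; simp at hPo
    rcases Int.prime_three.dvd_or_dvd (Dvd.intro _ hkn') with ⟨P', rfl⟩ | ⟨Q', rfl⟩
    · have hkn3 : k * n' = P' * Q := by linarith
      obtain ⟨k₁, k₂, n₁, n₂, rfl, rfl, rfl, rfl⟩ :=
        exists_refinement_of_mul_eq_mul (by rintro rfl; simp at hP0) hkn3
      have hn2 : n₂ ≠ 0 := by rintro rfl; simp at hn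
      have hko := Int.odd_mul.1 hk
      have hkn'' : IsCoprime (k₁ * k₂) (n₁ * n₂) := hkn.of_mul_right_right
      have hk2n2 := hkn''.of_mul_left_right.of_mul_right_right
      obtain ⟨t, ht1, ht2⟩ := exists_common_factor_of_sq_mul_eq_sq_mul
        (x := k₁) (y := n₂) (A := k₂ ^ 2 - 9 * n₁ ^ 2) (B := 16 * n₁ ^ 2 - k₂ ^ 2)
        hkn''.of_mul_left_left.of_mul_right_right hn2
        (by linear_combination hP)
      have ht7 : t ∣ 7 := by
        refine dvd_of_dvd_mul_sq_of_isCoprime hkn''.of_mul_left_right.of_mul_right_left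
          ⟨16 * n₂ ^ 2 + 9 * k₁ ^ 2, ?_⟩ ⟨n₂ ^ 2 + k₁ ^ 2, ?_⟩
        · linear_combination 16 * ht1 + 9 * ht2
        · linear_combination ht1 + ht2
      have e1 := Int.sq_emod_eight_of_odd hko.1
      have e2 := Int.sq_emod_eight_of_odd hko.2
      rcases Int.eq_of_dvd_seven ht7 with rfl | rfl | rfl | rfl
      · omega
      · exact not_three_dvd_and_three_dvd hk2n2 (Int.three_dvd_of_three_dvd_sq_add_sq
          ⟨3 * n₁ ^ 2, by linear_combination ht1⟩)
      · have h3k2 : ¬ (3 : ℤ) ∣ k₂ := by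
          intro hd
          obtain ⟨z, rfl⟩ := hd
          refine not_three_dvd_and_three_dvd hk2n2 (Int.three_dvd_of_three_dvd_sq_add_sq
            ⟨6 * z ^ 2 - 3 * n₁ ^ 2 - 2 * n₂ ^ 2, ?_⟩)
          linear_combination -ht1
        have hk12 : IsCoprime k₂ k₁ :=
          (hPQ'.of_mul_left_right.of_mul_left_left.of_mul_right_left).symm
        obtain ⟨U, V, hV, hVU, hUV, hc⟩ := exists_of_sq_sub_sq_eq_sixteen_mul_sq
          (c := k₂) (d := 3 * k₁) (e := n₂) hko.2 (Odd.mul (by decide) hko.1)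
          (IsCoprime.mul_right ((Int.prime_three.coprime_iff_not_dvd.2 h3k2).symm) hk12) hn2
          (by linarith)
        exact step n₁ n₂ U V (3 * n₁) rfl hV hVU hUV (by linear_combination -hc + ht1 - 7 * hUV)
      · omega
    · have hkn3 : k * n' = P * Q' := by linarith
      obtain ⟨k₁, k₂, n₁, n₂, rfl, rfl, rfl, rfl⟩ := exists_refinement_of_mul_eq_mul hP0 hkn3
      have hn2 : n₂ ≠ 0 := by rintro rfl; simp at hn
      have hko := Int.odd_mul.1 hk
      have hkn'' : IsCoprime (k₁ * k₂) (n₁ * n₂) := hkn.of_mul_right_right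
      obtain ⟨t, ht1, ht2⟩ := exists_common_factor_of_sq_mul_eq_sq_mul
        (x := k₁) (y := n₂) (A := k₂ ^ 2 - n₁ ^ 2) (B := 16 * n₁ ^ 2 - 9 * k₂ ^ 2)
        hkn''.of_mul_left_left.of_mul_right_right hn2
        (by linear_combination hP)
      have ht7 : t ∣ 7 := by
        refine dvd_of_dvd_mul_sq_of_isCoprime hkn''.of_mul_left_right.of_mul_right_left
          ⟨16 * n₂ ^ 2 + k₁ ^ 2, ?_⟩ ⟨9 * n₂ ^ 2 + k₁ ^ 2, ?_⟩
        · linear_combination 16 * ht1 + ht2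
        · linear_combination 9 * ht1 + ht2
      have e1 := Int.sq_emod_eight_of_odd hko.1
      have e2 := Int.sq_emod_eight_of_odd hko.2
      rcases Int.eq_of_dvd_seven ht7 with rfl | rfl | rfl | rfl
      · omega
      · exact not_three_dvd_and_three_dvd hkn''.of_mul_left_left.of_mul_right_left
          (Int.three_dvd_of_three_dvd_sq_add_sq
          ⟨3 * k₂ ^ 2 - 5 * n₁ ^ 2, by linear_combination ht2⟩)
      · have hk12 : IsCoprime k₂ k₁ :=
          (hPQ'.of_mul_left_left.of_mul_right_right.of_mul_right_left).symm
        obtain ⟨U, V, hV, hVU, hUV, hc⟩ := exists_of_sq_sub_sq_eq_sixteen_mul_sq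
          (c := k₂) (d := k₁) (e := n₂) hko.2 hko.1 hk12 hn2 (by linarith)
        exact step n₁ n₂ U V n₁ rfl hV hVU hUV (by linear_combination -hc + ht1 - 7 * hUV)
      · omega

lemma biquadratic_ne {m n k l : ℤ} (hk : Odd k) (hkn : IsCoprime k n) (hn : Even n) (hn0 : n ≠ 0)
    (hl : l ≠ 0) :
    m ^ 2 * k ^ 2 + n ^ 2 * l ^ 2 + 3 * (m * n * k * l) ≠ k ^ 2 * l ^ 2 + m ^ 2 * n ^ 2 := by
  intro h
  have h1 : (2 * m * (k ^ 2 - n ^ 2) + 3 * n * k * l) ^ 2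
      = l ^ 2 * (4 * k ^ 4 + k ^ 2 * n ^ 2 + 4 * n ^ 4) := by
    linear_combination 4 * (k ^ 2 - n ^ 2) * h
  obtain ⟨R, hR⟩ := (Int.pow_dvd_pow_iff (by norm_num)).1 (Dvd.intro _ h1.symm)
  have h2 : 4 * k ^ 4 + k ^ 2 * n ^ 2 + 4 * n ^ 4 = R ^ 2 :=
    mul_left_cancel₀ (pow_ne_zero 2 hl) (by rw [← h1, hR]; ring)
  obtain ⟨n', rfl⟩ := hn.two_dvd
  have hRe : Even (R ^ 2) := by
    rw [← h2]
    exact ⟨2 * k ^ 4 + 2 * k ^ 2 * n' ^ 2 + 32 * n' ^ 4, by ring⟩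
  obtain ⟨S, rfl⟩ := ((Int.even_pow' (by norm_num)).1 hRe).two_dvd
  have := eq_zero_of_quartic_eq_sq (r := S) hk hkn.of_mul_right_right (by linarith)
  exact hn0 (by rw [this]; rfl)

lemma eq_zero_of_isSquare_of_isSquare {a b : ℤ} (hab : IsCoprime a b)
    (h1 : IsSquare ((a ^ 2 + 3 * a * b + 3 * b ^ 2) * (a ^ 2 - a * b - 5 * b ^ 2)))
    (h2 : IsSquare (a ^ 2 - 8 * b ^ 2)) : b = 0 := by
  by_contra hb
  have hApos : 0 < a ^ 2 + 3 * a * b + 3 * b ^ 2 := by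
    have : 0 < b ^ 2 := by positivity
    nlinarith [sq_nonneg (2 * a + 3 * b)]
  have hnot : ¬ (Even a ∧ Even b) := by
    rintro ⟨ha, hb⟩
    have := Int.isUnit_iff.1 (hab.isUnit_of_dvd' ha.two_dvd hb.two_dvd)
    omega
  have hAodd : Odd (a ^ 2 + 3 * a * b + 3 * b ^ 2) := by
    have h3 : ¬ Even (3 : ℤ) := by decide
    by_cases ha : Even a <;> by_cases hb : Even b <;>
      simp_all [← Int.not_even_iff_odd, parity_simps]
  have hcop : IsCoprime (a ^ 2 + 3 * a * b + 3 * b ^ 2) (a ^ 2 - a * b - 5 * b ^ 2) := by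
    refine isCoprime_of_prime_dvd (fun h => hApos.ne' h.1) fun p hp hA hB => ?_
    have hd : p ∣ 4 * (b * (a + 2 * b)) := by
      have := dvd_sub hA hB
      rwa [show _ - _ = 4 * (b * (a + 2 * b)) by ring] at this
    have hpb : ¬ p ∣ b := fun hpb => by
      have : p ∣ a ^ 2 := by
        have := dvd_sub hA (hpb.mul_left (3 * a + 3 * b))
        rwa [show _ - _ = a ^ 2 by ring] at this
      exact hp.not_isUnit (hab.isUnit_of_dvd' (hp.dvd_of_dvd_pow this) hpb)
    rcases hp.dvd_or_dvd hd with h | h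
    · have h2 : p ∣ 2 := hp.dvd_of_dvd_pow (n := 2) (by norm_num; exact h)
      obtain ⟨j, hj⟩ := hAodd
      rw [hj] at hA
      exact hp.not_isUnit (isUnit_of_dvd_one ((dvd_add_right (h2.mul_right j)).1 hA))
    · rcases hp.dvd_or_dvd h with h | h
      · exact hpb h
      · refine hpb (hp.dvd_of_dvd_pow (n := 2) ?_)
        have := dvd_sub hA (h.mul_right (a + b))
        rwa [show _ - _ = b ^ 2 by ring] at this
  obtain ⟨δ, hδ⟩ := h1
  rw [← sq] at hδ
  obtain ⟨α, hα⟩ : ∃ α, a ^ 2 + 3 * a * b + 3 * b ^ 2 = α ^ 2 := by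
    obtain ⟨α, hα | hα⟩ := Int.sq_of_isCoprime hcop hδ
    · exact ⟨α, hα⟩
    · nlinarith [sq_nonneg α]
  obtain ⟨β, hβ⟩ : ∃ β, a ^ 2 - a * b - 5 * b ^ 2 = β ^ 2 := by
    obtain ⟨β, hβ | hβ⟩ := Int.sq_of_isCoprime hcop.symm (by rw [mul_comm]; exact hδ)
    · exact ⟨β, hβ⟩
    · have : β ^ 2 = 0 := by nlinarith [sq_nonneg β, sq_nonneg δ]
      exact ⟨β, by rw [hβ, this]; rfl⟩
  have hαo : Odd α := by
    rw [hα] at hAodd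
    exact (Int.odd_pow' (by norm_num)).1 hAodd
  have hβo : Odd β := by
    have : Odd (β ^ 2) := by
      have e : β ^ 2 = (a ^ 2 + 3 * a * b + 3 * b ^ 2) - 2 * (2 * (a * b) + 4 * b ^ 2) := by
        rw [← hβ]; ring
      rw [e]
      exact hAodd.sub_even (even_two_mul _)
    exact (Int.odd_pow' (by norm_num)).1 this
  have hα8 := Int.sq_emod_eight_of_odd hαo
  have hβ8 := Int.sq_emod_eight_of_odd hβo
  have hab2 : Odd a ∧ Even b := by
    obtain ⟨γ, hγ⟩ := h2
    rcases Int.even_or_odd b with hbe | hbo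
    · exact ⟨Int.not_even_iff_odd.1 fun ha => hnot ⟨ha, hbe⟩, hbe⟩
    exfalso
    have hb8 := Int.sq_emod_eight_of_odd hbo
    rw [show 3 * a * b = 3 * (a * b) by ring] at hα
    rcases Int.even_or_odd a with hae | hao
    · obtain ⟨a', rfl⟩ := hae.two_dvd
      have e1 : (2 * a') ^ 2 = 4 * a' ^ 2 := by ring
      have e2 : 2 * a' * b = 2 * (a' * b) := by ring
      rw [e1, e2] at hα
      have ha'b : Odd (a' * b) := by rw [Int.odd_iff]; omega
      have ha'8 := Int.sq_emod_eight_of_odd (Int.odd_mul.1 ha'b).1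
      have hγe : Even (γ * γ) := by rw [← hγ, e1, Int.even_iff]; omega
      obtain ⟨γ', rfl⟩ := ((Int.even_mul.1 hγe).elim id id).two_dvd
      have e3 : 2 * γ' * (2 * γ') = 4 * γ' ^ 2 := by ring
      rw [e1, e3] at hγ
      have hγo : Odd (γ' ^ 2) := by rw [Int.odd_iff]; omega
      have hγ8 := Int.sq_emod_eight_of_odd ((Int.odd_pow' (by norm_num)).1 hγo)
      omega
    · have ha8 := Int.sq_emod_eight_of_odd hao
      omega
  obtain ⟨hao, hbe⟩ := hab2
  obtain ⟨M, hM⟩ := (hαo.sub_odd hβo).two_dvd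
  obtain ⟨N, hN⟩ := (hαo.add_odd hβo).two_dvd
  obtain rfl : α = N + M := by omega
  obtain rfl : β = N - M := by omega
  have hco : Odd (a + 2 * b) := hao.add_even (even_two_mul b)
  have hc0 : a + 2 * b ≠ 0 := fun h => by rw [h] at hco; simp at hco
  have hbc : b * (a + 2 * b) = N * M := by linarith
  have hN0 : N ≠ 0 := by
    rintro rfl
    exact (mul_ne_zero hb hc0) (by rw [hbc, zero_mul])
  have hcb : IsCoprime (a + 2 * b) b := by
    obtain ⟨i, j, hij⟩ := hab
    exact ⟨i, j - 2 * i, by linear_combination hij⟩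
  obtain ⟨m, n, k, l, hmn, hkl, rfl, rfl⟩ := exists_refinement_of_mul_eq_mul hN0 hbc
  obtain rfl : a = k * l - 2 * b := by linarith
  subst hmn
  rw [hkl] at hco hc0 hcb
  have hko := Int.odd_mul.1 hco
  rcases Int.even_mul.1 hbe with hm | hn
  · exact biquadratic_ne (m := n) (n := m) (k := l) (l := k) hko.2
      hcb.of_mul_left_right.of_mul_right_left hm (left_ne_zero_of_mul hb)
      (left_ne_zero_of_mul hc0) (by linear_combination -hα)
  · exact biquadratic_ne (m := m) (n := n) (k := k) (l := l) hko.1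
      hcb.of_mul_left_left.of_mul_right_right hn (right_ne_zero_of_mul hb)
      (right_ne_zero_of_mul hc0) (by linear_combination -hα)

/-- The affine rational points of the hyperelliptic model of the modular curve `X₀(252)*`. -/
theorem X0_252_star_affine_rational_points (x y : ℚ) :
    y ^ 2 = x ^ 8 - 6 * x ^ 7 + 17 * x ^ 6 - 38 * x ^ 5 + 64 * x ^ 4
        - 74 * x ^ 3 + 73 * x ^ 2 - 42 * x + 21 ↔
      (x, y) = (1, 4) ∨ (x, y) = (1, -4) := by
  simp only [Prod.mk.injEq]
  constructor
  · intro h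
    by_cases hx : x = 1
    · subst hx
      have : (y - 4) * (y + 4) = 0 := by linear_combination h
      rcases mul_eq_zero.1 this with h | h
      · exact Or.inl ⟨rfl, by linarith⟩
      · exact Or.inr ⟨rfl, by linarith⟩
    exfalso
    obtain ⟨s, rfl⟩ : ∃ s, x = s + 1 := ⟨x - 1, by ring⟩
    have hs : s ≠ 0 := fun h => hx (by rw [h, zero_add])
    obtain ⟨v, hv⟩ : ∃ v, v = s + 2 / s := ⟨_, rfl⟩
    have hd : (v.den : ℚ) ≠ 0 := by exact_mod_cast v.den_ne_zero
    have hvd : v * v.den = v.num := Rat.mul_den_eq_num v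
    have g1 : (v ^ 2 + 3 * v + 3) * (v ^ 2 - v - 5) = (y / s ^ 2) ^ 2 := by
      rw [div_pow, h, hv]
      field_simp
      ring
    have g2 : v ^ 2 - 8 = (s - 2 / s) ^ 2 := by
      rw [hv]
      field_simp
      ring
    have key := eq_zero_of_isSquare_of_isSquare (a := v.num) (b := v.den)
      (Rat.isCoprime_num_den v)
      (by
        rw [← Rat.isSquare_intCast_iff]
        refine ⟨y / s ^ 2 * v.den ^ 2, ?_⟩
        push_cast
        rw [← hvd]
        linear_combination (v.den : ℚ) ^ 4 * g1)
      (by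
        rw [← Rat.isSquare_intCast_iff]
        refine ⟨(s - 2 / s) * v.den, ?_⟩
        push_cast
        rw [← hvd]
        linear_combination (v.den : ℚ) ^ 2 * g2)
    exact v.den_ne_zero (by exact_mod_cast key)
  · rintro (⟨rfl, rfl⟩ | ⟨rfl, rfl⟩) <;> norm_num
end
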